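/- Theorem A (properties of the invariant measure). Let f ∈ Bimod and suppose f preserves a Borel probability measure μ on 𝕋¹ which is absolutely continuous with respect to λ. Then μ is the unique such f-invariant probability measure, μ is equivalent to λ, the system (f, μ) is ergodic, μ is a global physical measure for f (for λ-almost every x ∈ 𝕋¹ and every continuous φ : 𝕋¹ → ℝ, the averages (1/n) Σ_{j=0}^{n-1} φ(f^j(x)) converge to ∫ φ dμ), and μ is hyperbolic: its Lyapunov exponent ∫ log|Df| dμ is strictly positive. -/

import Mathlib

open MeasureTheory Set Filter

noncomputable section

/-- Iterated fractional parts in the continued fraction algorithm: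
`cfFrac ρ 0 = ρ - ⌊ρ⌋` and `cfFrac ρ (k+1) = 1/(cfFrac ρ k) - ⌊1/(cfFrac ρ k)⌋`. -/
noncomputable def cfFrac (ρ : ℝ) : ℕ → ℝ
  | 0 => Int.fract ρ
  | n + 1 => Int.fract (1 / cfFrac ρ n)

/-- Partial quotients `a_k` of the continued fraction expansion of `ρ`. -/
noncomputable def cfA (ρ : ℝ) : ℕ → ℤ
  | 0 => ⌊ρ⌋
  | n + 1 => ⌊1 / cfFrac ρ n⌋

/-- Denominators `q_k` of the convergents of `ρ`:
`q_0 = 1`, `q_1 = a_1` (since `q_{-1} = 0`), `q_{k+1} = a_{k+1} q_k + q_{k-1}`. -/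
noncomputable def cfQ (ρ : ℝ) : ℕ → ℕ
  | 0 => 1
  | 1 => (cfA ρ 1).toNat
  | n + 2 => (cfA ρ (n + 2)).toNat * cfQ ρ (n + 1) + cfQ ρ n
/-- The class `Bimod` of degree one bimodal circle endomorphisms, given by the
circle map `f : 𝕋¹ → 𝕋¹` together with a lift `F : ℝ → ℝ` (`π ∘ F = f ∘ π`,
`F(x+1) = F(x)+1`), satisfying (A1) (`C²`, bimodal with non-flat critical points
`c̃⁺ < c̃⁻` of orders `ℓ⁺, ℓ⁻`), (A2) (the rotation numbers of the upper and lower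
maps `F₊, F₋` are irrational) and (A3) (all periodic orbits are hyperbolic repelling). -/
structure BimodData where
  /-- the lift -/
  F : ℝ → ℝ
  /-- the circle endomorphism -/
  f : UnitAddCircle → UnitAddCircle
  /-- lift of the critical point `c⁺` -/
  ctp : ℝ
  /-- lift of the critical point `c⁻` -/
  ctm : ℝ
  /-- `d̃⁺`, the second preimage of the critical value of `c⁺` -/
  dtp : ℝ
  /-- `d̃⁻`, the second preimage of the critical value of `c⁻` -/
  dtm : ℝ
  /-- the non-flatness order `ℓ⁺` -/
  lp : ℝ
  /-- the non-flatness order `ℓ⁻` -/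
  lm : ℝ
  /-- the upper map `F₊` (a monotone degree one lift) -/
  Fp : CircleDeg1Lift
  /-- the lower map `F₋` (a monotone degree one lift) -/
  Fm : CircleDeg1Lift
  /-- the diffeomorphism `ψ⁺` -/
  psip : ℝ → ℝ
  /-- the diffeomorphism `ψ⁻` -/
  psim : ℝ → ℝ
  hf : ∀ x : ℝ, f ((x : ℝ) : UnitAddCircle) = ((F x : ℝ) : UnitAddCircle)
  h0 : 0 < ctp
  h1 : ctp < ctm
  h2 : ctm < 1
  hlift : ∀ x, F (x + 1) = F x + 1
  hC2 : ContDiff ℝ 2 F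
  hdecr : ∀ x ∈ Set.Ioo ctp ctm, deriv F x < 0
  hincr : ∀ x ∈ Set.Ioo ctm (ctp + 1), 0 < deriv F x
  hlp : 1 < lp
  hlm : 1 < lm
  hpsipC2 : ContDiff ℝ 2 psip
  hpsipBij : Function.Bijective psip
  hpsipD : ∀ x, deriv psip x ≠ 0
  hpsip0 : psip ctp = 0
  hpsipEq : ∀ᶠ x in nhds ctp, F x = F ctp - |psip x| ^ lp
  hpsimC2 : ContDiff ℝ 2 psim
  hpsimBij : Function.Bijective psim
  hpsimD : ∀ x, deriv psim x ≠ 0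
  hpsim0 : psim ctm = 0
  hpsimEq : ∀ᶠ x in nhds ctm, F x = F ctm + |psim x| ^ lm
  hdtp : dtp ∈ Set.Ioo ctm (ctp + 1)
  hdtpF : F dtp = F ctp
  hFp1 : ∀ x ∈ Set.Icc ctp dtp, Fp x = F ctp
  hFp2 : ∀ x ∈ Set.Icc dtp (ctp + 1), Fp x = F x
  hdtm : dtm ∈ Set.Ioo (ctm - 1) ctp
  hdtmF : F dtm = F ctm
  hFm1 : ∀ x ∈ Set.Icc dtm ctm, Fm x = F ctm
  hFm2 : ∀ x ∈ Set.Icc ctm (dtm + 1), Fm x = F x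
  hirrp : Irrational Fp.translationNumber
  hirrm : Irrational Fm.translationNumber
  hA3 : ∀ (x : ℝ) (n : ℕ), 1 ≤ n → (∃ m : ℤ, F^[n] x = x + (m : ℝ)) →
    1 < |deriv (F^[n]) x|

namespace BimodData

/-- The critical point `c⁺ = π(c̃⁺)`. -/
noncomputable def cp (B : BimodData) : UnitAddCircle := ((B.ctp : ℝ) : UnitAddCircle)

/-- The critical point `c⁻ = π(c̃⁻)`. -/
noncomputable def cm (B : BimodData) : UnitAddCircle := ((B.ctm : ℝ) : UnitAddCircle)

/-- The interval `𝕀 = π([c̃⁺, c̃⁻])` on which `f` is decreasing. -/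
def II (B : BimodData) : Set UnitAddCircle :=
  (fun x : ℝ => ((x : ℝ) : UnitAddCircle)) '' Set.Icc B.ctp B.ctm

/-- The upper rotation number `ρ⁺`. -/
noncomputable def rhop (B : BimodData) : ℝ := B.Fp.translationNumber

/-- The lower rotation number `ρ⁻`. -/
noncomputable def rhom (B : BimodData) : ℝ := B.Fm.translationNumber

/-- Condition (C⁻): `Σ_{k≥0} q⁻_{2k+1} · d(f^{q⁻_{2k}}(c⁻), c⁻) < ∞`. -/
def CondCm (B : BimodData) : Prop :=
  Summable fun k : ℕ =>
    (cfQ B.rhom (2 * k + 1) : ℝ) * dist (B.f^[cfQ B.rhom (2 * k)] B.cm) B.cm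

/-- Condition (C⁺): `Σ_{k≥1} q⁺_{2k} · d(f^{q⁺_{2k-1}}(c⁺), c⁺) < ∞`. -/
def CondCp (B : BimodData) : Prop :=
  Summable fun k : ℕ =>
    (cfQ B.rhop (2 * k + 2) : ℝ) * dist (B.f^[cfQ B.rhop (2 * k + 1)] B.cp) B.cp

end BimodData

/-- The derivative of the circle endomorphism `f`, obtained by lifting the
(1-periodic) derivative of the lift `F` to the circle via the fundamental
domain `[0,1)`. -/
noncomputable def BimodData.Df (B : BimodData) : UnitAddCircle → ℝ :=
  AddCircle.liftIco 1 0 (deriv B.F)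

/-- The cross-ratio of four points (length of the whole interval times length of the middle one,
over the product of the lengths of the two outer ones). -/
def crossRatio (a b c d : ℝ) : ℝ := ((d - a) * (c - b)) / ((b - a) * (d - c))

theorem crossRatio_pos {a b c d : ℝ} (h1 : a < b) (h2 : b < c) (h3 : c < d) :
    0 < crossRatio a b c d := by
  unfold crossRatio
  have : 0 < d - a := by linarith
  have : 0 < c - b := by linarith
  have : 0 < b - a := by linarith
  have : 0 < d - c := by linarith
  positivity

theorem crossRatio_reverse (a b c d : ℝ) : crossRatio d c b a = crossRatio a b c d := by
  unfold crossRatio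
  congr 1 <;> ring

theorem crossRatio_neg (a b c d : ℝ) : crossRatio (-a) (-b) (-c) (-d) = crossRatio a b c d := by
  unfold crossRatio
  congr 1 <;> ring

theorem crossRatio_add (a b c d t : ℝ) :
    crossRatio (a + t) (b + t) (c + t) (d + t) = crossRatio a b c d := by
  unfold crossRatio
  congr 1 <;> ring

theorem two_mul_sinh_le_of_one_le {l t : ℝ} (hl : 1 ≤ l) (ht : 1 ≤ t) :
    l * (t - t⁻¹) ≤ t ^ l - t ^ (-l) := by
  have key : MonotoneOn (fun t : ℝ => t ^ l - t ^ (-l) - l * (t - t⁻¹)) (Ici 1) := by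
    have hd : ∀ x ∈ Ici (1 : ℝ), HasDerivAt (fun t : ℝ => t ^ l - t ^ (-l) - l * (t - t⁻¹))
        (l * x ^ (l - 1) - (-l) * x ^ (-l - 1) - l * (1 - -(x ^ 2)⁻¹)) x := by
      intro x hx
      have hx0 : x ≠ 0 := by
        have : (1 : ℝ) ≤ x := hx
        positivity
      exact ((Real.hasDerivAt_rpow_const (Or.inl hx0)).sub
        (Real.hasDerivAt_rpow_const (Or.inl hx0))).sub
        (((hasDerivAt_id x).sub (hasDerivAt_inv hx0)).const_mul l)
    refine monotoneOn_of_deriv_nonneg (convex_Ici 1)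
      (fun x hx => (hd x hx).continuousAt.continuousWithinAt)
      (fun x hx => (hd x (interior_subset hx)).differentiableAt.differentiableWithinAt) ?_
    intro x hx
    have hx1 : (1 : ℝ) ≤ x := interior_subset hx
    rw [(hd x hx1).deriv]
    have hx0 : 0 < x := by linarith
    rw [Real.rpow_sub hx0, Real.rpow_sub hx0, Real.rpow_one, Real.rpow_neg hx0.le]
    have hX : x ≤ x ^ l := by
      simpa using Real.rpow_le_rpow_of_exponent_le hx1 hl
    set X := x ^ l with hXd
    have hXp : 0 < X := by positivity
    have e : l * (X / x) - -l * (X⁻¹ / x) - l * (1 - -(x ^ 2)⁻¹)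
        = l * ((X - x) * (X * x - 1)) / (X * x ^ 2) := by
      field_simp
      ring
    rw [e]
    have : 0 ≤ X * x - 1 := by nlinarith
    have : 0 ≤ X - x := by linarith
    positivity
  have := key (show (1 : ℝ) ∈ Ici 1 by simp) (show t ∈ Ici 1 from ht) ht
  simp at this
  linarith

/-- The geometric mean of the derivatives of a power map is at most its slope. -/
theorem rpow_deriv_mul_le {l x y : ℝ} (hl : 1 ≤ l) (hx : 0 < x) (hxy : x < y) :
    (l * x ^ (l - 1)) * (l * y ^ (l - 1)) * (y - x) ^ 2 ≤ (y ^ l - x ^ l) ^ 2 := by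
  have hy : 0 < y := hx.trans hxy
  set t := Real.sqrt (y / x) with ht
  have ht1 : 1 ≤ t := by
    rw [ht, Real.one_le_sqrt, le_div_iff₀ hx]
    linarith
  have ht0 : 0 < t := by linarith
  have hyt : y = x * t ^ 2 := by
    rw [ht, Real.sq_sqrt (by positivity)]
    field_simp
  have key := two_mul_sinh_le_of_one_le hl ht1
  have ha : 0 ≤ l * (t - t⁻¹) := by
    have : t⁻¹ ≤ 1 := inv_le_one_of_one_le₀ ht1
    have : 0 ≤ t - t⁻¹ := by linarith
    positivity
  have k2 : (l * (t - t⁻¹)) ^ 2 ≤ (t ^ l - t ^ (-l)) ^ 2 := pow_le_pow_left₀ ha key 2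
  have hyl : y ^ l = x ^ l * (t ^ l) ^ 2 := by
    rw [hyt, Real.mul_rpow hx.le (by positivity), ← Real.rpow_natCast, ← Real.rpow_natCast,
      ← Real.rpow_mul ht0.le, ← Real.rpow_mul ht0.le, mul_comm l]
  rw [Real.rpow_sub hx, Real.rpow_sub hy, Real.rpow_one, Real.rpow_one, hyl]
  rw [Real.rpow_neg ht0.le] at k2
  set T := t ^ l with hT
  have hTp : 0 < T := by positivity
  set X := x ^ l with hX
  have hXp : 0 < X := by positivity
  have e1 : l * (X / x) * (l * (X * T ^ 2 / y)) * (y - x) ^ 2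
      = (X * T) ^ 2 * (l * (t - t⁻¹)) ^ 2 := by
    rw [hyt]
    field_simp
  have e2 : (X * T ^ 2 - X) ^ 2 = (X * T) ^ 2 * (T - T⁻¹) ^ 2 := by
    field_simp
  rw [e1, e2]
  gcongr

theorem slope_defect_antitone {l y : ℝ} (hl : 1 ≤ l) {a b : ℝ} (ha : 0 ≤ a) (hab : a < b)
    (hby : b < y) :
    (l * y ^ (l - 1)) / (y ^ l - b ^ l) - 1 / (y - b) ≤
      (l * y ^ (l - 1)) / (y ^ l - a ^ l) - 1 / (y - a) := by
  have hl0 : 0 < l := by linarith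
  have hpos : ∀ x ∈ Icc a b, 0 < y ^ l - x ^ l := fun x hx => by
    have := Real.rpow_lt_rpow (ha.trans hx.1) (hx.2.trans_lt hby) hl0
    linarith
  have hpos' : ∀ x ∈ Icc a b, 0 < y - x := fun x hx => by linarith [hx.2]
  have hy : 0 < y := by linarith
  have key : AntitoneOn (fun x => (l * y ^ (l - 1)) / (y ^ l - x ^ l) - 1 / (y - x)) (Icc a b) := by
    refine antitoneOn_of_deriv_nonpos (convex_Icc a b) ?_ ?_ ?_
    · refine ContinuousOn.sub (ContinuousOn.div continuousOn_const ?_ fun x hx => (hpos x hx).ne')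
        (ContinuousOn.div continuousOn_const (by fun_prop) fun x hx => (hpos' x hx).ne')
      exact continuousOn_const.sub
        (continuousOn_id.rpow_const fun x _ => Or.inr hl0.le)
    all_goals
      intro x hx
      rw [interior_Icc] at hx
      have hx' : x ∈ Icc a b := Ioo_subset_Icc_self hx
      have hx0 : 0 < x := ha.trans_lt hx.1
      have h1 : HasDerivAt (fun x => (l * y ^ (l - 1)) / (y ^ l - x ^ l) - 1 / (y - x))
          ((0 * (y ^ l - x ^ l) - (l * y ^ (l - 1)) * (0 - l * x ^ (l - 1))) / (y ^ l - x ^ l) ^ 2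
            - (0 * (y - x) - 1 * (0 - 1)) / (y - x) ^ 2) x :=
        ((hasDerivAt_const x _).div
          ((hasDerivAt_const x _).sub (Real.hasDerivAt_rpow_const (Or.inl hx0.ne')))
          (hpos x hx').ne').sub
        ((hasDerivAt_const x _).div ((hasDerivAt_const x _).sub (hasDerivAt_id x))
          (hpos' x hx').ne')
    · exact h1.differentiableAt.differentiableWithinAt
    · rw [h1.deriv]
      have := rpow_deriv_mul_le hl hx0 (hx.2.trans hby)
      have p1 := hpos x hx'
      have p2 := hpos' x hx'
      rw [sub_nonpos, div_le_div_iff₀ (by positivity) (by positivity)]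
      nlinarith
  exact key (left_mem_Icc.2 hab.le) (right_mem_Icc.2 hab.le) hab.le

/-- Power maps expand cross-ratios. -/
theorem crossRatio_rpow {l : ℝ} (hl : 1 ≤ l) {a b c d : ℝ} (ha : 0 ≤ a) (hab : a < b)
    (hbc : b < c) (hcd : c < d) :
    crossRatio a b c d ≤ crossRatio (a ^ l) (b ^ l) (c ^ l) (d ^ l) := by
  have hl0 : 0 < l := by linarith
  have hb : 0 < b := by linarith
  have hc : 0 < c := by linarith
  have hd : 0 < d := by linarith
  have lt : ∀ {x y : ℝ}, 0 ≤ x → x < y → x ^ l < y ^ l := fun hx hxy =>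
    Real.rpow_lt_rpow hx hxy hl0
  have key : AntitoneOn (fun y => ((y ^ l - b ^ l) * (y - a)) / ((y ^ l - a ^ l) * (y - b)))
      (Icc c d) := by
    have hder : ∀ y ∈ Icc c d,
        HasDerivAt (fun y => ((y ^ l - b ^ l) * (y - a)) / ((y ^ l - a ^ l) * (y - b)))
        (((l * y ^ (l - 1) * (y - a) + (y ^ l - b ^ l) * 1) * ((y ^ l - a ^ l) * (y - b))
          - (y ^ l - b ^ l) * (y - a) * (l * y ^ (l - 1) * (y - b) + (y ^ l - a ^ l) * 1))
          / ((y ^ l - a ^ l) * (y - b)) ^ 2) y := by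
      intro y hy
      have hy0 : 0 < y := by linarith [hy.1]
      have h1 := (Real.hasDerivAt_rpow_const (p := l) (Or.inl hy0.ne'))
      have hb1 := lt hb.le (hbc.trans_le hy.1)
      have ha1 := lt ha ((hab.trans hbc).trans_le hy.1)
      refine (((h1.sub_const _).mul ((hasDerivAt_id y).sub_const a))).div
        ((h1.sub_const _).mul ((hasDerivAt_id y).sub_const b)) ?_
      have : 0 < y - b := by linarith [hy.1]
      have : 0 < y ^ l - a ^ l := by linarith
      positivity
    refine antitoneOn_of_deriv_nonpos (convex_Icc c d)
      (fun x hx => (hder x hx).continuousAt.continuousWithinAt)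
      (fun x hx => (hder x (interior_subset hx)).differentiableAt.differentiableWithinAt) ?_
    intro y hy
    replace hy := interior_subset hy
    rw [(hder y hy).deriv]
    refine div_nonpos_of_nonpos_of_nonneg ?_ (sq_nonneg _)
    have hb1 : 0 < y ^ l - b ^ l := by linarith [lt hb.le (hbc.trans_le hy.1)]
    have ha1 : 0 < y ^ l - a ^ l := by linarith [lt ha ((hab.trans hbc).trans_le hy.1)]
    have p1 : 0 < y - b := by linarith [hy.1]
    have p2 : 0 < y - a := by linarith [hy.1]
    have := slope_defect_antitone hl ha hab (hbc.trans_le hy.1)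
    set D := l * y ^ (l - 1)
    set P := y ^ l - b ^ l
    set Q := y ^ l - a ^ l
    have e : (D * (y - a) + P * 1) * (Q * (y - b)) - P * (y - a) * (D * (y - b) + Q * 1)
      = (D / P - 1 / (y - b) - (D / Q - 1 / (y - a))) * (P * Q * (y - b) * (y - a)) := by
      field_simp
      ring
    rw [e]
    exact mul_nonpos_of_nonpos_of_nonneg (by linarith) (by positivity)
  have h := key (left_mem_Icc.2 hcd.le) (right_mem_Icc.2 hcd.le) hcd.le
  have q1 := lt ha hab
  have q2 := lt hb.le hbc
  have q3 := lt hc.le hcd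
  unfold crossRatio
  simp only at h
  set A := a ^ l
  set B := b ^ l
  set C := c ^ l
  set E := d ^ l
  have h' := (div_le_div_iff₀ (mul_pos (by linarith : 0 < E - A) (by linarith : 0 < d - b))
    (mul_pos (by linarith : 0 < C - A) (by linarith : 0 < c - b))).1 h
  rw [div_le_div_iff₀ (mul_pos (by linarith) (by linarith)) (mul_pos (by linarith) (by linarith))]
  nlinarith

theorem crossRatio_affine (a b c d v : ℝ) {s : ℝ} (hs : s ≠ 0) :
    crossRatio (v + s * a) (v + s * b) (v + s * c) (v + s * d) = crossRatio a b c d := by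
  unfold crossRatio
  have : ((v + s * d - (v + s * a)) * (v + s * c - (v + s * b)))
      = (s * s) * ((d - a) * (c - b)) := by ring
  rw [this]
  have : ((v + s * b - (v + s * a)) * (v + s * d - (v + s * c)))
      = (s * s) * ((b - a) * (d - c)) := by ring
  rw [this, mul_div_mul_left _ _ (mul_ne_zero hs hs)]

theorem crossRatio_le_of_slope {g : ℝ → ℝ} {a b c d k : ℝ} (h1 : a < b) (h2 : b < c) (h3 : c < d)
    (hpos : 0 < (g b - g a) * (g d - g c))
    (h : k * (((g b - g a) / (b - a)) * ((g d - g c) / (d - c))) ≤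
      ((g d - g a) / (d - a)) * ((g c - g b) / (c - b))) :
    k * crossRatio a b c d ≤ crossRatio (g a) (g b) (g c) (g d) := by
  unfold crossRatio
  have p1 : 0 < b - a := by linarith
  have p2 : 0 < c - b := by linarith
  have p3 : 0 < d - c := by linarith
  have p4 : 0 < d - a := by linarith
  rw [le_div_iff₀ hpos]
  calc k * ((d - a) * (c - b) / ((b - a) * (d - c))) * ((g b - g a) * (g d - g c))
      = (k * (((g b - g a) / (b - a)) * ((g d - g c) / (d - c)))) * ((d - a) * (c - b)) := by
        field_simp
    _ ≤ (((g d - g a) / (d - a)) * ((g c - g b) / (c - b))) * ((d - a) * (c - b)) := by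
        gcongr
    _ = _ := by field_simp

/-- Cross-ratio distortion of a map whose derivative varies by a bounded factor. -/
theorem crossRatio_of_deriv_ratio {g : ℝ → ℝ} {a b c d k : ℝ} (h1 : a < b) (h2 : b < c)
    (h3 : c < d) (hd : ∀ x ∈ Icc a d, DifferentiableAt ℝ g x) (hne : ∀ x ∈ Icc a d, 0 < deriv g x)
    (hk : ∀ x ∈ Icc a d, ∀ y ∈ Icc a d, deriv g x ≤ Real.exp k * deriv g y) :
    Real.exp (-(2 * k)) * crossRatio a b c d ≤ crossRatio (g a) (g b) (g c) (g d) := by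
  have mvt : ∀ x y, a ≤ x → x < y → y ≤ d → ∃ z ∈ Icc a d, deriv g z = (g y - g x) / (y - x) := by
    intro x y hx hxy hy
    obtain ⟨z, hz, e⟩ := exists_deriv_eq_slope g hxy
      (fun t ht => (hd t ⟨hx.trans ht.1, ht.2.trans hy⟩).continuousAt.continuousWithinAt)
      (fun t ht => (hd t ⟨hx.trans ht.1.le, ht.2.le.trans hy⟩).differentiableWithinAt)
    exact ⟨z, ⟨hx.trans hz.1.le, hz.2.le.trans hy⟩, e⟩
  obtain ⟨z1, m1, e1⟩ := mvt a b le_rfl h1 (h2.trans h3).le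
  obtain ⟨z2, m2, e2⟩ := mvt b c h1.le h2 h3.le
  obtain ⟨z3, m3, e3⟩ := mvt c d (h1.trans h2).le h3 le_rfl
  obtain ⟨z4, m4, e4⟩ := mvt a d le_rfl (h1.trans (h2.trans h3)) le_rfl
  refine crossRatio_le_of_slope h1 h2 h3 ?_ ?_
  · have i1 : 0 < g b - g a := by
      have := hne z1 m1
      rw [e1, lt_div_iff₀ (by linarith)] at this
      linarith
    have i3 : 0 < g d - g c := by
      have := hne z3 m3
      rw [e3, lt_div_iff₀ (by linarith)] at this
      linarith
    positivity
  · rw [← e1, ← e2, ← e3, ← e4]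
    have := mul_le_mul (hk z1 m1 z4 m4) (hk z3 m3 z2 m2) (hne z3 m3).le
      (mul_nonneg (Real.exp_pos k).le (hne z4 m4).le)
    calc Real.exp (-(2 * k)) * (deriv g z1 * deriv g z3)
        ≤ Real.exp (-(2 * k)) * (Real.exp k * deriv g z4 * (Real.exp k * deriv g z2)) := by gcongr
      _ = (Real.exp (-(2 * k)) * (Real.exp k * Real.exp k)) * (deriv g z4 * deriv g z2) := by ring
      _ = _ := by
        rw [← Real.exp_add, ← Real.exp_add]
        ring_nf
        simp

/-- The logarithm of a nonvanishing derivative of a `C²` map is Lipschitz on compact intervals. -/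
theorem exists_deriv_ratio_bound {g : ℝ → ℝ} (hg : ContDiff ℝ 2 g) {p q : ℝ}
    (hne : ∀ x ∈ Icc p q, deriv g x ≠ 0) :
    ∃ K, 0 ≤ K ∧ ∀ x ∈ Icc p q, ∀ y ∈ Icc p q,
      |deriv g x| ≤ Real.exp (K * |x - y|) * |deriv g y| := by
  have hg1 : ContDiff ℝ 1 (deriv g) := by
    have : ContDiff ℝ (1 + 1) g := by simpa [one_add_one_eq_two] using hg
    exact (contDiff_succ_iff_deriv.1 this).2.2
  have hc2 : Continuous (deriv (deriv g)) := hg1.continuous_deriv le_rfl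
  rcases (Icc p q).eq_empty_or_nonempty with he | hnon
  · exact ⟨0, le_rfl, fun x hx => by simp [he] at hx⟩
  obtain ⟨M, hM⟩ := (isCompact_Icc (a := p) (b := q)).exists_bound_of_continuousOn hc2.continuousOn
  obtain ⟨z, hz, hmin⟩ := (isCompact_Icc (a := p) (b := q)).exists_isMinOn hnon
    (hg1.continuous.abs.continuousOn)
  set m := |deriv g z| with hm
  have hm0 : 0 < m := abs_pos.2 (hne z hz)
  have hM0 : 0 ≤ M := (norm_nonneg _).trans (hM z hz)
  refine ⟨M / m, by positivity, fun x hx y hy => ?_⟩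
  have hlip : ‖deriv g x - deriv g y‖ ≤ M * ‖x - y‖ :=
    (convex_Icc p q).norm_image_sub_le_of_norm_deriv_le
      (fun t _ => (hg1.differentiable one_ne_zero) t) hM hy hx
  have hmy : m ≤ |deriv g y| := hmin hy
  rw [Real.norm_eq_abs, Real.norm_eq_abs] at hlip
  have h1 : |deriv g x| ≤ |deriv g y| + M * |x - y| := by
    have := abs_sub_abs_le_abs_sub (deriv g x) (deriv g y)
    linarith
  have h2 : M * |x - y| ≤ (M / m * |x - y|) * |deriv g y| := by
    calc M * |x - y| = (M / m * |x - y|) * m := by field_simp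
      _ ≤ _ := by gcongr
  have h3 := Real.add_one_le_exp (M / m * |x - y|)
  calc |deriv g x| ≤ (M / m * |x - y| + 1) * |deriv g y| := by linarith
    _ ≤ _ := by gcongr

/-- Behaviour of a map near a non-flat critical point `c`: one-sided cross-ratio distortion and
one-sided quasi-monotonicity of the derivative. -/
theorem nonflat_local_of_pos {F psi : ℝ → ℝ} {c v s l : ℝ} (hs : s ≠ 0) (hl : 1 < l)
    (hpsi : ContDiff ℝ 2 psi) (hD : ∀ x, 0 < deriv psi x) (h0 : psi c = 0)
    (hF : ∀ᶠ x in nhds c, F x = v + s * |psi x| ^ l) :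
    ∃ δ > 0, ∃ K, 0 ≤ K ∧
      (∀ a b e d, a < b → b < e → e < d → ((c ≤ a ∧ d ≤ c + δ) ∨ (c - δ ≤ a ∧ d ≤ c)) →
        Real.exp (-(K * (d - a))) * crossRatio a b e d ≤ crossRatio (F a) (F b) (F e) (F d)) ∧
      (∀ x y, ((c ≤ x ∧ x ≤ y ∧ y ≤ c + δ) ∨ (c - δ ≤ y ∧ y ≤ x ∧ x ≤ c)) →
        |deriv F x| ≤ K * |deriv F y|) := by
  obtain ⟨δ, hδ, hball⟩ := Metric.eventually_nhds_iff.1 hF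
  have hmono : StrictMono psi := strictMono_of_deriv_pos hD
  have hdiff : Differentiable ℝ psi := hpsi.differentiable (by norm_num)
  obtain ⟨K, hK0, hK⟩ := exists_deriv_ratio_bound hpsi (p := c - δ) (q := c + δ)
    (fun x _ => (hD x).ne')
  simp only [abs_of_pos (hD _)] at hK
  refine ⟨δ / 2, by positivity, max (2 * K) (Real.exp (K * δ)),
    (by positivity : (0:ℝ) ≤ 2 * K).trans (le_max_left _ _), ?_, ?_⟩
  · intro a b e d hab hbe hed hside
    have hmem : ∀ x ∈ Icc a d, F x = v + s * |psi x| ^ l := by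
      intro x hx
      apply hball
      rw [Real.dist_eq, abs_lt]
      rcases hside with h | h <;> constructor <;> linarith [hx.1, hx.2, h.1, h.2]
    have hmem' : ∀ x ∈ Icc a d, x ∈ Icc (c - δ) (c + δ) := by
      intro x hx
      rcases hside with h | h <;> constructor <;> linarith [hx.1, hx.2, h.1, h.2]
    have hcr : Real.exp (-(2 * (K * (d - a)))) * crossRatio a b e d ≤
        crossRatio (psi a) (psi b) (psi e) (psi d) := by
      refine crossRatio_of_deriv_ratio hab hbe hed (fun x _ => hdiff x) (fun x _ => hD x) ?_
      intro x hx y hy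
      refine (hK x (hmem' x hx) y (hmem' y hy)).trans ?_
      have : |x - y| ≤ d - a := by
        rw [abs_le]; constructor <;> linarith [hx.1, hx.2, hy.1, hy.2]
      have := (hD y).le
      gcongr
    have hexp : Real.exp (-(max (2 * K) (Real.exp (K * δ)) * (d - a))) ≤
        Real.exp (-(2 * (K * (d - a)))) := by
      apply Real.exp_le_exp.2
      have : (2 * K) * (d - a) ≤ max (2 * K) (Real.exp (K * δ)) * (d - a) :=
        mul_le_mul_of_nonneg_right (le_max_left _ _) (by linarith)
      linarith
    have hpos := (crossRatio_pos hab hbe hed).le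
    refine (mul_le_mul_of_nonneg_right hexp hpos).trans (hcr.trans ?_)
    rw [hmem a (by constructor <;> linarith), hmem b (by constructor <;> linarith),
      hmem e (by constructor <;> linarith), hmem d (by constructor <;> linarith),
      crossRatio_affine _ _ _ _ _ hs]
    have m1 := hmono hab
    have m2 := hmono hbe
    have m3 := hmono hed
    rcases hside with h | h
    · have : 0 ≤ psi a := by rw [← h0]; exact hmono.monotone h.1
      rw [abs_of_nonneg this, abs_of_nonneg (by linarith : 0 ≤ psi b),
        abs_of_nonneg (by linarith : 0 ≤ psi e), abs_of_nonneg (by linarith : 0 ≤ psi d)]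
      exact crossRatio_rpow hl.le this m1 m2 m3
    · have : psi d ≤ 0 := by rw [← h0]; exact hmono.monotone h.2
      rw [abs_of_nonpos this, abs_of_nonpos (by linarith : psi b ≤ 0),
        abs_of_nonpos (by linarith : psi e ≤ 0), abs_of_nonpos (by linarith : psi a ≤ 0),
        ← crossRatio_neg, ← crossRatio_reverse,
        ← crossRatio_reverse ((-psi a) ^ l)]
      exact crossRatio_rpow hl.le (by linarith) (by linarith) (by linarith) (by linarith)
  · have hderiv : ∀ x, |x - c| < δ → x ≠ c →
        |deriv F x| = |s| * (l * |psi x| ^ (l - 1)) * deriv psi x := by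
      intro x hx hxc
      have hpx : psi x ≠ 0 := by
        rw [← h0]; exact fun h => hxc (hmono.injective h)
      have hev : F =ᶠ[nhds x] fun y => v + s * |psi y| ^ l := by
        have : ∀ᶠ y in nhds x, |y - c| < δ :=
          (isOpen_lt (by fun_prop) continuous_const).mem_nhds hx
        exact this.mono fun y hy => hball (by rwa [Real.dist_eq])
      rw [hev.deriv_eq]
      have hd := ((((hasDerivAt_abs hpx).comp x (hdiff x).hasDerivAt).rpow_const
        (p := l) (Or.inl (abs_ne_zero.2 hpx))).const_mul s).const_add v
      have := hd.deriv
      simp only [Function.comp] at this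
      rw [this]
      have hsgn : |((SignType.sign (psi x) : SignType) : ℝ)| = 1 := by
        rcases lt_or_gt_of_ne hpx with h | h <;> simp [h]
      simp only [abs_mul, hsgn, abs_of_pos (hD x), abs_of_pos (zero_lt_one.trans hl)]
      rw [abs_of_nonneg (by positivity : 0 ≤ |psi x| ^ (l - 1))]
      ring
    have hder0 : deriv F c = 0 := by
      have hlow : s ≤ 0 ∨ 0 ≤ s := le_total s 0
      have hFc : F c = v := by
        rw [hball (by simpa using hδ), h0, abs_zero, Real.zero_rpow (by linarith)]; simp
      rcases hlow with h | h
      · refine IsLocalMax.deriv_eq_zero ?_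
        filter_upwards [hF] with x hx
        rw [hx, hFc]
        have : 0 ≤ |psi x| ^ l := by positivity
        nlinarith
      · refine IsLocalMin.deriv_eq_zero ?_
        filter_upwards [hF] with x hx
        rw [hx, hFc]
        have : 0 ≤ |psi x| ^ l := by positivity
        nlinarith
    intro x y hside
    by_cases hxc : x = c
    · rw [hxc, hder0]; simp only [abs_zero]
      positivity
    have hyc : y ≠ c := by
      rintro rfl
      rcases hside with h | h
      · exact hxc (le_antisymm h.2.1 h.1)
      · exact hxc (le_antisymm h.2.2 h.2.1)
    have hxδ : |x - c| < δ := by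
      rw [abs_lt]; rcases hside with h | h <;> constructor <;> linarith
    have hyδ : |y - c| < δ := by
      rw [abs_lt]; rcases hside with h | h <;> constructor <;> linarith
    rw [hderiv x hxδ hxc, hderiv y hyδ hyc]
    have hab : |psi x| ≤ |psi y| := by
      rcases hside with h | h
      · have i1 := hmono.monotone h.1
        have i2 := hmono.monotone h.2.1
        rw [h0] at i1
        rwa [abs_of_nonneg i1, abs_of_nonneg (i1.trans i2)]
      · have i1 := hmono.monotone h.2.2
        have i2 := hmono.monotone h.2.1
        rw [h0] at i1
        rw [abs_of_nonpos i1, abs_of_nonpos (i2.trans i1)]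
        linarith
    have hpow : |psi x| ^ (l - 1) ≤ |psi y| ^ (l - 1) :=
      Real.rpow_le_rpow (abs_nonneg _) hab (by linarith)
    have hdr : deriv psi x ≤ max (2 * K) (Real.exp (K * δ)) * deriv psi y := by
      rw [abs_lt] at hxδ hyδ
      refine (hK x ⟨by linarith, by linarith⟩ y ⟨by linarith, by linarith⟩).trans ?_
      have : |x - y| ≤ δ := by
        rw [abs_le]; rcases hside with h | h <;> constructor <;> linarith
      refine mul_le_mul_of_nonneg_right (le_max_of_le_right ?_) (hD y).le
      apply Real.exp_le_exp.2
      gcongr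
    have hl0 : 0 ≤ l := by linarith
    have := (hD x).le
    calc |s| * (l * |psi x| ^ (l - 1)) * deriv psi x
        ≤ |s| * (l * |psi y| ^ (l - 1)) * (max (2 * K) (Real.exp (K * δ)) * deriv psi y) := by
          gcongr
      _ = _ := by ring

theorem nonflat_local {F psi : ℝ → ℝ} {c v s l : ℝ} (hs : s ≠ 0) (hl : 1 < l)
    (hpsi : ContDiff ℝ 2 psi) (hD : ∀ x, deriv psi x ≠ 0) (h0 : psi c = 0)
    (hF : ∀ᶠ x in nhds c, F x = v + s * |psi x| ^ l) :
    ∃ δ > 0, ∃ K, 0 ≤ K ∧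
      (∀ a b e d, a < b → b < e → e < d → ((c ≤ a ∧ d ≤ c + δ) ∨ (c - δ ≤ a ∧ d ≤ c)) →
        Real.exp (-(K * (d - a))) * crossRatio a b e d ≤ crossRatio (F a) (F b) (F e) (F d)) ∧
      (∀ x y, ((c ≤ x ∧ x ≤ y ∧ y ≤ c + δ) ∨ (c - δ ≤ y ∧ y ≤ x ∧ x ≤ c)) →
        |deriv F x| ≤ K * |deriv F y|) := by
  have hcont : Continuous (deriv psi) := hpsi.continuous_deriv (by norm_num)
  have hsign : (∀ x, 0 < deriv psi x) ∨ (∀ x, deriv psi x < 0) := by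
    by_contra! h
    obtain ⟨⟨x, hx⟩, ⟨y, hy⟩⟩ := h
    obtain ⟨z, hz⟩ := mem_range_of_exists_le_of_exists_ge hcont ⟨x, hx⟩ ⟨y, hy⟩
    exact hD z hz
  rcases hsign with h | h
  · exact nonflat_local_of_pos hs hl hpsi h h0 hF
  · refine nonflat_local_of_pos (v := v) (psi := fun x => -psi x) hs hl hpsi.neg (fun x => ?_) (by simp [h0]) ?_
    · have : deriv (fun x => -psi x) x = -deriv psi x := deriv.fun_neg
      rw [this]
      linarith [h x]
    · simpa using hF

/-- Cross-ratio distortion on a lap, the map being increasing there. -/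
theorem crossRatio_lap_of_local {F : ℝ → ℝ} {p q δ K : ℝ} (hpq : p < q) (hC2 : ContDiff ℝ 2 F)
    (hpos : ∀ x ∈ Ioo p q, 0 < deriv F x) (hδ : 0 < δ) (hK : 0 ≤ K)
    (hp : ∀ a b e d, a < b → b < e → e < d → p ≤ a → d ≤ p + δ →
        Real.exp (-(K * (d - a))) * crossRatio a b e d ≤ crossRatio (F a) (F b) (F e) (F d))
    (hq : ∀ a b e d, a < b → b < e → e < d → q - δ ≤ a → d ≤ q →
        Real.exp (-(K * (d - a))) * crossRatio a b e d ≤ crossRatio (F a) (F b) (F e) (F d))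
    (hp' : ∀ x y, p ≤ x → x ≤ y → y ≤ p + δ → |deriv F x| ≤ K * |deriv F y|)
    (hq' : ∀ x y, q - δ ≤ y → y ≤ x → x ≤ q → |deriv F x| ≤ K * |deriv F y|) :
    ∃ K', 0 ≤ K' ∧ ∀ a b e d, a < b → b < e → e < d → p ≤ a → d ≤ q →
      Real.exp (-(K' * (d - a))) * crossRatio a b e d ≤ crossRatio (F a) (F b) (F e) (F d) := by
  have hdiff : Differentiable ℝ F := hC2.differentiable (by norm_num)
  have hcd : Continuous (deriv F) := hC2.continuous_deriv (by norm_num)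
  have hmono : StrictMonoOn F (Icc p q) := strictMonoOn_of_deriv_pos (convex_Icc p q)
    hdiff.continuous.continuousOn (by rwa [interior_Icc])
  set η := min (δ / 2) ((q - p) / 4) with hη
  have hη0 : 0 < η := lt_min (by linarith) (by linarith)
  have hη1 : η ≤ δ / 2 := min_le_left _ _
  have hη2 : η ≤ (q - p) / 4 := min_le_right _ _
  obtain ⟨K1, hK1, hr⟩ := exists_deriv_ratio_bound hC2 (p := p + η) (q := q - η)
    (fun x hx => (hpos x ⟨by linarith [hx.1], by linarith [hx.2]⟩).ne')
  obtain ⟨M, hM⟩ := (isCompact_Icc (a := p) (b := q)).exists_bound_of_continuousOn hcd.continuousOn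
  have hM0 : 0 ≤ M := (norm_nonneg _).trans (hM p (left_mem_Icc.2 hpq.le))
  obtain ⟨z, hz, hzmin⟩ := (isCompact_Icc (a := p + η) (b := q - η)).exists_isMinOn
    ⟨p + η, ⟨le_rfl, by linarith⟩⟩ hcd.continuousOn
  have hm : 0 < deriv F z := hpos z ⟨by linarith [hz.1], by linarith [hz.2]⟩
  set m := deriv F z with hmdef
  obtain ⟨w, hw, hwmin⟩ := (isCompact_Icc (a := p) (b := q - η)).exists_isMinOn
    ⟨p, ⟨le_rfl, by linarith⟩⟩ (f := fun t => F (t + η) - F t) (by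
      have := hdiff.continuous
      fun_prop)
  have hm2 : 0 < F (w + η) - F w := by
    have := hmono ⟨hw.1, by linarith [hw.2]⟩ ⟨by linarith [hw.1], by linarith [hw.2]⟩
      (by linarith : w < w + η)
    linarith
  set m2 := F (w + η) - F w with hm2def
  set C := max K (M / m) with hC
  have hC0 : 0 ≤ C := hK.trans (le_max_left _ _)
  have quasi : ∀ x y t, p ≤ x → x < y → y < t → t ≤ q →
      min (deriv F x) (deriv F t) ≤ C * deriv F y := by
    intro x y t hx hxy hyt ht
    have hy : 0 < deriv F y := hpos y ⟨by linarith, by linarith⟩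
    by_cases h1 : y ≤ p + η
    · have := hp' x y hx hxy.le (by linarith)
      rw [abs_of_pos hy] at this
      exact (min_le_left _ _).trans ((le_abs_self _).trans (this.trans
        (mul_le_mul_of_nonneg_right (le_max_left _ _) hy.le)))
    by_cases h2 : q - η ≤ y
    · have := hq' t y (by linarith) hyt.le ht
      rw [abs_of_pos hy] at this
      exact (min_le_right _ _).trans ((le_abs_self _).trans (this.trans
        (mul_le_mul_of_nonneg_right (le_max_left _ _) hy.le)))
    · push Not at h1 h2
      have i1 : m ≤ deriv F y := hzmin ⟨h1.le, h2.le⟩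
      have i2 : deriv F x ≤ M :=
        (le_abs_self _).trans (hM x ⟨hx, by linarith⟩)
      calc min (deriv F x) (deriv F t) ≤ M := (min_le_left _ _).trans i2
        _ = M / m * m := by field_simp
        _ ≤ C * deriv F y := mul_le_mul (le_max_right _ _) i1 hm.le hC0
  have mvt : ∀ x y, p ≤ x → x < y → y ≤ q → ∃ z ∈ Ioo x y, deriv F z = (F y - F x) / (y - x) :=
    fun x y hx hxy hy => exists_deriv_eq_slope F hxy hdiff.continuous.continuousOn
      hdiff.differentiableOn
  set k : ℝ := m2 / (q - p) / ((C + 1) * (M + 1)) with hk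
  have hqp : 0 < q - p := by linarith
  have hk0 : 0 < k := by positivity
  set K4 := |Real.log k| / η with hK4
  have hK40 : 0 ≤ K4 := by positivity
  refine ⟨max (max K (2 * K1)) K4, hK40.trans (le_max_right _ _), ?_⟩
  intro a b e d hab hbe hed hpa hdq
  have hT : 0 < d - a := by linarith
  have hcp := (crossRatio_pos hab hbe hed).le
  have mono : ∀ K2, K2 ≤ max (max K (2 * K1)) K4 →
      Real.exp (-(max (max K (2 * K1)) K4 * (d - a))) * crossRatio a b e d ≤
        Real.exp (-(K2 * (d - a))) * crossRatio a b e d := by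
    intro K2 h
    have := mul_le_mul_of_nonneg_right h hT.le
    gcongr
  by_cases hlong : η ≤ d - a
  · refine (mono K4 (le_max_right _ _)).trans ?_
    have hke : Real.exp (-(K4 * (d - a))) ≤ k := by
      have : |Real.log k| ≤ K4 * (d - a) := by
        calc |Real.log k| = K4 * η := by rw [hK4]; field_simp
          _ ≤ _ := by gcongr
      calc Real.exp (-(K4 * (d - a))) ≤ Real.exp (Real.log k) := by
            apply Real.exp_le_exp.2
            have := neg_abs_le (Real.log k)
            linarith
        _ = k := Real.exp_log hk0
    refine (mul_le_mul_of_nonneg_right hke hcp).trans ?_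
    have i1 := hmono ⟨hpa, by linarith⟩ ⟨by linarith, by linarith⟩ hab
    have i2 := hmono ⟨by linarith, by linarith⟩ ⟨by linarith, by linarith⟩ hbe
    have i3 := hmono ⟨by linarith, by linarith⟩ ⟨by linarith, by linarith⟩ hed
    refine crossRatio_le_of_slope hab hbe hed (mul_pos (by linarith) (by linarith)) ?_
    obtain ⟨z1, y1, e1⟩ := mvt a b hpa hab (by linarith)
    obtain ⟨z2, y2, e2⟩ := mvt b e (by linarith) hbe (by linarith)
    obtain ⟨z3, y3, e3⟩ := mvt e d (by linarith) hed (by linarith)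
    have hTs : m2 / (q - p) ≤ (F d - F a) / (d - a) := by
      have h1 : m2 ≤ F (a + η) - F a := hwmin ⟨hpa, by linarith⟩
      have h2 : F (a + η) ≤ F d :=
        hmono.monotoneOn ⟨by linarith, by linarith⟩ ⟨by linarith, hdq⟩ (by linarith)
      exact div_le_div₀ (by linarith) (by linarith) (by linarith) (by linarith)
    rw [← e1, ← e2, ← e3]
    have p1 : 0 < deriv F z1 := hpos z1 ⟨by linarith [y1.1], by linarith [y1.2]⟩
    have p2 : 0 < deriv F z2 := hpos z2 ⟨by linarith [y2.1], by linarith [y2.2]⟩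
    have p3 : 0 < deriv F z3 := hpos z3 ⟨by linarith [y3.1], by linarith [y3.2]⟩
    have M1 : deriv F z1 ≤ M := (le_abs_self _).trans (hM z1 ⟨by linarith [y1.1], by linarith [y1.2]⟩)
    have M3 : deriv F z3 ≤ M := (le_abs_self _).trans (hM z3 ⟨by linarith [y3.1], by linarith [y3.2]⟩)
    have hprod : deriv F z1 * deriv F z3 ≤ (C * deriv F z2) * M := by
      rcases min_le_iff.1 (quasi z1 z2 z3 (by linarith [y1.1]) (by linarith [y1.2, y2.1])
        (by linarith [y2.2, y3.1]) (by linarith [y3.2])) with h | h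
      · exact mul_le_mul h M3 p3.le (by positivity)
      · rw [mul_comm]
        exact mul_le_mul h M1 p1.le (by positivity)
    have hprod' : deriv F z1 * deriv F z3 ≤ ((C + 1) * (M + 1)) * deriv F z2 := by
      refine hprod.trans ?_
      have : 0 ≤ C * deriv F z2 := by positivity
      nlinarith
    calc k * (deriv F z1 * deriv F z3) ≤ k * (((C + 1) * (M + 1)) * deriv F z2) := by gcongr
      _ = m2 / (q - p) * deriv F z2 := by rw [hk]; field_simp
      _ ≤ _ := by gcongr
  · push Not at hlong
    by_cases h1 : a < p + η
    · exact (mono K ((le_max_left _ _).trans (le_max_left _ _))).trans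
        (hp a b e d hab hbe hed hpa (by linarith))
    by_cases h2 : q - η < d
    · exact (mono K ((le_max_left _ _).trans (le_max_left _ _))).trans
        (hq a b e d hab hbe hed (by linarith) hdq)
    push Not at h1 h2
    refine (mono (2 * K1) ((le_max_right _ _).trans (le_max_left _ _))).trans ?_
    have hp'' : ∀ x ∈ Icc a d, 0 < deriv F x := fun x hx =>
      hpos x ⟨by linarith [hx.1], by linarith [hx.2]⟩
    have := crossRatio_of_deriv_ratio (g := F) (k := K1 * (d - a)) hab hbe hed
      (fun x _ => hdiff x) hp'' (by
        intro x hx y hy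
        have := hr x ⟨by linarith [hx.1], by linarith [hx.2]⟩ y
          ⟨by linarith [hy.1], by linarith [hy.2]⟩
        rw [abs_of_pos (hp'' x hx), abs_of_pos (hp'' y hy)] at this
        refine this.trans ?_
        have hxy : |x - y| ≤ d - a := by
          rw [abs_le]; constructor <;> linarith [hx.1, hx.2, hy.1, hy.2]
        have := (hp'' y hy).le
        gcongr)
    rwa [show 2 * K1 * (d - a) = 2 * (K1 * (d - a)) by ring]

/-- Cross-ratio distortion on a lap with non-flat critical end points. -/
theorem crossRatio_lap {F psi psi' : ℝ → ℝ} {p q v v' s s' l l' : ℝ} (hpq : p < q)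
    (hC2 : ContDiff ℝ 2 F)
    (hsgn : (∀ x ∈ Ioo p q, 0 < deriv F x) ∨ (∀ x ∈ Ioo p q, deriv F x < 0))
    (hs : s ≠ 0) (hl : 1 < l) (hpsi : ContDiff ℝ 2 psi) (hD : ∀ x, deriv psi x ≠ 0)
    (h0 : psi p = 0) (hF : ∀ᶠ x in nhds p, F x = v + s * |psi x| ^ l)
    (hs' : s' ≠ 0) (hl' : 1 < l') (hpsi' : ContDiff ℝ 2 psi') (hD' : ∀ x, deriv psi' x ≠ 0)
    (h0' : psi' q = 0) (hF' : ∀ᶠ x in nhds q, F x = v' + s' * |psi' x| ^ l') :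
    ∃ K, 0 ≤ K ∧ ∀ a b e d, a < b → b < e → e < d → p ≤ a → d ≤ q →
      Real.exp (-(K * (d - a))) * crossRatio a b e d ≤ crossRatio (F a) (F b) (F e) (F d) := by
  wlog hpos : ∀ x ∈ Ioo p q, 0 < deriv F x generalizing F v v' s s'
  · have hneg : ∀ x ∈ Ioo p q, deriv F x < 0 := hsgn.resolve_left hpos
    have e : ∀ x, deriv (fun x => -F x) x = -deriv F x := fun x => deriv.fun_neg
    have := this (F := fun x => -F x) (v := -v) (v' := -v') (s := -s) (s' := -s') hC2.neg
      (Or.inl fun x hx => by rw [e]; linarith [hneg x hx]) (by simpa) (by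
        filter_upwards [hF] with x hx
        rw [hx]; ring) (by simpa) (by
        filter_upwards [hF'] with x hx
        rw [hx]; ring) (fun x hx => by rw [e]; linarith [hneg x hx])
    simpa only [crossRatio_neg] using this
  obtain ⟨δ1, hδ1, K1, hK1, hA1, hB1⟩ := nonflat_local hs hl hpsi hD h0 hF
  obtain ⟨δ2, hδ2, K2, hK2, hA2, hB2⟩ := nonflat_local hs' hl' hpsi' hD' h0' hF'
  have mono : ∀ {Ka a b e d : ℝ}, Ka ≤ max K1 K2 → a < b → b < e → e < d →
      Real.exp (-(max K1 K2 * (d - a))) * crossRatio a b e d ≤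
        Real.exp (-(Ka * (d - a))) * crossRatio a b e d := by
    intro Ka a b e d h hab hbe hed
    have hT : 0 ≤ d - a := by linarith
    have := mul_le_mul_of_nonneg_right h hT
    have := (crossRatio_pos hab hbe hed).le
    gcongr
  refine crossRatio_lap_of_local (δ := min δ1 δ2) (K := max K1 K2) hpq hC2 hpos (lt_min hδ1 hδ2)
    (hK1.trans (le_max_left _ _)) ?_ ?_ ?_ ?_
  · intro a b e d hab hbe hed ha hd
    exact (mono (le_max_left _ _) hab hbe hed).trans
      (hA1 a b e d hab hbe hed (Or.inl ⟨ha, hd.trans (by gcongr; exact min_le_left _ _)⟩))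
  · intro a b e d hab hbe hed ha hd
    exact (mono (le_max_right _ _) hab hbe hed).trans
      (hA2 a b e d hab hbe hed (Or.inr ⟨le_trans (by gcongr; exact min_le_right _ _) ha, hd⟩))
  · intro x y hx hxy hy
    exact (hB1 x y (Or.inl ⟨hx, hxy, hy.trans (by gcongr; exact min_le_left _ _)⟩)).trans
      (by gcongr; exact le_max_left _ _)
  · intro x y hx hxy hy
    exact (hB2 x y (Or.inr ⟨le_trans (by gcongr; exact min_le_right _ _) hx, hxy, hy⟩)).trans
      (by gcongr; exact le_max_right _ _)

namespace BimodData

variable (B : BimodData)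

theorem F_add_int (x : ℝ) (n : ℤ) : B.F (x + n) = B.F x + n := by
  have hnat : ∀ (k : ℕ) (x : ℝ), B.F (x + k) = B.F x + k := by
    intro k
    induction k with
    | zero => simp
    | succ k ih =>
      intro x
      push_cast
      rw [← add_assoc, B.hlift, ih]
      ring
  obtain ⟨k, rfl | rfl⟩ := n.eq_nat_or_neg
  · exact_mod_cast hnat k x
  · have := hnat k (x + ((-(k : ℤ) : ℤ) : ℝ))
    push_cast at this ⊢
    rw [neg_add_cancel_right] at this
    linarith

theorem iterate_add_int (k : ℕ) (x : ℝ) (n : ℤ) : B.F^[k] (x + n) = B.F^[k] x + n := by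
  induction k generalizing x with
  | zero => rfl
  | succ k ih => rw [Function.iterate_succ_apply, F_add_int, ih, Function.iterate_succ_apply]

theorem f_iterate_coe (k : ℕ) (x : ℝ) :
    B.f^[k] (x : UnitAddCircle) = ((B.F^[k] x : ℝ) : UnitAddCircle) := by
  induction k generalizing x with
  | zero => rfl
  | succ k ih => rw [Function.iterate_succ_apply, B.hf, ih, Function.iterate_succ_apply]

theorem continuous_F : Continuous B.F := B.hC2.continuous

theorem differentiable_F : Differentiable ℝ B.F := B.hC2.differentiable (by norm_num)

theorem continuous_deriv_F : Continuous (deriv B.F) := B.hC2.continuous_deriv (by norm_num)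

theorem continuous_f : Continuous B.f := by
  have hq : Topology.IsQuotientMap (fun x : ℝ => (x : UnitAddCircle)) :=
    QuotientAddGroup.isQuotientMap_mk _
  rw [hq.continuous_iff]
  have : B.f ∘ (fun x : ℝ => (x : UnitAddCircle)) = fun x => ((B.F x : ℝ) : UnitAddCircle) := by
    funext x; exact B.hf x
  rw [this]
  exact hq.continuous.comp B.continuous_F

theorem measurable_f : Measurable B.f := B.continuous_f.measurable

theorem deriv_add_int (x : ℝ) (n : ℤ) : deriv B.F (x + n) = deriv B.F x := by
  have h : (fun y => B.F (y + n)) = fun y => B.F y + n := by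
    funext y; exact B.F_add_int y n
  have h1 : deriv (fun y => B.F (y + n)) x = deriv B.F (x + n) := deriv_comp_add_const _ _ _
  rw [← h1, h, deriv_add_const]

theorem exists_coe_eq (x : UnitAddCircle) : ∃ y : ℝ, (y : UnitAddCircle) = x :=
  QuotientAddGroup.mk_surjective x

theorem coe_eq_coe_iff {x y : ℝ} : (x : UnitAddCircle) = y ↔ ∃ n : ℤ, y = x + n := by
  have : ((y - x : ℝ) : UnitAddCircle) = 0 ↔ ∃ n : ℤ, n • (1 : ℝ) = y - x :=
    AddCircle.coe_eq_zero_iff (1 : ℝ)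
  rw [AddCircle.coe_sub, sub_eq_zero, eq_comm] at this
  rw [this]
  refine exists_congr fun n => ?_
  rw [zsmul_eq_mul, mul_one]
  constructor <;> intro h <;> linarith

theorem coe_add_int (x : ℝ) (n : ℤ) : ((x + n : ℝ) : UnitAddCircle) = x :=
  (coe_eq_coe_iff.2 ⟨n, rfl⟩).symm

theorem Df_coe (x : ℝ) : B.Df (x : UnitAddCircle) = deriv B.F x := by
  have h1 : ((Int.fract x : ℝ) : UnitAddCircle) = x := coe_eq_coe_iff.2 ⟨⌊x⌋, by
    rw [Int.fract_add_floor]⟩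
  rw [← h1, Df, AddCircle.liftIco_zero_coe_apply ⟨Int.fract_nonneg x, Int.fract_lt_one x⟩]
  conv_rhs => rw [← Int.fract_add_floor x, B.deriv_add_int]

theorem continuous_Df : Continuous B.Df := by
  have hq : Topology.IsQuotientMap (fun x : ℝ => (x : UnitAddCircle)) :=
    QuotientAddGroup.isQuotientMap_mk _
  rw [hq.continuous_iff]
  have : B.Df ∘ (fun x : ℝ => (x : UnitAddCircle)) = deriv B.F := by
    funext x; exact B.Df_coe x
  rw [this]
  exact B.continuous_deriv_F

theorem exists_deriv_bound : ∃ M, 0 < M ∧ ∀ x, |deriv B.F x| ≤ M := by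
  obtain ⟨M, hM⟩ := (isCompact_Icc (a := (0:ℝ)) (b := 1)).exists_bound_of_continuousOn
    B.continuous_deriv_F.continuousOn
  refine ⟨max M 1, by positivity, fun x => ?_⟩
  rw [← Int.fract_add_floor x, B.deriv_add_int]
  exact (hM _ ⟨Int.fract_nonneg x, (Int.fract_lt_one x).le⟩).trans (le_max_left _ _)

theorem hpsipEq' : ∀ᶠ x in nhds B.ctp, B.F x = B.F B.ctp + (-1) * |B.psip x| ^ B.lp := by
  filter_upwards [B.hpsipEq] with x hx
  rw [hx]; ring

theorem hpsimEq' : ∀ᶠ x in nhds B.ctm, B.F x = B.F B.ctm + 1 * |B.psim x| ^ B.lm := by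
  filter_upwards [B.hpsimEq] with x hx
  rw [hx]; ring

theorem deriv_ctp : deriv B.F B.ctp = 0 := by
  refine IsLocalMax.deriv_eq_zero ?_
  filter_upwards [B.hpsipEq] with x hx
  rw [hx]
  have : 0 ≤ |B.psip x| ^ B.lp := by positivity
  linarith

theorem deriv_ctm : deriv B.F B.ctm = 0 := by
  refine IsLocalMin.deriv_eq_zero ?_
  filter_upwards [B.hpsimEq] with x hx
  rw [hx]
  have : 0 ≤ |B.psim x| ^ B.lm := by positivity
  linarith

theorem exists_int_mem_Ico (x t : ℝ) : ∃ n : ℤ, x + n ∈ Ico t (t + 1) := by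
  refine ⟨-⌊x - t⌋, ?_, ?_⟩
  · have := Int.floor_le (x - t); push_cast; linarith
  · have := Int.lt_floor_add_one (x - t); push_cast; linarith

theorem deriv_eq_zero_iff (x : ℝ) :
    deriv B.F x = 0 ↔ ∃ n : ℤ, x = B.ctp + n ∨ x = B.ctm + n := by
  constructor
  · intro h
    obtain ⟨n, hn⟩ := exists_int_mem_Ico x B.ctp
    have hx : deriv B.F (x + n) = 0 := by rw [B.deriv_add_int, h]
    have := B.h1
    refine ⟨-n, ?_⟩
    push_cast
    by_contra! hne
    rcases lt_trichotomy (x + n) B.ctm with h3 | h3 | h3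
    · have : B.ctp < x + n := lt_of_le_of_ne hn.1 fun e => hne.1 (by rw [e]; ring)
      exact (B.hdecr _ ⟨this, h3⟩).ne hx
    · exact hne.2 (by rw [← h3]; ring)
    · exact (B.hincr _ ⟨h3, hn.2⟩).ne' hx
  · rintro ⟨n, rfl | rfl⟩
    · rw [B.deriv_add_int, B.deriv_ctp]
    · rw [B.deriv_add_int, B.deriv_ctm]

/-- An interval without critical points in its interior is contained in a lap. -/
theorem exists_lap {a d : ℝ} (h : ∀ x ∈ Ioo a d, deriv B.F x ≠ 0) :
    ∃ n : ℤ, (B.ctp + n ≤ a ∧ d ≤ B.ctm + n) ∨ (B.ctm + n ≤ a ∧ d ≤ B.ctp + 1 + n) := by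
  obtain ⟨n, hn⟩ := exists_int_mem_Ico a B.ctp
  have h1 := B.h1
  refine ⟨-n, ?_⟩
  push_cast
  rcases lt_or_ge (a + n) B.ctm with hlt | hge
  · left
    refine ⟨by linarith [hn.1], ?_⟩
    by_contra! hd
    exact h (B.ctm + ((-n : ℤ) : ℝ)) ⟨by push_cast; linarith, by push_cast; linarith⟩
      (by rw [B.deriv_add_int, B.deriv_ctm])
  · right
    refine ⟨by linarith [hn.1], ?_⟩
    by_contra! hd
    exact h (B.ctp + ((1 - n : ℤ) : ℝ)) ⟨by push_cast; linarith [hn.2], by push_cast; linarith⟩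
      (by rw [B.deriv_add_int, B.deriv_ctp])

/-- Cross-ratio distortion of the lift on intervals without critical points. -/
theorem exists_crossRatio_bound : ∃ K, 0 ≤ K ∧ ∀ a b e d, a < b → b < e → e < d →
    (∀ x ∈ Ioo a d, deriv B.F x ≠ 0) →
    Real.exp (-(K * (d - a))) * crossRatio a b e d ≤
      crossRatio (B.F a) (B.F b) (B.F e) (B.F d) := by
  obtain ⟨K1, hK1, H1⟩ := crossRatio_lap B.h1 B.hC2 (Or.inr B.hdecr) (by norm_num : (-1:ℝ) ≠ 0)
    B.hlp B.hpsipC2 B.hpsipD B.hpsip0 B.hpsipEq' one_ne_zero B.hlm B.hpsimC2 B.hpsimD B.hpsim0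
    B.hpsimEq'
  have hs : ContDiff ℝ 2 (fun x => B.psip (x - 1)) := B.hpsipC2.comp (contDiff_id.sub contDiff_const)
  have hsD : ∀ x, deriv (fun x => B.psip (x - 1)) x ≠ 0 := fun x => by
    rw [deriv_comp_sub_const]; exact B.hpsipD _
  have hsE : ∀ᶠ x in nhds (B.ctp + 1),
      B.F x = (B.F B.ctp + 1) + (-1) * |B.psip (x - 1)| ^ B.lp := by
    have ht : Tendsto (fun x : ℝ => x - 1) (nhds (B.ctp + 1)) (nhds B.ctp) := by
      have : Continuous fun x : ℝ => x - 1 := by fun_prop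
      simpa using this.tendsto (B.ctp + 1)
    filter_upwards [ht.eventually B.hpsipEq'] with x hx
    have := B.hlift (x - 1)
    rw [sub_add_cancel] at this
    rw [this, hx]; ring
  obtain ⟨K2, hK2, H2⟩ := crossRatio_lap (by linarith [B.h0, B.h2] : B.ctm < B.ctp + 1) B.hC2
    (Or.inl B.hincr) one_ne_zero B.hlm B.hpsimC2 B.hpsimD B.hpsim0 B.hpsimEq'
    (by norm_num : (-1:ℝ) ≠ 0) B.hlp hs hsD (by simp [B.hpsip0]) hsE
  refine ⟨max K1 K2, hK1.trans (le_max_left _ _), ?_⟩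
  intro a b e d hab hbe hed h
  have hT : 0 ≤ d - a := by linarith
  have hcp := (crossRatio_pos hab hbe hed).le
  have mono : ∀ Ka, Ka ≤ max K1 K2 →
      Real.exp (-(max K1 K2 * (d - a))) * crossRatio a b e d ≤
        Real.exp (-(Ka * (d - a))) * crossRatio a b e d := by
    intro Ka h
    have := mul_le_mul_of_nonneg_right h hT
    gcongr
  obtain ⟨n, ⟨h1, h2⟩ | ⟨h1, h2⟩⟩ := B.exists_lap h
  · have := H1 (a + ((-n : ℤ) : ℝ)) (b + ((-n : ℤ) : ℝ)) (e + ((-n : ℤ) : ℝ)) (d + ((-n : ℤ) : ℝ))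
      (by linarith) (by linarith) (by linarith) (by push_cast; linarith) (by push_cast; linarith)
    simp only [B.F_add_int, crossRatio_add, add_sub_add_right_eq_sub] at this
    exact (mono _ (le_max_left _ _)).trans this
  · have := H2 (a + ((-n : ℤ) : ℝ)) (b + ((-n : ℤ) : ℝ)) (e + ((-n : ℤ) : ℝ)) (d + ((-n : ℤ) : ℝ))
      (by linarith) (by linarith) (by linarith) (by push_cast; linarith) (by push_cast; linarith)
    simp only [B.F_add_int, crossRatio_add, add_sub_add_right_eq_sub] at this
    exact (mono _ (le_max_right _ _)).trans this

theorem contDiff_iterate (n : ℕ) : ContDiff ℝ 2 (B.F^[n]) := by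
  induction n with
  | zero => exact contDiff_id
  | succ n ih => rw [Function.iterate_succ']; exact B.hC2.comp ih

theorem continuous_iterate (n : ℕ) : Continuous (B.F^[n]) := (B.contDiff_iterate n).continuous

theorem hasDerivAt_iterate (n : ℕ) (x : ℝ) :
    HasDerivAt (B.F^[n]) (∏ i ∈ Finset.range n, deriv B.F (B.F^[i] x)) x := by
  induction n with
  | zero => simpa using hasDerivAt_id x
  | succ n ih =>
    rw [Function.iterate_succ', Finset.prod_range_succ, mul_comm]
    exact (B.differentiable_F _).hasDerivAt.comp x ih

/-- An iterate without critical points in an open interval is strictly monotone on its closure. -/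
theorem strictMonoOn_or_strictAntiOn_iterate {a d : ℝ} {n : ℕ}
    (h : ∀ i < n, ∀ x ∈ Ioo a d, deriv B.F (B.F^[i] x) ≠ 0) :
    StrictMonoOn (B.F^[n]) (Icc a d) ∨ StrictAntiOn (B.F^[n]) (Icc a d) := by
  have hne : ∀ x ∈ Ioo a d, deriv (B.F^[n]) x ≠ 0 := fun x hx => by
    rw [(B.hasDerivAt_iterate n x).deriv, Finset.prod_ne_zero_iff]
    intro i hi
    exact h i (Finset.mem_range.1 hi) x hx
  have hc : Continuous (deriv (B.F^[n])) := (B.contDiff_iterate n).continuous_deriv (by norm_num)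
  have hsign : (∀ x ∈ Ioo a d, 0 < deriv (B.F^[n]) x) ∨ (∀ x ∈ Ioo a d, deriv (B.F^[n]) x < 0) := by
    by_contra! hcon
    obtain ⟨⟨x, hx, hx'⟩, ⟨y, hy, hy'⟩⟩ := hcon
    obtain ⟨z, hz, hz'⟩ := isPreconnected_Ioo.intermediate_value hx hy hc.continuousOn ⟨hx', hy'⟩
    exact hne z hz hz'
  rcases hsign with h | h
  · exact Or.inl (strictMonoOn_of_deriv_pos (convex_Icc a d) (B.continuous_iterate n).continuousOn
      (by rwa [interior_Icc]))
  · exact Or.inr (strictAntiOn_of_deriv_neg (convex_Icc a d) (B.continuous_iterate n).continuousOn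
      (by rwa [interior_Icc]))

end BimodData

/-- Iterates of the end point of the plateau of an upper or lower map coincide with the iterates
under the original map, and never come back to the plateau. -/
theorem plateau_orbit {F : ℝ → ℝ} {G : CircleDeg1Lift} {p q c : ℝ}
    (hF : ∀ (x : ℝ) (n : ℤ), F (x + n) = F x + n)
    (hG1 : ∀ x ∈ Icc p q, G x = F c) (hG2 : ∀ x ∈ Icc q (p + 1), G x = F x)
    (hirr : Irrational G.translationNumber) (k : ℕ) :
    F^[k] (F c) = (G ^ k) (F c) ∧ ∀ j : ℤ, F^[k] (F c) + j ∉ Icc p q := by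
  have not_mem : ∀ (k : ℕ) (j : ℤ), (G ^ k) (F c) + j ∉ Icc p q := by
    intro k j hj
    have h1 : (G ^ (k + 1)) (F c) = F c + ((-j : ℤ) : ℝ) := by
      rw [pow_succ', CircleDeg1Lift.mul_apply]
      have := hG1 _ hj
      rw [CircleDeg1Lift.map_add_int] at this
      push_cast
      linarith
    have := CircleDeg1Lift.translationNumber_of_map_pow_eq_add_int (f := G) h1 (Nat.succ_pos k)
    apply hirr
    rw [this]
    exact ⟨((-j : ℤ) : ℚ) / ((k + 1 : ℕ) : ℚ), by push_cast; rfl⟩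
  have heq : F^[k] (F c) = (G ^ k) (F c) := by
    induction k with
    | zero => rfl
    | succ k ih =>
      rw [Function.iterate_succ_apply', ih, pow_succ', CircleDeg1Lift.mul_apply]
      obtain ⟨n, hn⟩ := BimodData.exists_int_mem_Ico ((G ^ k) (F c)) p
      have hq : q ≤ (G ^ k) (F c) + n := by
        by_contra! h
        exact not_mem k n ⟨hn.1, h.le⟩
      have := hG2 _ ⟨hq, hn.2.le⟩
      rw [CircleDeg1Lift.map_add_int, hF] at this
      linarith
  exact ⟨heq, heq ▸ not_mem k⟩

namespace BimodData

variable (B : BimodData)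

theorem orbit_ctp (k : ℕ) : B.F^[k] (B.F B.ctp) = (B.Fp ^ k) (B.F B.ctp) ∧
    ∀ j : ℤ, B.F^[k] (B.F B.ctp) + j ∉ Icc B.ctp B.dtp :=
  plateau_orbit B.F_add_int B.hFp1 B.hFp2 B.hirrp k

theorem orbit_ctm (k : ℕ) : B.F^[k] (B.F B.ctm) = (B.Fm ^ k) (B.F B.ctm) ∧
    ∀ j : ℤ, B.F^[k] (B.F B.ctm) + j ∉ Icc B.dtm B.ctm :=
  plateau_orbit B.F_add_int B.hFm1 B.hFm2 B.hirrm k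

theorem exists_irrational_tendsto {c : ℝ} (hc : deriv B.F c = 0) :
    ∃ ρ : ℝ, Irrational ρ ∧ Tendsto (fun k : ℕ => B.F^[k] c / k) atTop (nhds ρ) := by
  have aux : ∀ (G : CircleDeg1Lift) (p : ℝ) (m : ℤ),
      (∀ k, B.F^[k] (B.F p) = (G ^ k) (B.F p)) →
      Tendsto (fun k : ℕ => B.F^[k] (p + m) / k) atTop (nhds G.translationNumber) := by
    intro G p m hk
    rw [← tendsto_add_atTop_iff_nat 1]
    have h1 := (G.tendsto_translationNumber (B.F p))
    have h2 : Tendsto (fun k : ℕ => ((k : ℝ) + 1)⁻¹) atTop (nhds 0) :=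
      tendsto_inv_atTop_zero.comp (tendsto_atTop_add_const_right _ _ tendsto_natCast_atTop_atTop)
    have h3 : Tendsto (fun k : ℕ => (((G ^ k) (B.F p) - B.F p) / k) * (1 - ((k : ℝ) + 1)⁻¹)
        + (B.F p + m) * ((k : ℝ) + 1)⁻¹) atTop
        (nhds (G.translationNumber * (1 - 0) + (B.F p + m) * 0)) :=
      (h1.mul (tendsto_const_nhds.sub h2)).add (tendsto_const_nhds.mul h2)
    simp only [sub_zero, mul_one, mul_zero, add_zero] at h3
    refine h3.congr' ?_
    filter_upwards [eventually_gt_atTop 0] with k hk0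
    rw [B.iterate_add_int, Function.iterate_succ_apply, hk]
    have : (k : ℝ) ≠ 0 := by positivity
    push_cast
    field_simp
    ring
  obtain ⟨m, rfl | rfl⟩ := (B.deriv_eq_zero_iff c).1 hc
  · exact ⟨_, B.hirrp, aux B.Fp B.ctp m fun k => (B.orbit_ctp k).1⟩
  · exact ⟨_, B.hirrm, aux B.Fm B.ctm m fun k => (B.orbit_ctm k).1⟩

/-- Critical orbits have no rational rotation number. -/
theorem critical_orbit_unbounded {c : ℝ} (hc : deriv B.F c = 0) {n : ℕ} (hn : 1 ≤ n) (j : ℤ)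
    (C : ℝ) (h : ∀ k : ℕ, |B.F^[n * k] c - k * j| ≤ C) : False := by
  obtain ⟨ρ, hirr, ht⟩ := B.exists_irrational_tendsto hc
  have hn0 : (0 : ℝ) < n := by exact_mod_cast hn
  have h1 : Tendsto (fun k : ℕ => n * k) atTop atTop :=
    tendsto_id.const_mul_atTop' (by omega)
  have h2 := ht.comp h1
  have h3 : Tendsto (fun k : ℕ => (B.F^[n * k] c - k * j) / ((n * k : ℕ) : ℝ)) atTop (nhds 0) := by
    refine squeeze_zero_norm (a := fun k : ℕ => C / ((n * k : ℕ) : ℝ)) (fun k => ?_) ?_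
    · rw [norm_div, Real.norm_eq_abs, Real.norm_natCast]
      gcongr
      exact h k
    · exact tendsto_const_nhds.div_atTop (tendsto_natCast_atTop_atTop.comp h1)
  have h4 := h2.sub h3
  have h5 : Tendsto (fun k : ℕ => (j : ℝ) / n) atTop (nhds (ρ - 0)) := by
    refine h4.congr' ?_
    filter_upwards [eventually_gt_atTop 0] with k hk
    simp only [Function.comp]
    have : (k : ℝ) ≠ 0 := by positivity
    push_cast
    field_simp
    ring
  have := tendsto_nhds_unique h5 tendsto_const_nhds
  apply hirr
  refine ⟨(j : ℚ) / n, ?_⟩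
  push_cast
  linarith

/-- A differentiable self-map of a compact interval cannot have all its fixed points repelling
with derivative greater than one. -/
theorem not_all_fixed_repelling {H : ℝ → ℝ} {α β : ℝ} (hαβ : α < β)
    (hH : Continuous H) (hmaps : ∀ x ∈ Icc α β, H x ∈ Icc α β)
    (hfix : ∀ x ∈ Icc α β, H x = x → ∃ m, 1 < m ∧ HasDerivAt H m x) : False := by
  have side : ∀ x m, 1 < m → HasDerivAt H m x → H x = x →
      ∀ᶠ y in nhds x, y ≠ x → 0 < (H y - y) / (y - x) := by
    intro x m hm hd hx
    have h1 := hd.sub (hasDerivAt_id x)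
    have h2 := hasDerivAt_iff_tendsto_slope.1 h1
    have h3 := h2.eventually (lt_mem_nhds (by linarith : (0:ℝ) < m - 1))
    rw [eventually_nhdsWithin_iff] at h3
    filter_upwards [h3] with y hy hne
    have := hy hne
    rw [slope_def_field] at this
    simpa [hx] using this
  obtain ⟨p, hp, hpβ, hpH⟩ : ∃ p, α ≤ p ∧ p < β ∧ p < H p := by
    rcases (hmaps α (left_mem_Icc.2 hαβ.le)).1.lt_or_eq with h | h
    · exact ⟨α, le_rfl, hαβ, h⟩
    · obtain ⟨m, hm, hd⟩ := hfix α (left_mem_Icc.2 hαβ.le) h.symm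
      have h1 := (side α m hm hd h.symm).filter_mono (nhdsWithin_le_nhds (s := Ioi α))
      have h2 : ∀ᶠ y in nhdsWithin α (Ioi α), y ∈ Ioo α β := Ioo_mem_nhdsGT hαβ
      obtain ⟨y, hy1, hy2⟩ := (h1.and h2).exists
      refine ⟨y, hy2.1.le, hy2.2, ?_⟩
      have := hy1 hy2.1.ne'
      rw [lt_div_iff₀ (by linarith [hy2.1])] at this
      linarith
  have hS : IsCompact (Icc p β ∩ {x | H x ≤ x}) :=
    isCompact_Icc.inter_right (isClosed_le hH continuous_id)
  obtain ⟨x, ⟨⟨hx1, hx2⟩, hx3⟩, hxmin⟩ := hS.exists_isLeast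
    ⟨β, ⟨hpβ.le, le_rfl⟩, (hmaps β (right_mem_Icc.2 hαβ.le)).2⟩
  have hpx : p < x := lt_of_le_of_ne hx1 fun e => by
    rw [← e] at hx3
    exact absurd hpH (not_lt.2 hx3)
  have hlt : ∀ y ∈ Ioo p x, y < H y := by
    intro y hy
    by_contra! h
    exact absurd (hxmin ⟨⟨hy.1.le, hy.2.le.trans hx2⟩, h⟩) (not_le.2 hy.2)
  have hxe : H x = x := by
    refine le_antisymm hx3 ?_
    have h2 : ∀ᶠ y in nhdsWithin x (Iio x), y ∈ Ioo p x := Ioo_mem_nhdsLT hpx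
    exact le_of_tendsto_of_tendsto (continuous_id.continuousWithinAt (s := Iio x))
      (hH.continuousWithinAt (s := Iio x)) (h2.mono fun y hy => (hlt y hy).le)
  obtain ⟨m, hm, hd⟩ := hfix x ⟨hp.trans hx1, hx2⟩ hxe
  have h1 := (side x m hm hd hxe).filter_mono (nhdsWithin_le_nhds (s := Iio x))
  have h2 : ∀ᶠ y in nhdsWithin x (Iio x), y ∈ Ioo p x := Ioo_mem_nhdsLT hpx
  obtain ⟨y, hy1, hy2⟩ := (h1.and h2).exists
  have h3 := hy1 hy2.2.ne
  have h4 := hlt y hy2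
  have : (H y - y) / (y - x) < 0 := div_neg_of_pos_of_neg (by linarith) (by linarith [hy2.2])
  linarith

theorem no_invariant_interval {α β : ℝ} (hαβ : α < β) {n : ℕ} (hn : 1 ≤ n) (j : ℤ)
    (hmaps : ∀ x ∈ Icc α β, B.F^[n] x - j ∈ Icc α β) : False := by
  set G : ℝ → ℝ := fun x => B.F^[n] x - j with hG
  have hiter : ∀ (k : ℕ), ∀ x ∈ Icc α β, B.F^[n * k] x - k * j ∈ Icc α β := by
    intro k
    induction k with
    | zero => intro x hx; simpa using hx
    | succ k ih =>
      intro x hx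
      have h1 := ih _ (hmaps x hx)
      have h2 : B.F^[n] x - j = B.F^[n] x + ((-j : ℤ) : ℝ) := by push_cast; ring
      rw [h2, B.iterate_add_int, ← Function.iterate_add_apply] at h1
      rw [show n * (k + 1) = n * k + n by ring]
      convert h1 using 1
      push_cast; ring
  have hcrit : ∀ i, ∀ x ∈ Icc α β, deriv B.F (B.F^[i] x) ≠ 0 := by
    intro i x hx h0
    obtain ⟨C, hC⟩ := (isCompact_Icc (a := α) (b := β)).exists_bound_of_continuousOn
      (B.continuous_iterate i).continuousOn
    refine B.critical_orbit_unbounded h0 hn j C fun k => ?_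
    have h1 := hC _ (hiter k x hx)
    have h2 : B.F^[n * k] x - k * j = B.F^[n * k] x + ((-(k * j) : ℤ) : ℝ) := by push_cast; ring
    rw [h2, B.iterate_add_int, ← Function.iterate_add_apply, add_comm i,
      Function.iterate_add_apply] at h1
    convert h1 using 1
    rw [Real.norm_eq_abs]
    push_cast
    ring_nf
  have hGd : ∀ x, HasDerivAt G (deriv (B.F^[n]) x) x := fun x =>
    (((B.contDiff_iterate n).differentiable (by norm_num)) x).hasDerivAt.sub_const _
  have hne : ∀ x ∈ Icc α β, deriv (B.F^[n]) x ≠ 0 := fun x hx => by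
    rw [(B.hasDerivAt_iterate n x).deriv, Finset.prod_ne_zero_iff]
    intro i _
    exact hcrit i x hx
  have hc : Continuous (deriv (B.F^[n])) := (B.contDiff_iterate n).continuous_deriv (by norm_num)
  have hsign : ∀ x ∈ Icc α β, ∀ y ∈ Icc α β, 0 < deriv (B.F^[n]) x * deriv (B.F^[n]) y := by
    intro x hx y hy
    by_contra! hcon
    rcases lt_or_gt_of_ne (hne x hx) with h1 | h1 <;> rcases lt_or_gt_of_ne (hne y hy) with h2 | h2
    · nlinarith
    · obtain ⟨z, hz, hz'⟩ := isPreconnected_Icc.intermediate_value hx hy hc.continuousOn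
        ⟨h1.le, h2.le⟩
      exact hne z hz hz'
    · obtain ⟨z, hz, hz'⟩ := isPreconnected_Icc.intermediate_value hy hx hc.continuousOn
        ⟨h2.le, h1.le⟩
      exact hne z hz hz'
    · nlinarith
  have hGc : Continuous G := (B.continuous_iterate n).sub continuous_const
  refine not_all_fixed_repelling (H := G ∘ G) hαβ (hGc.comp hGc)
    (fun x hx => hmaps _ (hmaps x hx)) ?_
  intro x hx hfix
  refine ⟨_, ?_, (hGd (G x)).comp x (hGd x)⟩
  have hpos := hsign _ (hmaps x hx) x hx
  have hF2 : G ∘ G = fun y => B.F^[n + n] y - 2 * j := by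
    funext y
    have h2 : B.F^[n] y - j = B.F^[n] y + ((-j : ℤ) : ℝ) := by push_cast; ring
    simp only [Function.comp, hG]
    rw [h2, B.iterate_add_int, Function.iterate_add_apply]
    push_cast; ring
  have hper : B.F^[n + n] x = x + ((2 * j : ℤ) : ℝ) := by
    have : (G ∘ G) x = x := hfix
    rw [hF2] at this
    push_cast
    linarith
  have hA := B.hA3 x (n + n) (by omega) ⟨_, hper⟩
  have hd : deriv (B.F^[n + n]) x = deriv (B.F^[n]) (G x) * deriv (B.F^[n]) x := by
    have h1 := ((hGd (G x)).comp x (hGd x)).deriv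
    rw [hF2] at h1
    rw [← h1]
    exact (deriv_sub_const _).symm
  rw [hd, abs_of_pos hpos] at hA
  exact hA

/-- A nonempty open interval meeting one of its iterates has iterates covering the circle. -/
theorem exists_iterate_eq_add_int {a b : ℝ} {n : ℕ} (hn : 1 ≤ n) (j : ℤ)
    {x : ℝ} (hx : x ∈ Ioo a b) (hx' : B.F^[n] x - j ∈ Ioo a b) (t : ℝ) :
    ∃ (k : ℕ) (i : ℤ) (y : ℝ), y ∈ Ioo a b ∧ B.F^[k] y = t + i := by
  have hab : a < b := hx.1.trans hx.2
  set G : ℝ → ℝ := fun x => B.F^[n] x - j with hG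
  have hGc : Continuous G := (B.continuous_iterate n).sub continuous_const
  have hGk : ∀ k y, G^[k] y = B.F^[n * k] y - k * j := by
    intro k
    induction k with
    | zero => intro y; simp
    | succ k ih =>
      intro y
      rw [Function.iterate_succ_apply, ih]
      have h2 : B.F^[n] y - j = B.F^[n] y + ((-j : ℤ) : ℝ) := by push_cast; ring
      simp only [hG]
      rw [h2, B.iterate_add_int, ← Function.iterate_add_apply, show n * (k + 1) = n * k + n by ring]
      push_cast; ring
  set U : Set ℝ := ⋃ k : ℕ, G^[k] '' Ioo a b with hU
  have hUconn : IsPreconnected U := by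
    refine IsPreconnected.iUnion_of_chain (fun k => isPreconnected_Ioo.image _
      (hGc.iterate k).continuousOn) fun k => ?_
    refine ⟨G^[k] (G x), ⟨_, hx', rfl⟩, ⟨x, hx, ?_⟩⟩
    exact Function.iterate_succ_apply G k x
  have hUord := hUconn.ordConnected
  have hIU : Ioo a b ⊆ U := fun y hy => mem_iUnion.2 ⟨0, y, hy, rfl⟩
  have hGU : ∀ y ∈ U, G y ∈ U := by
    intro y hy
    obtain ⟨k, z, hz, rfl⟩ := mem_iUnion.1 hy
    exact mem_iUnion.2 ⟨k + 1, z, hz, Function.iterate_succ_apply' _ _ _⟩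
  obtain ⟨u, hu, v, hv, huv⟩ : ∃ u ∈ U, ∃ v ∈ U, 1 < v - u := by
    by_contra! hcon
    have hbb : BddBelow U := ⟨x - 1, fun u hu => by linarith [hcon u hu x (hIU hx)]⟩
    have hba : BddAbove U := ⟨x + 1, fun v hv => by linarith [hcon x (hIU hx) v hv]⟩
    have hne : U.Nonempty := ⟨x, hIU hx⟩
    have hclo : Icc (sInf U) (sSup U) = closure U := by
      refine Subset.antisymm ?_ ?_
      · have h1 : Ioo (sInf U) (sSup U) ⊆ U := by
          intro y hy
          obtain ⟨u, hu, huy⟩ := exists_lt_of_csInf_lt hne hy.1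
          obtain ⟨v, hv, hyv⟩ := exists_lt_of_lt_csSup hne hy.2
          exact hUord.out hu hv ⟨huy.le, hyv.le⟩
        have hlt : sInf U < sSup U := by
          have h3 := csInf_le hbb (hIU (show (2 * a + b) / 3 ∈ Ioo a b by constructor <;> linarith))
          have h4 := le_csSup hba (hIU (show (a + b) / 2 ∈ Ioo a b by constructor <;> linarith))
          linarith
        rw [← closure_Ioo hlt.ne]
        exact closure_mono h1
      · exact closure_minimal (fun y hy => ⟨csInf_le hbb hy, le_csSup hba hy⟩) isClosed_Icc
    have hlt : sInf U < sSup U := by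
      have h3 := csInf_le hbb (hIU (show (2 * a + b) / 3 ∈ Ioo a b by constructor <;> linarith))
      have h4 := le_csSup hba (hIU (show (a + b) / 2 ∈ Ioo a b by constructor <;> linarith))
      linarith
    refine B.no_invariant_interval hlt hn j fun y hy => ?_
    rw [hclo] at hy ⊢
    exact map_mem_closure (f := G) hGc hy hGU
  obtain ⟨i, hi⟩ := exists_int_mem_Ico t u
  have : t + i ∈ U := hUord.out hu hv ⟨hi.1, by linarith [hi.2]⟩
  obtain ⟨k, y, hy, e⟩ := mem_iUnion.1 this
  rw [hGk] at e
  refine ⟨n * k, i + k * j, y, hy, ?_⟩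
  push_cast
  linarith

end BimodData

/-- The lift to the line of the density of a measure on the circle. -/
def liftDensity (ν : Measure UnitAddCircle) (x : ℝ) : ENNReal := ν.rnDeriv volume (x : UnitAddCircle)

/-- The lift to the line of an absolutely continuous measure on the circle. -/
def liftMeasure (ν : Measure UnitAddCircle) : Measure ℝ := volume.withDensity (liftDensity ν)

theorem measurable_coe_circle : Measurable (fun x : ℝ => (x : UnitAddCircle)) :=
  (UnitAddCircle.measurePreserving_mk 0).measurable

theorem measurable_liftDensity (ν : Measure UnitAddCircle) : Measurable (liftDensity ν) :=
  (Measure.measurable_rnDeriv ν volume).comp measurable_coe_circle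

theorem liftDensity_add_int (ν : Measure UnitAddCircle) (x : ℝ) (n : ℤ) :
    liftDensity ν (x + n) = liftDensity ν x := by
  unfold liftDensity
  rw [BimodData.coe_add_int]

theorem liftMeasure_ac (ν : Measure UnitAddCircle) : liftMeasure ν ≪ volume :=
  withDensity_absolutelyContinuous _ _

/-- `m` is the periodic measure on the line lifting the measure `ν` on the circle. -/
def IsCircleLift (m : Measure ℝ) (ν : Measure UnitAddCircle) : Prop :=
  ∀ (t : ℝ) (E : Set UnitAddCircle), MeasurableSet E →
    ν E = m ((fun x : ℝ => (x : UnitAddCircle)) ⁻¹' E ∩ Ioc t (t + 1))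

theorem isCircleLift_volume : IsCircleLift volume volume := by
  intro t E hE
  rw [← (UnitAddCircle.measurePreserving_mk t).measure_preimage hE.nullMeasurableSet,
    Measure.restrict_apply (measurable_coe_circle hE)]

theorem isCircleLift_liftMeasure {ν : Measure UnitAddCircle} [IsFiniteMeasure ν]
    (hν : ν ≪ volume) : IsCircleLift (liftMeasure ν) ν := by
  intro t E hE
  have h1 : ν E = ∫⁻ x in E, ν.rnDeriv volume x := by
    rw [Measure.setLIntegral_rnDeriv hν]
  have hpre := measurable_coe_circle hE
  rw [h1, liftMeasure, withDensity_apply _ (hpre.inter measurableSet_Ioc),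
    ← lintegral_indicator hE, ← UnitAddCircle.lintegral_preimage t,
    ← Measure.restrict_restrict hpre, ← lintegral_indicator hpre]
  rfl

theorem injOn_coe_Ioc (t : ℝ) : InjOn (fun x : ℝ => (x : UnitAddCircle)) (Ioc t (t + 1)) := by
  intro x hx y hy h
  obtain ⟨n, hn⟩ := BimodData.coe_eq_coe_iff.1 h
  have h1 : (-1 : ℝ) < n := by linarith [hx.2, hy.1]
  have h2 : (n : ℝ) < 1 := by linarith [hx.1, hy.2]
  have : n = 0 := by
    have h1' : (-1 : ℤ) < n := by exact_mod_cast h1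
    have h2' : n < 1 := by exact_mod_cast h2
    omega
  rw [hn, this]; simp

theorem measurableSet_coe_image {S : Set ℝ} {t : ℝ} (hS : MeasurableSet S)
    (hSt : S ⊆ Ioc t (t + 1)) : MeasurableSet ((fun x : ℝ => (x : UnitAddCircle)) '' S) :=
  hS.image_of_measurable_injOn measurable_coe_circle ((injOn_coe_Ioc t).mono hSt)

namespace IsCircleLift

variable {m : Measure ℝ} {ν : Measure UnitAddCircle}

theorem measure_image (h : IsCircleLift m ν) {S : Set ℝ} {t : ℝ} (hS : MeasurableSet S)
    (hSt : S ⊆ Ioc t (t + 1)) : ν ((fun x : ℝ => (x : UnitAddCircle)) '' S) = m S := by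
  rw [h t _ (measurableSet_coe_image hS hSt)]
  congr 1
  ext x
  constructor
  · rintro ⟨⟨y, hy, hyx⟩, hx⟩
    rwa [← injOn_coe_Ioc t (hSt hy) hx hyx]
  · exact fun hx => ⟨⟨x, hx, rfl⟩, hSt hx⟩

theorem measure_Ioc (h : IsCircleLift m ν) (t : ℝ) : m (Ioc t (t + 1)) = ν univ := by
  rw [h t univ MeasurableSet.univ]; simp

theorem measure_preimage_eq_zero (h : IsCircleLift m ν) {E : Set UnitAddCircle}
    (hE : MeasurableSet E) : m ((fun x : ℝ => (x : UnitAddCircle)) ⁻¹' E) = 0 ↔ ν E = 0 := by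
  constructor
  · intro h0
    rw [h 0 E hE]
    exact measure_mono_null inter_subset_left h0
  · intro h0
    have : (fun x : ℝ => (x : UnitAddCircle)) ⁻¹' E ⊆
        ⋃ n : ℤ, (fun x : ℝ => (x : UnitAddCircle)) ⁻¹' E ∩ Ioc (n : ℝ) (n + 1) := by
      intro x hx
      obtain ⟨n, hn⟩ := mem_iUnion.1 (iUnion_Ioc_intCast ℝ ▸ mem_univ x)
      exact mem_iUnion.2 ⟨n, hx, hn⟩
    refine measure_mono_null this (measure_iUnion_null fun n => ?_)
    rw [← h (n : ℝ) E hE, h0]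

theorem ae_coe (h : IsCircleLift m ν) {p : UnitAddCircle → Prop} (hp : ∀ᵐ y ∂ν, p y) :
    ∀ᵐ x : ℝ ∂m, p (x : UnitAddCircle) := by
  obtain ⟨E, hE, hEm, hE0⟩ := exists_measurable_superset_of_null (ae_iff.1 hp)
  rw [ae_iff]
  refine measure_mono_null (fun x hx => ?_) ((h.measure_preimage_eq_zero hEm).2 hE0)
  exact hE hx

theorem ae_of_ae_coe (h : IsCircleLift m ν) {p : UnitAddCircle → Prop}
    (hpm : MeasurableSet {y | p y}) (hp : ∀ᵐ x : ℝ ∂m, p (x : UnitAddCircle)) : ∀ᵐ y ∂ν, p y := by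
  rw [ae_iff]
  exact (h.measure_preimage_eq_zero hpm.compl).1 (ae_iff.1 hp)

/-- Total measure of finitely many subsets of the line whose projections to the circle overlap
at most `M` times. -/
theorem sum_le (h : IsCircleLift m ν) {ι : Type*} (s : Finset ι) (S : ι → Set ℝ) (t : ι → ℝ)
    (hS : ∀ i ∈ s, MeasurableSet (S i)) (hSt : ∀ i ∈ s, S i ⊆ Ioc (t i) (t i + 1)) (M : ℕ)
    (E : Set UnitAddCircle) (hE : MeasurableSet E)
    (hSE : ∀ i ∈ s, ∀ x ∈ S i, (x : UnitAddCircle) ∈ E)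
    (hM : ∀ y : UnitAddCircle, ∀ u ⊆ s, (∀ i ∈ u, ∃ x ∈ S i, (x : UnitAddCircle) = y) →
      u.card ≤ M) :
    ∑ i ∈ s, m (S i) ≤ M * ν E := by
  classical
  have hmeas : ∀ i ∈ s, MeasurableSet ((fun x : ℝ => (x : UnitAddCircle)) '' S i) := fun i hi =>
    measurableSet_coe_image (hS i hi) (hSt i hi)
  calc ∑ i ∈ s, m (S i)
      = ∑ i ∈ s, ∫⁻ y, ((fun x : ℝ => (x : UnitAddCircle)) '' S i).indicator (fun _ => 1) y ∂ν := by
        refine Finset.sum_congr rfl fun i hi => ?_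
        rw [← h.measure_image (hS i hi) (hSt i hi), lintegral_indicator_const (hmeas i hi), one_mul]
    _ = ∫⁻ y, ∑ i ∈ s, ((fun x : ℝ => (x : UnitAddCircle)) '' S i).indicator (fun _ => 1) y ∂ν := by
        rw [lintegral_finsetSum' _ fun i hi =>
          (measurable_const.indicator (hmeas i hi)).aemeasurable]
    _ ≤ ∫⁻ y, E.indicator (fun _ => (M : ENNReal)) y ∂ν := by
        refine lintegral_mono fun y => ?_
        by_cases hy : y ∈ E
        · rw [indicator_of_mem hy]
          simp only [indicator, Finset.sum_boole]
          exact_mod_cast hM y _ (Finset.filter_subset _ _)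
            fun i hi => (Finset.mem_filter.1 hi).2
        · rw [indicator_of_notMem hy]
          refine (Finset.sum_eq_zero fun i hi => indicator_of_notMem ?_ _).le
          rintro ⟨x, hx, rfl⟩
          exact hy (hSE i hi x hx)
    _ = M * ν E := by rw [lintegral_indicator_const hE]

end IsCircleLift

theorem liftMeasure_preimage_add_int (ν : Measure UnitAddCircle) (n : ℤ) (S : Set ℝ)
    (hS : MeasurableSet S) : liftMeasure ν ((fun x => x + n) ⁻¹' S) = liftMeasure ν S := by
  have hm : Measurable fun x : ℝ => x + n := by fun_prop
  rw [liftMeasure, withDensity_apply _ (hm hS), withDensity_apply _ hS,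
    ← lintegral_indicator hS, ← lintegral_indicator (hm hS)]
  conv_rhs => rw [← lintegral_add_right_eq_self _ (n : ℝ)]
  refine lintegral_congr fun x => ?_
  simp only [indicator, liftDensity_add_int]
  rfl

instance (ν : Measure UnitAddCircle) : NullSingletonClass (liftMeasure ν) :=
  ⟨fun x => liftMeasure_ac ν (measure_singleton x)⟩

namespace BimodData

variable (B : BimodData) {ν : Measure UnitAddCircle} [IsFiniteMeasure ν]

/-- The mass of a short set is at most the mass of its image. -/
theorem liftMeasure_le_image (hν : ν ≪ volume) (hinv : Measure.map B.f ν = ν) {S : Set ℝ}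
    {s t : ℝ} (hS : MeasurableSet S) (hSs : S ⊆ Ioc s (s + 1)) (hinj : InjOn B.F S)
    (hFS : B.F '' S ⊆ Ioc t (t + 1)) : liftMeasure ν S ≤ liftMeasure ν (B.F '' S) := by
  have hl := isCircleLift_liftMeasure hν
  have hFm : MeasurableSet (B.F '' S) :=
    hS.image_of_measurable_injOn B.continuous_F.measurable hinj
  rw [← hl.measure_image hS hSs, ← hl.measure_image hFm hFS]
  conv_rhs => rw [← hinv]
  rw [Measure.map_apply B.measurable_f (measurableSet_coe_image hFm hFS)]
  refine measure_mono ?_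
  rintro _ ⟨x, hx, rfl⟩
  exact ⟨B.F x, ⟨x, hx, rfl⟩, (B.hf x).symm⟩

theorem countable_crit : {x | deriv B.F x = 0}.Countable := by
  have : {x | deriv B.F x = 0} ⊆ range (fun n : ℤ => B.ctp + n) ∪ range (fun n : ℤ => B.ctm + n) := by
    intro x hx
    obtain ⟨n, h | h⟩ := (B.deriv_eq_zero_iff x).1 hx
    · exact Or.inl ⟨n, h.symm⟩
    · exact Or.inr ⟨n, h.symm⟩
  exact ((countable_range _).union (countable_range _)).mono this

theorem injOn_of_deriv_ne_zero {a b : ℝ} (h : ∀ x ∈ Ioo a b, deriv B.F x ≠ 0) :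
    InjOn B.F (Icc a b) := by
  have := B.strictMonoOn_or_strictAntiOn_iterate (a := a) (d := b) (n := 1) (by
    intro i hi x hx
    have : i = 0 := by omega
    subst this
    exact h x hx)
  rw [Function.iterate_one] at this
  exact this.elim StrictMonoOn.injOn StrictAntiOn.injOn

/-- Jacobian inequality for the density of an absolutely continuous invariant measure. -/
theorem liftDensity_le (hν : ν ≪ volume) (hinv : Measure.map B.f ν = ν) :
    ∀ᵐ x : ℝ, liftDensity ν x ≤ ENNReal.ofReal |deriv B.F x| * liftDensity ν (B.F x) := by
  obtain ⟨M, hM0, hM⟩ := B.exists_deriv_bound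
  set P : Set (ℚ × ℚ) := {r | (r.2 : ℝ) - r.1 < 1 ∧ M * ((r.2 : ℝ) - r.1) < 1 / 2 ∧
    ∀ x ∈ Ioo (r.1 : ℝ) r.2, deriv B.F x ≠ 0}
  have hlocal : ∀ r ∈ P, ∀ᵐ x : ℝ ∂(volume.restrict (Ioo (r.1 : ℝ) r.2)),
      liftDensity ν x ≤ ENNReal.ofReal |deriv B.F x| * liftDensity ν (B.F x) := by
    intro r hr
    refine ae_le_of_forall_setLIntegral_le_of_sigmaFinite (measurable_liftDensity ν) ?_
    intro S hS _
    rw [Measure.restrict_restrict hS]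
    set S' := S ∩ Ioo (r.1 : ℝ) r.2 with hS'
    have hS'm : MeasurableSet S' := hS.inter measurableSet_Ioo
    have hinj : InjOn B.F S' := (B.injOn_of_deriv_ne_zero hr.2.2).mono
      (inter_subset_right.trans Ioo_subset_Icc_self)
    have hlip : ∀ x ∈ S', |B.F x - B.F r.1| < 1 / 2 := by
      intro x hx
      have := convex_univ.norm_image_sub_le_of_norm_deriv_le (f := B.F) (C := M)
        (fun t _ => B.differentiable_F t) (fun t _ => hM t) (mem_univ (r.1 : ℝ)) (mem_univ x)
      rw [Real.norm_eq_abs, Real.norm_eq_abs, abs_of_pos (by linarith [hx.2.1] : 0 < x - r.1)] at this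
      have h2 : M * (x - r.1) ≤ M * (r.2 - r.1) := by
        gcongr
        exact hx.2.2.le
      linarith [hr.2.1]
    have hle := B.liftMeasure_le_image hν hinv (s := r.1) (t := B.F r.1 - 1 / 2) hS'm
      (fun x hx => ⟨hx.2.1, by linarith [hx.2.2, hr.1]⟩) hinj (by
        rintro _ ⟨x, hx, rfl⟩
        have := abs_lt.1 (hlip x hx)
        constructor <;> linarith [this.1, this.2])
    rw [liftMeasure, withDensity_apply _ hS'm, withDensity_apply _
      (hS'm.image_of_measurable_injOn B.continuous_F.measurable hinj),
      lintegral_image_eq_lintegral_abs_deriv_mul hS'm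
        (fun x _ => (B.differentiable_F x).hasDerivAt.hasDerivWithinAt) hinj] at hle
    exact hle
  have hcov : ∀ x, deriv B.F x ≠ 0 → ∃ r ∈ P, x ∈ Ioo (r.1 : ℝ) r.2 := by
    intro x hx
    have hopen : {y | deriv B.F y ≠ 0} ∈ nhds x :=
      (isOpen_ne_fun B.continuous_deriv_F continuous_const).mem_nhds hx
    obtain ⟨ε, hε, hball⟩ := Metric.mem_nhds_iff.1 hopen
    set e := min ε (min (1 / 4) (1 / (8 * M))) with he
    have he0 : 0 < e := by positivity
    obtain ⟨p, hp1, hp2⟩ := exists_rat_btwn (by linarith : x - e < x)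
    obtain ⟨q, hq1, hq2⟩ := exists_rat_btwn (by linarith : x < x + e)
    have e1 : e ≤ ε := min_le_left _ _
    have e2 : e ≤ 1 / 4 := (min_le_right _ _).trans (min_le_left _ _)
    have e3 : e ≤ 1 / (8 * M) := (min_le_right _ _).trans (min_le_right _ _)
    refine ⟨(p, q), ⟨?_, ?_, ?_⟩, hp2, hq1⟩
    · simp only; linarith
    · have h3 : M * e ≤ 1 / 8 := by
        calc M * e ≤ M * (1 / (8 * M)) := by gcongr
          _ = 1 / 8 := by field_simp
      have h4 : M * ((q : ℝ) - p) ≤ M * (2 * e) := by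
        gcongr
        linarith
      simp only
      linarith
    · intro y hy
      apply hball
      rw [Metric.mem_ball, Real.dist_eq, abs_lt]
      constructor <;> linarith [hy.1, hy.2]
  have hall : ∀ᵐ x : ℝ, ∀ r : P, x ∈ Ioo (r.1.1 : ℝ) r.1.2 →
      liftDensity ν x ≤ ENNReal.ofReal |deriv B.F x| * liftDensity ν (B.F x) :=
    ae_all_iff.2 fun r => (ae_restrict_iff' measurableSet_Ioo).1 (hlocal r.1 r.2)
  have hc : ∀ᵐ x : ℝ, x ∉ {x | deriv B.F x = 0} :=
    measure_eq_zero_iff_ae_notMem.1 (B.countable_crit.measure_zero volume)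
  filter_upwards [hall, hc] with x hx hx0
  obtain ⟨r, hr, hxr⟩ := hcov x hx0
  exact hx ⟨r, hr⟩ hxr

end BimodData

/-- Koebe-type distortion bound: a monotone map that does not contract cross-ratios too much and
whose image has definite space on both sides of `g '' [p, q]` is Lipschitz on `[p, q]`, with a
constant comparable to its average slope there. -/
theorem slope_le_of_crossRatio_of_strictMonoOn {g : ℝ → ℝ} {α β p q c η : ℝ}
    (hg : StrictMonoOn g (Icc α β)) (hαp : α < p) (hqβ : q < β) (hc0 : 0 < c) (hc1 : c ≤ 1)
    (hη : 0 < η)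
    (hcr : ∀ a b e d, α ≤ a → a < b → b < e → e < d → d ≤ β →
      c * crossRatio a b e d ≤ crossRatio (g a) (g b) (g e) (g d))
    (h1 : η * (g β - g α) ≤ g p - g α) (h2 : η * (g β - g α) ≤ g β - g q)
    {x y : ℝ} (hpx : p ≤ x) (hxy : x < y) (hyq : y ≤ q) :
    c * η * (g y - g x) * (q - p) ≤ (g q - g p) * (y - x) := by
  have mono : ∀ s t, α ≤ s → s < t → t ≤ β → g s < g t := fun s t hs hst ht =>
    hg ⟨hs, by linarith⟩ ⟨by linarith, ht⟩ hst
  have hαβ := mono α β le_rfl (by linarith) le_rfl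
  have hgxy := mono x y (by linarith) hxy (by linarith)
  have hη1 : η ≤ 1 := by
    by_contra hcon
    have : g p < g β := mono p β hαp.le (by linarith) le_rfl
    nlinarith
  have key : ∀ T J L R gT gJ gL gR gW : ℝ, 0 < T → 0 < J → 0 < L → 0 < R → 0 < gT → 0 < gJ →
      0 < gL → 0 < gR → R ≤ T → gT ≤ gW → η * gW ≤ gR →
      c * ((T * J) / (L * R)) ≤ (gT * gJ) / (gL * gR) → c * η * gL * J ≤ gJ * L := by
    intro T J L R gT gJ gL gR gW hT hJ hL hR hgT hgJ hgL hgR hRT hTW hRW h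
    rw [← mul_div_assoc, div_le_div_iff₀ (by positivity) (by positivity)] at h
    have e1 : c * η * gL * J * (T * gT) ≤ gJ * L * (T * gT) := by
      calc c * η * gL * J * (T * gT) = (c * (T * J) * gL) * (η * gT) := by ring
        _ ≤ (c * (T * J) * gL) * gR := by
            gcongr
            exact (mul_le_mul_of_nonneg_left hTW hη.le).trans hRW
        _ = c * (T * J) * (gL * gR) := by ring
        _ ≤ gT * gJ * (L * R) := h
        _ ≤ gT * gJ * (L * T) := by gcongr
        _ = gJ * L * (T * gT) := by ring
    exact le_of_mul_le_mul_right e1 (by positivity)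
  have hright : c * η * (g y - g x) * (q - y) ≤ (g q - g y) * (y - x) := by
    rcases hyq.eq_or_lt with rfl | hlt
    · simp
    refine key (β - x) (q - y) (y - x) (β - q) (g β - g x) (g q - g y) (g y - g x) (g β - g q)
      (g β - g α) (by linarith) (by linarith) (by linarith) (by linarith) ?_ ?_ (by linarith) ?_
      (by linarith) ?_ h2 (hcr x y q β (by linarith) hxy hlt hqβ le_rfl)
    · linarith [mono x β (by linarith) (by linarith) le_rfl]
    · linarith [mono y q (by linarith) hlt hqβ.le]
    · linarith [mono q β (by linarith) hqβ le_rfl]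
    · linarith [mono α x le_rfl (by linarith) (by linarith)]
  have hleft : c * η * (g y - g x) * (x - p) ≤ (g x - g p) * (y - x) := by
    rcases hpx.eq_or_lt with rfl | hlt
    · simp
    have hc' := hcr α p x y le_rfl hαp hlt hxy (by linarith)
    unfold crossRatio at hc'
    rw [mul_comm (p - α), mul_comm (g p - g α)] at hc'
    refine key (y - α) (x - p) (y - x) (p - α) (g y - g α) (g x - g p) (g y - g x) (g p - g α)
      (g β - g α) (by linarith) (by linarith) (by linarith) (by linarith) ?_ ?_ (by linarith) ?_
      (by linarith) ?_ h1 hc'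
    · linarith [mono α y (by linarith) (by linarith) (by linarith)]
    · linarith [mono p x (by linarith) hlt (by linarith)]
    · linarith [mono α p le_rfl hαp (by linarith)]
    · rcases (show y ≤ β by linarith).eq_or_lt with rfl | hlt'
      · exact le_rfl
      · linarith [mono y β (by linarith) hlt' le_rfl]
  have hmid : c * η * (g y - g x) * (y - x) ≤ (g y - g x) * (y - x) := by
    have : c * η ≤ 1 := mul_le_one₀ hc1 hη.le hη1
    have : 0 ≤ (g y - g x) * (y - x) := mul_nonneg (by linarith) (by linarith)
    nlinarith
  nlinarith

theorem slope_le_of_crossRatio {g : ℝ → ℝ} {α β p q c η : ℝ}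
    (hg : StrictMonoOn g (Icc α β) ∨ StrictAntiOn g (Icc α β)) (hαp : α < p) (hpq : p < q)
    (hqβ : q < β) (hc0 : 0 < c) (hc1 : c ≤ 1) (hη : 0 < η)
    (hcr : ∀ a b e d, α ≤ a → a < b → b < e → e < d → d ≤ β →
      c * crossRatio a b e d ≤ crossRatio (g a) (g b) (g e) (g d))
    (h1 : η * |g β - g α| ≤ |g p - g α|) (h2 : η * |g β - g α| ≤ |g β - g q|)
    {x y : ℝ} (hpx : p ≤ x) (hxy : x < y) (hyq : y ≤ q) :
    c * η * |g y - g x| * (q - p) ≤ |g q - g p| * (y - x) := by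
  have m1 : α ∈ Icc α β := ⟨le_rfl, by linarith⟩
  have m2 : p ∈ Icc α β := ⟨by linarith, by linarith⟩
  have m3 : q ∈ Icc α β := ⟨by linarith, by linarith⟩
  have m4 : β ∈ Icc α β := ⟨by linarith, by linarith⟩
  have m5 : x ∈ Icc α β := ⟨by linarith, by linarith⟩
  have m6 : y ∈ Icc α β := ⟨by linarith, by linarith⟩
  rcases hg with hg | hg
  · rw [abs_of_pos (sub_pos.2 (hg m1 m4 (by linarith)))] at h1 h2
    rw [abs_of_pos (sub_pos.2 (hg m1 m2 (by linarith)))] at h1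
    rw [abs_of_pos (sub_pos.2 (hg m3 m4 (by linarith)))] at h2
    rw [abs_of_pos (sub_pos.2 (hg m5 m6 (by linarith))),
      abs_of_pos (sub_pos.2 (hg m2 m3 (by linarith)))]
    exact slope_le_of_crossRatio_of_strictMonoOn hg hαp hqβ hc0 hc1 hη hcr h1 h2 hpx hxy hyq
  · rw [abs_of_neg (sub_neg.2 (hg m1 m4 (by linarith)))] at h1 h2
    rw [abs_of_neg (sub_neg.2 (hg m1 m2 (by linarith)))] at h1
    rw [abs_of_neg (sub_neg.2 (hg m3 m4 (by linarith)))] at h2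
    rw [abs_of_neg (sub_neg.2 (hg m5 m6 (by linarith))),
      abs_of_neg (sub_neg.2 (hg m2 m3 (by linarith)))]
    have := slope_le_of_crossRatio_of_strictMonoOn (g := fun t => -g t)
      (fun s hs t ht hst => neg_lt_neg (hg hs ht hst)) hαp hqβ hc0 hc1 hη
      (fun a b e d h1 h2 h3 h4 h5 => by
        rw [crossRatio_neg]; exact hcr a b e d h1 h2 h3 h4 h5)
      (by linarith) (by linarith) hpx hxy hyq
    calc _ = c * η * (-g y - -g x) * (q - p) := by ring
      _ ≤ _ := this
      _ = _ := by ring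

namespace BimodData

variable (B : BimodData)

theorem exists_crossRatio_iterate_bound : ∃ K, 0 ≤ K ∧ ∀ (n : ℕ) (a b e d : ℝ), a < b → b < e →
    e < d → (∀ i < n, ∀ x ∈ Ioo a d, deriv B.F (B.F^[i] x) ≠ 0) →
    Real.exp (-(K * ∑ i ∈ Finset.range n, |B.F^[i] d - B.F^[i] a|)) * crossRatio a b e d ≤
      crossRatio (B.F^[n] a) (B.F^[n] b) (B.F^[n] e) (B.F^[n] d) := by
  obtain ⟨K, hK, H⟩ := B.exists_crossRatio_bound
  refine ⟨K, hK, fun n a b e d hab hbe hed => ?_⟩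
  have ma : a ∈ Icc a d := ⟨le_rfl, by linarith⟩
  have mb : b ∈ Icc a d := ⟨by linarith, by linarith⟩
  have me : e ∈ Icc a d := ⟨by linarith, by linarith⟩
  have md : d ∈ Icc a d := ⟨by linarith, by linarith⟩
  induction n with
  | zero => intro _; simp
  | succ n ih =>
    intro h
    have ih' := ih fun i hi => h i (by omega)
    have hn := h n (by omega)
    rw [Finset.sum_range_succ]
    simp only [Function.iterate_succ_apply']
    have hstep : Real.exp (-(K * |B.F^[n] d - B.F^[n] a|)) *
        crossRatio (B.F^[n] a) (B.F^[n] b) (B.F^[n] e) (B.F^[n] d) ≤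
        crossRatio (B.F (B.F^[n] a)) (B.F (B.F^[n] b)) (B.F (B.F^[n] e)) (B.F (B.F^[n] d)) := by
      rcases B.strictMonoOn_or_strictAntiOn_iterate (n := n) fun i hi => h i (by omega) with
        hm | hm
      · have := H _ _ _ _ (hm ma mb hab) (hm mb me hbe) (hm me md hed) (by
          intro x hx
          obtain ⟨y, hy, rfl⟩ := intermediate_value_Ioo (by linarith)
            (B.continuous_iterate n).continuousOn hx
          exact hn y hy)
        rwa [abs_of_pos (sub_pos.2 (hm ma md (by linarith)))]
      · have := H _ _ _ _ (hm me md hed) (hm mb me hbe) (hm ma mb hab) (by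
          intro x hx
          obtain ⟨y, hy, rfl⟩ := intermediate_value_Ioo' (by linarith)
            (B.continuous_iterate n).continuousOn hx
          exact hn y hy)
        rw [crossRatio_reverse (B.F^[n] a), crossRatio_reverse (B.F (B.F^[n] a))] at this
        rwa [abs_of_neg (sub_neg.2 (hm ma md (by linarith))), neg_sub]
    refine le_trans ?_ hstep
    calc _ = Real.exp (-(K * |B.F^[n] d - B.F^[n] a|)) *
          (Real.exp (-(K * ∑ i ∈ Finset.range n, |B.F^[i] d - B.F^[i] a|)) *
            crossRatio a b e d) := by
          rw [← mul_assoc, ← Real.exp_add]; congr 2; ring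
      _ ≤ _ := by gcongr

end BimodData

theorem abs_clamp_sub_le (k s t : ℝ) :
    |max (-k) (min k s) - max (-k) (min k t)| ≤ |s - t| := by
  refine (abs_max_sub_max_le_max _ _ _ _).trans (max_le (by simp) ?_)
  exact (abs_min_sub_min_le_max _ _ _ _).trans (max_le (by simp) le_rfl)

theorem neg_le_clamp_sub {k s t Λ : ℝ} (hΛ : 0 ≤ Λ) (h : -Λ ≤ s - t) :
    -Λ ≤ max (-k) (min k s) - max (-k) (min k t) := by
  rcases le_total t s with hts | hst
  · have : max (-k) (min k t) ≤ max (-k) (min k s) := by gcongr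
    linarith
  · have := abs_clamp_sub_le k s t
    rw [abs_of_nonpos (by linarith : s - t ≤ 0)] at this
    linarith [neg_abs_le (max (-k) (min k s) - max (-k) (min k t))]

/-- A coboundary that is bounded below is integrable with zero integral. -/
theorem MeasureTheory.MeasurePreserving.integral_comp_sub_eq_zero {X : Type*} [MeasurableSpace X]
    {ν : Measure X} [IsProbabilityMeasure ν] {T : X → X} (hT : MeasurePreserving T ν ν)
    {u : X → ℝ} (hu : Measurable u) {Λ : ℝ} (hΛ : 0 ≤ Λ) (h : ∀ᵐ x ∂ν, -Λ ≤ u (T x) - u x) :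
    Integrable (fun x => u (T x) - u x) ν ∧ ∫ x, (u (T x) - u x) ∂ν = 0 := by
  set v : ℕ → X → ℝ := fun k x => max (-(k : ℝ)) (min k (u x)) with hv
  have hvm : ∀ k, Measurable (v k) := fun k => measurable_const.max (measurable_const.min hu)
  have hvb : ∀ k x, ‖v k x‖ ≤ k := by
    intro k x
    rw [Real.norm_eq_abs, abs_le]
    exact ⟨le_max_left _ _, max_le (by linarith [(Nat.cast_nonneg k : (0:ℝ) ≤ k)]) (min_le_left _ _)⟩
  have hvi : ∀ k, Integrable (v k) ν := fun k =>
    Integrable.of_bound (hvm k).aestronglyMeasurable k (ae_of_all _ (hvb k))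
  have hvTi : ∀ k, Integrable (fun x => v k (T x)) ν := fun k =>
    hT.integrable_comp_of_integrable (hvi k)
  set w : ℕ → X → ℝ := fun k x => v k (T x) - v k x with hw
  have hwi : ∀ k, Integrable (w k) ν := fun k => (hvTi k).sub (hvi k)
  have hw0 : ∀ k, ∫ x, w k x ∂ν = 0 := by
    intro k
    have : ∫ x, v k (T x) ∂ν = ∫ x, v k x ∂ν := by
      have hm := (hvm k).aestronglyMeasurable (μ := Measure.map T ν)
      rw [← integral_map hT.measurable.aemeasurable hm, hT.map_eq]
    rw [hw, integral_sub (hvTi k) (hvi k), this, sub_self]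
  have hlim : ∀ x, Tendsto (fun k => w k x) atTop (nhds (u (T x) - u x)) := by
    intro x
    have hvlim : ∀ y, ∀ᶠ k : ℕ in atTop, v k y = u y := by
      intro y
      obtain ⟨N, hN⟩ := exists_nat_ge |u y|
      filter_upwards [eventually_ge_atTop N] with k hk
      have hk' : |u y| ≤ k := hN.trans (by exact_mod_cast hk)
      have := abs_le.1 hk'
      simp only [hv]
      rw [min_eq_right this.2, max_eq_right this.1]
    refine tendsto_const_nhds.congr' ?_
    filter_upwards [hvlim x, hvlim (T x)] with k h1 h2
    rw [hw]; simp only; rw [h1, h2]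
  have hwm : Measurable fun x => u (T x) - u x := (hu.comp hT.measurable).sub hu
  have hbd : ∀ k, ∫⁻ x, ‖w k x‖ₑ ∂ν ≤ ENNReal.ofReal (2 * Λ) := by
    intro k
    rw [← ofReal_integral_norm_eq_lintegral_enorm (hwi k)]
    apply ENNReal.ofReal_le_ofReal
    calc ∫ x, ‖w k x‖ ∂ν ≤ ∫ x, (w k x + 2 * Λ) ∂ν := by
          refine integral_mono_ae (hwi k).norm ((hwi k).add (integrable_const _)) ?_
          filter_upwards [h] with x hx
          have := neg_le_clamp_sub (k := k) hΛ hx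
          rw [Real.norm_eq_abs]
          simp only [hw, hv]
          rw [abs_le]
          constructor <;> linarith
      _ = 2 * Λ := by
          rw [integral_add (hwi k) (integrable_const _), hw0]; simp
  have hintg : Integrable (fun x => u (T x) - u x) ν := by
    refine ⟨hwm.aestronglyMeasurable, ?_⟩
    calc ∫⁻ x, ‖u (T x) - u x‖ₑ ∂ν = ∫⁻ x, liminf (fun k => ‖w k x‖ₑ) atTop ∂ν :=
          lintegral_congr fun x => ((hlim x).enorm.liminf_eq).symm
      _ ≤ liminf (fun k => ∫⁻ x, ‖w k x‖ₑ ∂ν) atTop :=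
          lintegral_liminf_le fun k => (((hvm k).comp hT.measurable).sub (hvm k)).enorm
      _ ≤ ENNReal.ofReal (2 * Λ) := by
          refine liminf_le_of_le (by isBoundedDefault) fun b hb => ?_
          obtain ⟨k, hk⟩ := hb.exists
          exact hk.trans (hbd k)
      _ < ⊤ := ENNReal.ofReal_lt_top
  refine ⟨hintg, ?_⟩
  have := tendsto_integral_of_dominated_convergence (μ := ν) (F := w)
    (fun x => ‖u (T x) - u x‖) (fun k => (hwi k).aestronglyMeasurable) hintg.norm
    (fun k => ae_of_all _ fun x => abs_clamp_sub_le _ _ _) (ae_of_all _ hlim)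
  simp only [hw0] at this
  exact tendsto_nhds_unique this tendsto_const_nhds

namespace BimodData

variable (B : BimodData) {ν : Measure UnitAddCircle}

theorem measurePreserving_f (hinv : Measure.map B.f ν = ν) : MeasurePreserving B.f ν ν :=
  ⟨B.measurable_f, hinv⟩

theorem liftMeasure_le_image_iterate [IsFiniteMeasure ν] (hν : ν ≪ volume)
    (hinv : Measure.map B.f ν = ν) {n : ℕ} {S : Set ℝ}
    {s t : ℝ} (hS : MeasurableSet S) (hSs : S ⊆ Ioc s (s + 1)) (hinj : InjOn (B.F^[n]) S)
    (hFS : B.F^[n] '' S ⊆ Ioc t (t + 1)) : liftMeasure ν S ≤ liftMeasure ν (B.F^[n] '' S) := by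
  have hl := isCircleLift_liftMeasure hν
  have hFm : MeasurableSet (B.F^[n] '' S) :=
    hS.image_of_measurable_injOn (B.continuous_iterate n).measurable hinj
  rw [← hl.measure_image hS hSs, ← hl.measure_image hFm hFS,
    ← ((B.measurePreserving_f hinv).iterate n).measure_preimage
      (measurableSet_coe_image hFm hFS).nullMeasurableSet]
  refine measure_mono ?_
  rintro _ ⟨x, hx, rfl⟩
  exact ⟨B.F^[n] x, ⟨x, hx, rfl⟩, (B.f_iterate_coe n x).symm⟩

theorem rnDeriv_le [IsFiniteMeasure ν] (hν : ν ≪ volume) (hinv : Measure.map B.f ν = ν) :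
    ∀ᵐ y ∂(volume : Measure UnitAddCircle),
      ν.rnDeriv volume y ≤ ENNReal.ofReal |B.Df y| * ν.rnDeriv volume (B.f y) := by
  have hm := Measure.measurable_rnDeriv ν volume
  refine isCircleLift_volume.ae_of_ae_coe (measurableSet_le hm ?_) ?_
  · exact (ENNReal.measurable_ofReal.comp B.continuous_Df.abs.measurable).mul
      (hm.comp B.measurable_f)
  · filter_upwards [B.liftDensity_le hν hinv] with x hx
    rw [B.Df_coe, B.hf]
    exact hx

theorem ae_Df_ne_zero (hν : ν ≪ volume) : ∀ᵐ y ∂ν, B.Df y ≠ 0 := by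
  refine hν.ae_le ?_
  refine isCircleLift_volume.ae_of_ae_coe
    (measurableSet_eq_fun B.continuous_Df.measurable measurable_const).compl ?_
  have hc : ∀ᵐ x : ℝ, x ∉ {x | deriv B.F x = 0} :=
    measure_eq_zero_iff_ae_notMem.1 (B.countable_crit.measure_zero volume)
  filter_upwards [hc] with x hx
  rw [B.Df_coe]
  exact hx

/-- An absolutely continuous invariant measure has an integrable and nonnegative Lyapunov
exponent; if the exponent vanishes then the density is transported exactly by the derivative. -/
theorem integrable_log_Df [IsProbabilityMeasure ν] (hν : ν ≪ volume)
    (hinv : Measure.map B.f ν = ν) :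
    Integrable (fun y => Real.log |B.Df y|) ν ∧ 0 ≤ ∫ y, Real.log |B.Df y| ∂ν ∧
    (∫ y, Real.log |B.Df y| ∂ν = 0 → ∀ᵐ y ∂ν,
      ν.rnDeriv volume y = ENNReal.ofReal |B.Df y| * ν.rnDeriv volume (B.f y)) := by
  have hT := B.measurePreserving_f hinv
  set ρ := ν.rnDeriv volume with hρ
  have hρm : Measurable ρ := Measure.measurable_rnDeriv ν volume
  set u : UnitAddCircle → ℝ := fun y => Real.log (ρ y).toReal with hu
  have hum : Measurable u := Real.measurable_log.comp hρm.ennreal_toReal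
  have hpos : ∀ᵐ y ∂ν, 0 < (ρ y).toReal := by
    filter_upwards [Measure.rnDeriv_pos hν, hν.ae_le (Measure.rnDeriv_lt_top ν volume)] with y h1 h2
    exact ENNReal.toReal_pos h1.ne' h2.ne
  have hfin : ∀ᵐ y ∂ν, ρ y ≠ ⊤ := by
    filter_upwards [hν.ae_le (Measure.rnDeriv_lt_top ν volume)] with y h2 using h2.ne
  have hpos' : ∀ᵐ y ∂ν, 0 < (ρ (B.f y)).toReal := hT.quasiMeasurePreserving.ae hpos
  have hfin' : ∀ᵐ y ∂ν, ρ (B.f y) ≠ ⊤ := hT.quasiMeasurePreserving.ae hfin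
  have hJ : ∀ᵐ y ∂ν, (ρ y).toReal ≤ |B.Df y| * (ρ (B.f y)).toReal := by
    filter_upwards [hν.ae_le (B.rnDeriv_le hν hinv), hfin'] with y h1 h2
    have := ENNReal.toReal_mono (ENNReal.mul_ne_top ENNReal.ofReal_ne_top h2) h1
    rwa [ENNReal.toReal_mul, ENNReal.toReal_ofReal (abs_nonneg _)] at this
  have hD := B.ae_Df_ne_zero hν
  obtain ⟨M, hM0, hM⟩ := B.exists_deriv_bound
  set Λ := max (Real.log M) 0
  have hΛ : 0 ≤ Λ := le_max_right _ _
  have hL : ∀ᵐ y ∂ν, Real.log |B.Df y| ≤ Λ := by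
    filter_upwards [hD] with y hy
    refine le_trans (Real.log_le_log (abs_pos.2 hy) ?_) (le_max_left _ _)
    obtain ⟨x, rfl⟩ := exists_coe_eq y
    rw [B.Df_coe]
    exact hM x
  have hg : ∀ᵐ y ∂ν, 0 ≤ Real.log |B.Df y| + (u (B.f y) - u y) := by
    filter_upwards [hJ, hpos, hpos', hD] with y h1 h2 h3 h4
    have := Real.log_le_log h2 h1
    rw [Real.log_mul (abs_pos.2 h4).ne' h3.ne'] at this
    simp only [hu]
    linarith
  obtain ⟨hwi, hw0⟩ := hT.integral_comp_sub_eq_zero hum hΛ (by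
    filter_upwards [hg, hL] with y h1 h2
    linarith)
  have hLm : Measurable fun y => Real.log |B.Df y| :=
    Real.measurable_log.comp B.continuous_Df.abs.measurable
  have hLi : Integrable (fun y => Real.log |B.Df y|) ν := by
    refine Integrable.mono' (hwi.norm.add (integrable_const Λ)) hLm.aestronglyMeasurable ?_
    filter_upwards [hg, hL] with y h1 h2
    simp only [Pi.add_apply, Real.norm_eq_abs]
    rw [abs_le]
    constructor <;> linarith [abs_nonneg (u (B.f y) - u y), le_abs_self (u (B.f y) - u y)]
  have heq : ∫ y, (Real.log |B.Df y| + (u (B.f y) - u y)) ∂ν = ∫ y, Real.log |B.Df y| ∂ν := by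
    rw [integral_add hLi hwi, hw0, add_zero]
  refine ⟨hLi, heq ▸ integral_nonneg_of_ae hg, fun h0 => ?_⟩
  rw [← heq, integral_eq_zero_iff_of_nonneg_ae hg (hLi.add hwi)] at h0
  filter_upwards [h0, hpos, hpos', hD, hfin, hfin'] with y h1 h2 h3 h4 h5 h6
  have h7 : Real.log (ρ y).toReal = Real.log (|B.Df y| * (ρ (B.f y)).toReal) := by
    rw [Real.log_mul (abs_pos.2 h4).ne' h3.ne']
    simp only [hu, Pi.zero_apply] at h1
    linarith
  have h8 := Real.log_injOn_pos (mem_Ioi.2 h2) (mem_Ioi.2 (mul_pos (abs_pos.2 h4) h3)) h7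
  rw [← ENNReal.ofReal_toReal h5, h8, ENNReal.ofReal_mul (abs_nonneg _), ENNReal.ofReal_toReal h6]

/-- If the density is transported exactly by the derivative, then iterates preserve the mass of
sets contained in the support of the density. -/
theorem liftMeasure_image_iterate [IsProbabilityMeasure ν] (hν : ν ≪ volume)
    (hinv : Measure.map B.f ν = ν)
    (hJ : ∀ᵐ y ∂ν, ν.rnDeriv volume y = ENNReal.ofReal |B.Df y| * ν.rnDeriv volume (B.f y))
    {n : ℕ} {S : Set ℝ} (hS : MeasurableSet S) (hinj : InjOn (B.F^[n]) S)
    (hpos : ∀ x ∈ S, liftDensity ν x ≠ 0) :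
    liftMeasure ν (B.F^[n] '' S) = liftMeasure ν S := by
  have hT := B.measurePreserving_f hinv
  have hiter : ∀ᵐ x ∂(liftMeasure ν), liftDensity ν x =
      ENNReal.ofReal |∏ i ∈ Finset.range n, deriv B.F (B.F^[i] x)| *
        liftDensity ν (B.F^[n] x) := by
    have hall : ∀ᵐ x ∂(liftMeasure ν), ∀ k : ℕ, liftDensity ν (B.F^[k] x) =
        ENNReal.ofReal |deriv B.F (B.F^[k] x)| * liftDensity ν (B.F^[k + 1] x) := by
      rw [ae_all_iff]
      intro k
      filter_upwards [(isCircleLift_liftMeasure hν).ae_coe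
        ((hT.iterate k).quasiMeasurePreserving.ae hJ)] with x hx
      rw [B.f_iterate_coe, B.Df_coe, B.hf, ← Function.iterate_succ_apply' B.F] at hx
      exact hx
    filter_upwards [hall] with x hx
    induction n with
    | zero => simp
    | succ n ih =>
      have ih' := ih (by
        intro a ha b hb hab
        exact hinj ha hb (by rw [Function.iterate_succ_apply', hab, Function.iterate_succ_apply']))
      rw [ih', hx n, Finset.prod_range_succ, abs_mul, ENNReal.ofReal_mul (abs_nonneg _), mul_assoc]
  have hvol : ∀ᵐ x : ℝ, liftDensity ν x ≠ 0 → liftDensity ν x =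
      ENNReal.ofReal |∏ i ∈ Finset.range n, deriv B.F (B.F^[i] x)| *
        liftDensity ν (B.F^[n] x) := (ae_withDensity_iff (measurable_liftDensity ν)).1 hiter
  rw [liftMeasure, withDensity_apply _ hS, withDensity_apply _
    (hS.image_of_measurable_injOn (B.continuous_iterate n).measurable hinj),
    lintegral_image_eq_lintegral_abs_deriv_mul hS
      (fun x _ => (B.hasDerivAt_iterate n x).hasDerivWithinAt) hinj]
  refine setLIntegral_congr_fun_ae hS ?_
  filter_upwards [hvol] with x hx hxS
  exact (hx (hpos x hxS)).symm

end BimodData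

/-- Lebesgue differentiation along all short intervals containing a point. -/
theorem ae_forall_interval_integral_le {h : ℝ → ℝ} (hh : LocallyIntegrable h volume) :
    ∀ᵐ x : ℝ, ∀ ε > 0, ∃ τ > 0, ∀ a b, a < b → x ∈ Icc a b → b - a ≤ τ →
      ∫ t in a..b, |h t - h x| ≤ ε * (b - a) := by
  filter_upwards [IsUnifLocDoublingMeasure.ae_tendsto_average_norm_sub (μ := volume) hh 1]
    with x hx ε hε
  have ht := hx (ι := ℝ × ℝ)
    (l := comap Prod.snd (nhdsWithin 0 (Ioi 0)) ⊓ 𝓟 {p | x ∈ Metric.closedBall p.1 p.2})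
    Prod.fst Prod.snd (tendsto_comap.mono_left inf_le_left) (by
      refine Eventually.filter_mono inf_le_right ?_
      rw [eventually_principal]
      intro p hp
      rw [one_mul]
      exact hp)
  have hev := ht.eventually (gt_mem_nhds hε)
  rw [eventually_inf_principal, eventually_comap] at hev
  obtain ⟨δ, hδ, hball⟩ := mem_nhdsGT_iff_exists_Ioo_subset.1 hev
  refine ⟨δ, hδ, fun a b hab hxab hbδ => ?_⟩
  have h1 := hball (show (b - a) / 2 ∈ Ioo 0 δ from ⟨by linarith, by linarith [mem_Ioi.1 hδ]⟩)
    ((a + b) / 2, (b - a) / 2) rfl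
  have hcb : Metric.closedBall ((a + b) / 2) ((b - a) / 2) = Icc a b := by
    rw [Real.closedBall_eq_Icc]; congr 1 <;> ring
  simp only [mem_ofPred_eq, hcb, hxab, forall_const] at h1
  rw [setAverage_eq, smul_eq_mul, Real.volume_real_Icc_of_le hab.le,
    inv_mul_lt_iff₀ (by linarith)] at h1
  rw [intervalIntegral.integral_of_le hab.le, ← integral_Icc_eq_integral_Ioc]
  have : ∫ t in Icc a b, |h t - h x| = ∫ t in Icc a b, ‖h t - h x‖ := rfl
  rw [this]
  linarith

/-- There are arbitrarily large times at which the orbit of a rotation is evenly spread. -/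
theorem exists_well_spaced {ρ : ℝ} (hρ : Irrational ρ) (N₀ : ℕ) :
    ∃ N : ℕ, N₀ ≤ N ∧ ∀ j : ℕ, 1 ≤ j → j < N → ∀ p : ℤ, 1 ≤ 2 * N * |j * ρ - p| := by
  have hpos : ∀ j : ℕ, 1 ≤ j → ∀ p : ℤ, 0 < |j * ρ - p| := by
    intro j hj p
    rw [abs_pos, sub_ne_zero]
    exact fun h => (hρ.natCast_mul (by omega)).ne_int p h
  set r : ℕ → ℝ := fun j => |j * ρ - round (j * ρ)| with hr
  have hround : ∀ (j : ℕ) (p : ℤ), r j ≤ |j * ρ - p| := fun j p => round_le _ _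
  obtain ⟨j₀, hj₀, hmin⟩ := Finset.exists_min_image (Finset.Icc 1 (N₀ + 1)) r ⟨1, by simp⟩
  rw [Finset.mem_Icc] at hj₀
  have hj₀p : 0 < r j₀ := hpos j₀ hj₀.1 _
  have hex : ∃ N : ℕ, 1 ≤ N ∧ r N < r j₀ := by
    obtain ⟨n, hn⟩ := exists_nat_gt (1 / r j₀)
    have hn0 : 0 < n := by
      have : (0 : ℝ) < n := lt_trans (by positivity) hn
      exact_mod_cast this
    obtain ⟨k, hk0, -, hk⟩ := Real.exists_nat_abs_mul_sub_round_le ρ hn0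
    refine ⟨k, hk0, hk.trans_lt ?_⟩
    rw [div_lt_iff₀ (by positivity)]
    rw [div_lt_iff₀ hj₀p] at hn
    nlinarith
  classical
  obtain ⟨N, ⟨hN1, hNlt⟩, hfind⟩ : ∃ N : ℕ, (1 ≤ N ∧ r N < r j₀) ∧
      ∀ j < N, ¬ (1 ≤ j ∧ r j < r j₀) :=
    ⟨Nat.find hex, Nat.find_spec hex, fun j hj => Nat.find_min hex hj⟩
  have hmin' : ∀ j, 1 ≤ j → j < N → r j₀ ≤ r j := by
    intro j hj hjN
    by_contra hcon
    exact hfind j hjN ⟨hj, not_le.1 hcon⟩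
  have hN₀ : N₀ + 1 < N := by
    by_contra hcon
    exact absurd (hmin N (Finset.mem_Icc.2 ⟨hN1, by omega⟩)) (not_le.2 hNlt)
  refine ⟨N, by omega, fun j hj hjN p => ?_⟩
  have key : 1 ≤ 2 * N * r j₀ := by
    set e := j₀ * ρ - round (j₀ * ρ) with he
    set e' := N * ρ - round (N * ρ) with he'
    have hre : r j₀ = |e| := rfl
    have hre' : r N = |e'| := rfl
    have hid : ((j₀ * round (N * ρ) - N * round (j₀ * ρ) : ℤ) : ℝ) = N * e - j₀ * e' := by
      push_cast; rw [he, he']; ring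
    have hj0N : (j₀ : ℝ) ≤ N := by exact_mod_cast (by omega : j₀ ≤ N)
    have hj01 : (1 : ℝ) ≤ j₀ := by exact_mod_cast hj₀.1
    rw [hre, hre'] at hNlt
    have hne : (j₀ * round (N * ρ) - N * round (j₀ * ρ) : ℤ) ≠ 0 := by
      intro h0
      rw [h0] at hid
      have h1 : (N : ℝ) * |e| = j₀ * |e'| := by
        rw [← Nat.abs_cast N, ← Nat.abs_cast j₀, ← abs_mul, ← abs_mul]
        congr 1
        simp only [Int.cast_zero] at hid
        linarith
      nlinarith [abs_nonneg e']
    have h1 : (1 : ℝ) ≤ |((j₀ * round (N * ρ) - N * round (j₀ * ρ) : ℤ) : ℝ)| := by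
      exact_mod_cast Int.one_le_abs hne
    rw [hid] at h1
    have h2 : |N * e - j₀ * e'| ≤ N * |e| + j₀ * |e'| := by
      refine (abs_sub _ _).trans (le_of_eq ?_)
      rw [abs_mul, abs_mul, Nat.abs_cast, Nat.abs_cast]
    rw [hre]
    nlinarith [abs_nonneg e']
  have h1 := hmin' j hj hjN
  have h2 := hround j p
  have h3 : (0 : ℝ) < 2 * N := by positivity
  nlinarith

/-- A periodic density on the line, seen as a measure on the circle. -/
def circleMeasure (h : ℝ → ℝ) : Measure UnitAddCircle :=
  volume.withDensity fun y => ENNReal.ofReal (AddCircle.liftIco 1 0 h y)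

theorem isCircleLift_circleMeasure {h : ℝ → ℝ}
    (hper : ∀ (x : ℝ) (n : ℤ), h (x + n) = h x) :
    IsCircleLift (volume.withDensity fun x => ENNReal.ofReal (h x)) (circleMeasure h) := by
  have hlift : ∀ x : ℝ, AddCircle.liftIco 1 0 h (x : UnitAddCircle) = h x := by
    intro x
    obtain ⟨n, hn⟩ := BimodData.exists_int_mem_Ico x 0
    rw [← BimodData.coe_add_int x n, AddCircle.liftIco_coe_apply hn, hper]
  intro t E hE
  have hpre := measurable_coe_circle hE
  rw [circleMeasure, withDensity_apply _ hE, withDensity_apply _ (hpre.inter measurableSet_Ioc),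
    ← lintegral_indicator hE, ← UnitAddCircle.lintegral_preimage t,
    ← Measure.restrict_restrict hpre, ← lintegral_indicator hpre]
  refine lintegral_congr fun x => ?_
  simp only [indicator, hlift]
  rfl

/-- A degree one map which is increasing off a plateau `(c, d)`, together with an invariant
density vanishing on the plateau. -/
structure PlateauSystem (F h : ℝ → ℝ) (c d K : ℝ) : Prop where
  F_add_int : ∀ (x : ℝ) (n : ℤ), F (x + n) = F x + n
  cont : Continuous F
  lt : c < d
  lt_add_one : d < c + 1
  map_eq : F c = F d
  mono : StrictMonoOn F (Icc d (c + 1))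
  K_nonneg : 0 ≤ K
  cr : ∀ a b e g, d ≤ a → a < b → b < e → e < g → g ≤ c + 1 →
    Real.exp (-(K * (g - a))) * crossRatio a b e g ≤ crossRatio (F a) (F b) (F e) (F g)
  h_meas : Measurable h
  h_nonneg : ∀ x, 0 ≤ h x
  h_add_int : ∀ (x : ℝ) (n : ℤ), h (x + n) = h x
  h_int : LocallyIntegrable h volume
  h_one : ∫ t in (0 : ℝ)..1, h t = 1
  h_zero : ∫ t in c..d, h t = 0
  inv : ∀ a b, d ≤ a → a ≤ b → b ≤ c + 1 → ∫ t in F a..F b, h t = ∫ t in a..b, h t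

/-- Points at which a density is nearly constant at all scales below `τ`. -/
def GoodPoint (h : ℝ → ℝ) (ε τ x : ℝ) : Prop :=
  0 < h x ∧ ∀ a b, a < b → x ∈ Icc a b → b - a ≤ τ →
    ∫ t in a..b, |h t - h x| ≤ ε * h x * (b - a)

namespace PlateauSystem

variable {F h : ℝ → ℝ} {c d K : ℝ}

theorem ii (P : PlateauSystem F h c d K) (a b : ℝ) : IntervalIntegrable h volume a b :=
  (P.h_int.integrableOn_isCompact isCompact_uIcc).intervalIntegrable

/-- The distribution function of the invariant density. -/
def phi (h : ℝ → ℝ) (d z : ℝ) : ℝ := ∫ t in d..z, h t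

theorem phi_sub (P : PlateauSystem F h c d K) (a b : ℝ) :
    phi h d b - phi h d a = ∫ t in a..b, h t :=
  intervalIntegral.integral_interval_sub_left (P.ii _ _) (P.ii _ _)

theorem phi_mono (P : PlateauSystem F h c d K) : Monotone (phi h d) := by
  intro a b hab
  have := P.phi_sub a b
  have h2 : 0 ≤ ∫ t in a..b, h t := intervalIntegral.integral_nonneg hab fun t _ => P.h_nonneg t
  linarith

theorem lt_of_phi_lt (P : PlateauSystem F h c d K) {a b : ℝ} (hab : phi h d a < phi h d b) :
    a < b := P.phi_mono.reflect_lt hab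

theorem phi_cont (P : PlateauSystem F h c d K) : Continuous (phi h d) :=
  intervalIntegral.continuous_primitive (fun a b => P.ii a b) d

theorem phi_add_int (P : PlateauSystem F h c d K) (z : ℝ) (n : ℤ) :
    phi h d (z + n) = phi h d z + n := by
  have hp : Function.Periodic h 1 := fun x => by simpa using P.h_add_int x 1
  have h1 : ∀ z, phi h d (z + 1) = phi h d z + 1 := by
    intro z
    have := P.phi_sub z (z + 1)
    rw [hp.intervalIntegral_add_eq z 0, zero_add, P.h_one] at this
    linarith
  have hnat : ∀ (k : ℕ) (z : ℝ), phi h d (z + k) = phi h d z + k := by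
    intro k
    induction k with
    | zero => simp
    | succ k ih => intro z; push_cast; rw [← add_assoc, h1, ih]; ring
  obtain ⟨k, rfl | rfl⟩ := n.eq_nat_or_neg
  · exact_mod_cast hnat k z
  · have := hnat k (z + ((-(k : ℤ) : ℤ) : ℝ))
    push_cast at this ⊢
    rw [neg_add_cancel_right] at this
    linarith

theorem phi_d (h : ℝ → ℝ) (d : ℝ) : phi h d d = 0 := intervalIntegral.integral_same

theorem phi_c (P : PlateauSystem F h c d K) : phi h d c = 0 := by
  have := P.phi_sub c d
  rw [P.h_zero, phi_d] at this
  linarith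

theorem phi_map (P : PlateauSystem F h c d K) {x : ℝ} {n : ℤ}
    (hx : x ∈ Icc (d + n) (c + 1 + n)) : phi h d (F x) = phi h d x + phi h d (F c) := by
  have key : ∀ y ∈ Icc d (c + 1), phi h d (F y) = phi h d y + phi h d (F c) := by
    intro y hy
    have h1 := P.inv d y le_rfl hy.1 hy.2
    rw [← P.phi_sub, ← P.phi_sub, phi_d, ← P.map_eq] at h1
    linarith
  have := key (x - n) ⟨by linarith [hx.1], by linarith [hx.2]⟩
  have e : x = (x - n) + n := by ring
  rw [e, P.F_add_int, P.phi_add_int, P.phi_add_int, this]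
  ring

theorem exists_phi_eq (P : PlateauSystem F h c d K) (s : ℝ) : ∃ z, phi h d z = s := by
  have h1 : phi h d (d + (⌊s⌋ : ℤ)) ≤ s := by
    rw [P.phi_add_int, phi_d]; linarith [Int.floor_le s]
  have h2 : s ≤ phi h d (d + ((⌊s⌋ + 1 : ℤ) : ℝ)) := by
    rw [P.phi_add_int, phi_d]; push_cast; linarith [(Int.lt_floor_add_one s).le]
  obtain ⟨z, -, hz⟩ := intermediate_value_Icc (by push_cast; linarith)
    P.phi_cont.continuousOn ⟨h1, h2⟩
  exact ⟨z, hz⟩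

theorem exists_lap (P : PlateauSystem F h c d K) {a g σ : ℝ} (hag : a ≤ g)
    (hσ : phi h d g - phi h d a ≤ σ) (hp : ∀ p : ℤ, σ < |phi h d a - p|) :
    ∃ n : ℤ, d + n ≤ a ∧ g ≤ c + 1 + n := by
  have h0 := P.phi_mono hag
  have h1 := hp ⌊phi h d a⌋
  have h2 := hp (⌊phi h d a⌋ + 1)
  have h3 := Int.floor_le (phi h d a)
  have h4 := Int.lt_floor_add_one (phi h d a)
  rw [abs_of_nonneg (by linarith)] at h1
  push_cast at h2
  rw [abs_of_neg (by linarith)] at h2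
  refine ⟨⌊phi h d a⌋, le_of_lt (P.lt_of_phi_lt ?_), le_of_lt (P.lt_of_phi_lt ?_)⟩
  · rw [P.phi_add_int, phi_d]; linarith
  · rw [add_right_comm]
    have := P.phi_add_int (c + (⌊phi h d a⌋ : ℝ)) 1
    push_cast at this
    rw [this, P.phi_add_int, P.phi_c]
    linarith

theorem mono_lap (P : PlateauSystem F h c d K) (n : ℤ) :
    StrictMonoOn F (Icc (d + n) (c + 1 + n)) := by
  intro x hx y hy hxy
  have := P.mono (a := x - n) ⟨by linarith [hx.1], by linarith [hx.2]⟩ (b := y - n)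
    ⟨by linarith [hy.1], by linarith [hy.2]⟩ (by linarith)
  have h1 := P.F_add_int (x - n) n
  have h2 := P.F_add_int (y - n) n
  rw [sub_add_cancel] at h1 h2
  linarith

theorem cr_lap (P : PlateauSystem F h c d K) (n : ℤ) {a b e g : ℝ} (ha : d + n ≤ a) (hab : a < b)
    (hbe : b < e) (heg : e < g) (hg : g ≤ c + 1 + n) :
    Real.exp (-(K * (g - a))) * crossRatio a b e g ≤ crossRatio (F a) (F b) (F e) (F g) := by
  have := P.cr (a - n) (b - n) (e - n) (g - n) (by linarith) (by linarith) (by linarith)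
    (by linarith) (by linarith)
  have hF : ∀ x, F (x - n) = F x + (-(n : ℝ)) := by
    intro x
    have := P.F_add_int (x - n) n
    rw [sub_add_cancel] at this
    linarith
  simp only [hF, sub_sub_sub_cancel_right] at this
  simp only [sub_eq_add_neg _ (n : ℝ), crossRatio_add] at this
  exact this

/-- Pushing a short interval forward along the rotation. -/
theorem push (P : PlateauSystem F h c d K) {a g σ : ℝ} (hag : a ≤ g)
    (hσ : phi h d g - phi h d a ≤ σ) {m : ℕ}
    (hp : ∀ i < m, ∀ p : ℤ, σ < |phi h d a + i * phi h d (F c) - p|) :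
    StrictMonoOn (F^[m]) (Icc a g) ∧
    (∀ t ∈ Icc a g, phi h d (F^[m] t) = phi h d t + m * phi h d (F c)) ∧
    ∀ b e, a < b → b < e → e < g →
      Real.exp (-(K * ∑ i ∈ Finset.range m, (F^[i] g - F^[i] a))) * crossRatio a b e g ≤
        crossRatio (F^[m] a) (F^[m] b) (F^[m] e) (F^[m] g) := by
  have ma : a ∈ Icc a g := ⟨le_rfl, hag⟩
  have mg : g ∈ Icc a g := ⟨hag, le_rfl⟩
  induction m with
  | zero => exact ⟨fun x _ y _ hxy => hxy, fun t _ => by simp, fun b e _ _ _ => by simp⟩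
  | succ m ih =>
    obtain ⟨h1, h2, h3⟩ := ih fun i hi => hp i (by omega)
    have hm1 : F^[m] a ≤ F^[m] g := h1.monotoneOn ma mg hag
    obtain ⟨n, hn1, hn2⟩ := P.exists_lap (σ := σ) hm1 (by
      rw [h2 a ma, h2 g mg]; linarith) (by
      rw [h2 a ma]; exact hp m (by omega))
    have hmem : ∀ t ∈ Icc a g, F^[m] t ∈ Icc (d + n) (c + 1 + n) := fun t ht =>
      ⟨hn1.trans (h1.monotoneOn ma ht ht.1), (h1.monotoneOn ht mg ht.2).trans hn2⟩
    refine ⟨?_, ?_, ?_⟩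
    · intro x hx y hy hxy
      rw [Function.iterate_succ_apply', Function.iterate_succ_apply']
      exact P.mono_lap n (hmem x hx) (hmem y hy) (h1 hx hy hxy)
    · intro t ht
      rw [Function.iterate_succ_apply', P.phi_map (hmem t ht), h2 t ht]
      push_cast; ring
    · intro b e hab hbe heg
      have mb : b ∈ Icc a g := ⟨by linarith, by linarith⟩
      have me : e ∈ Icc a g := ⟨by linarith, by linarith⟩
      have h4 := h3 b e hab hbe heg
      have h5 := P.cr_lap n hn1 (h1 ma mb hab) (h1 mb me hbe) (h1 me mg heg) hn2
      simp only [Function.iterate_succ_apply']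
      refine le_trans ?_ h5
      rw [Finset.sum_range_succ]
      calc _ = Real.exp (-(K * (F^[m] g - F^[m] a))) *
            (Real.exp (-(K * ∑ i ∈ Finset.range m, (F^[i] g - F^[i] a))) *
              crossRatio a b e g) := by
            rw [← mul_assoc, ← Real.exp_add]; congr 2; ring
        _ ≤ _ := by gcongr

theorem coe_disjoint (P : PlateauSystem F h c d K) {n : ℕ} {a g : ℕ → ℝ} {σ : ℝ}
    (hφ : ∀ i < n, phi h d (g i) - phi h d (a i) ≤ σ)
    (hsep : ∀ i < n, ∀ j < n, i ≠ j → ∀ p : ℤ, σ < |phi h d (a i) - phi h d (a j) - p|)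
    (y : UnitAddCircle) (s : Finset ℕ) (hs : s ⊆ Finset.range n)
    (hy : ∀ i ∈ s, ∃ x ∈ Ioc (a i) (g i), (x : UnitAddCircle) = y) : s.card ≤ 1 := by
  rw [Finset.card_le_one]
  intro i hi j hj
  by_contra hij
  obtain ⟨x, hx, hxy⟩ := hy i hi
  obtain ⟨x', hx', hxy'⟩ := hy j hj
  obtain ⟨p, hp⟩ := BimodData.coe_eq_coe_iff.1 (hxy'.trans hxy.symm)
  have hin := Finset.mem_range.1 (hs hi)
  have hjn := Finset.mem_range.1 (hs hj)
  have h1 := hsep i hin j hjn hij p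
  have h2 := P.phi_add_int x' p
  rw [← hp] at h2
  have e1 := P.phi_mono hx.1.le
  have e2 := P.phi_mono hx.2
  have e3 := P.phi_mono hx'.1.le
  have e4 := P.phi_mono hx'.2
  have e5 := hφ i hin
  have e6 := hφ j hjn
  rw [lt_abs] at h1
  rcases h1 with h1 | h1 <;> linarith

theorem sub_le_one (P : PlateauSystem F h c d K) {a g : ℝ}
    (hφ : phi h d g - phi h d a < 1) : g - a ≤ 1 := by
  have := P.phi_add_int a 1
  push_cast at this
  have h1 : g < a + 1 := P.lt_of_phi_lt (by linarith)
  linarith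

theorem sum_length_le (P : PlateauSystem F h c d K) {n : ℕ} {a g : ℕ → ℝ} {σ : ℝ} (hσ : σ < 1)
    (hag : ∀ i < n, a i ≤ g i) (hφ : ∀ i < n, phi h d (g i) - phi h d (a i) ≤ σ)
    (hsep : ∀ i < n, ∀ j < n, i ≠ j → ∀ p : ℤ, σ < |phi h d (a i) - phi h d (a j) - p|) :
    ∑ i ∈ Finset.range n, (g i - a i) ≤ 1 := by
  have := isCircleLift_volume.sum_le (Finset.range n) (fun i => Ioc (a i) (g i)) a
    (fun i _ => measurableSet_Ioc) (fun i hi x hx => ⟨hx.1, hx.2.trans (by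
      linarith [P.sub_le_one ((hφ i (Finset.mem_range.1 hi)).trans_lt hσ)])⟩) 1 univ
    MeasurableSet.univ (fun _ _ _ _ => mem_univ _) (P.coe_disjoint hφ hsep)
  simp only [Real.volume_Ioc] at this
  rw [← ENNReal.ofReal_sum_of_nonneg (fun i hi => by
    linarith [hag i (Finset.mem_range.1 hi)]), UnitAddCircle.measure_univ] at this
  simpa using this

theorem withDensity_Ioc (P : PlateauSystem F h c d K) {a b : ℝ} (hab : a ≤ b) :
    (volume.withDensity fun x => ENNReal.ofReal (h x)) (Ioc a b) =
      ENNReal.ofReal (phi h d b - phi h d a) := by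
  rw [withDensity_apply _ measurableSet_Ioc, P.phi_sub, intervalIntegral.integral_of_le hab,
    ofReal_integral_eq_lintegral_ofReal (P.ii a b).1 (ae_of_all _ P.h_nonneg)]

theorem goodPoint_add_int (hper : ∀ (x : ℝ) (n : ℤ), h (x + n) = h x) {ε τ x : ℝ}
    (hx : GoodPoint h ε τ x) (n : ℤ) : GoodPoint h ε τ (x + n) := by
  refine ⟨by rw [hper]; exact hx.1, fun a b hab hxab hτ => ?_⟩
  have := hx.2 (a - n) (b - n) (by linarith) ⟨by linarith [hxab.1], by linarith [hxab.2]⟩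
    (by linarith)
  rw [hper]
  calc ∫ t in a..b, |h t - h x| = ∫ t in (a - n)..(b - n), |h (t + n) - h x| := by
        rw [intervalIntegral.integral_comp_add_right (fun t => |h t - h x|)]; simp
    _ ≤ _ := by
        simp only [hper]
        linarith

/-- Most points are good at small scales. -/
theorem exists_goodPoint_scale (P : PlateauSystem F h c d K) {ε : ℝ} (hε : 0 < ε) :
    ∃ τ > 0, ENNReal.ofReal (19 / 20) < (volume.withDensity fun x => ENNReal.ofReal (h x))
      ({x | GoodPoint h ε τ x} ∩ Ioc 0 1) := by
  set m := volume.withDensity fun x => ENNReal.ofReal (h x) with hm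
  have hae : ∀ᵐ x ∂m, ∃ k : ℕ, GoodPoint h ε (1 / (k + 1)) x := by
    rw [hm, ae_withDensity_iff P.h_meas.ennreal_ofReal]
    filter_upwards [ae_forall_interval_integral_le P.h_int] with x hx hx0
    have hpos : 0 < h x := by simpa using hx0
    obtain ⟨τ, hτ, H⟩ := hx (ε * h x) (by positivity)
    obtain ⟨k, hk⟩ := exists_nat_one_div_lt hτ
    exact ⟨k, hpos, fun a b hab hxab hl => H a b hab hxab (hl.trans hk.le)⟩
  set S : ℕ → Set ℝ := fun k => {x | GoodPoint h ε (1 / (k + 1)) x} ∩ Ioc 0 1 with hS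
  have hmono : Monotone S := by
    intro k l hkl x hx
    refine ⟨⟨hx.1.1, fun a b hab hxab hl => hx.1.2 a b hab hxab (hl.trans ?_)⟩, hx.2⟩
    gcongr
  have hfull : m (⋃ k, S k) = 1 := by
    have h1 : m (Ioc 0 1) = 1 := by
      rw [hm, P.withDensity_Ioc zero_le_one, P.phi_sub, P.h_one, ENNReal.ofReal_one]
    rw [← h1]
    refine measure_congr ?_
    filter_upwards [hae] with x hx
    refine propext ⟨fun hxu => ?_, fun hx1 => ?_⟩
    · obtain ⟨k, hk⟩ := mem_iUnion.1 hxu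
      exact hk.2
    · obtain ⟨k, hk⟩ := hx
      exact mem_iUnion.2 ⟨k, hk, hx1⟩
  rw [hmono.measure_iUnion] at hfull
  have hlt : ENNReal.ofReal (19 / 20) < ⨆ k, m (S k) := by
    rw [hfull, ← ENNReal.ofReal_one]
    exact (ENNReal.ofReal_lt_ofReal_iff one_pos).2 (by norm_num)
  obtain ⟨k, hk⟩ := lt_iSup_iff.1 hlt
  exact ⟨1 / (k + 1), by positivity, hk⟩

/-- Among many disjoint intervals of equal mass, one is short and contains a good point. -/
theorem exists_good_index (P : PlateauSystem F h c d K) {ε τ : ℝ} (hτ : 0 < τ)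
    (hG : ENNReal.ofReal (19 / 20) < (volume.withDensity fun x => ENNReal.ofReal (h x))
      ({x | GoodPoint h ε τ x} ∩ Ioc 0 1)) {n : ℕ} {a g : ℕ → ℝ} {σ : ℝ} (hσ0 : 0 ≤ σ) (hσ : σ < 1)
    (hag : ∀ i < n, a i ≤ g i) (hφ : ∀ i < n, phi h d (g i) - phi h d (a i) = σ)
    (hsep : ∀ i < n, ∀ j < n, i ≠ j → ∀ p : ℤ, σ < |phi h d (a i) - phi h d (a j) - p|)
    (hnum : 1 / 20 + σ / τ ≤ n * σ) :
    ∃ i < n, g i - a i ≤ τ ∧ ∃ x ∈ Icc (a i) (g i), GoodPoint h ε τ x := by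
  classical
  by_contra! hcon
  set m := volume.withDensity fun x => ENNReal.ofReal (h x) with hm
  have hl : IsCircleLift m (circleMeasure h) := isCircleLift_circleMeasure P.h_add_int
  set s := (Finset.range n).filter fun i => g i - a i ≤ τ with hs
  set E : Set UnitAddCircle := ⋃ i ∈ s, (fun x : ℝ => (x : UnitAddCircle)) '' Ioc (a i) (g i)
  have hsn : ∀ i ∈ s, i < n := fun i hi => Finset.mem_range.1 (Finset.mem_filter.1 hi).1
  have hshort : ∀ i ∈ s, Ioc (a i) (g i) ⊆ Ioc (a i) (a i + 1) := fun i hi x hx =>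
    ⟨hx.1, hx.2.trans (by linarith [P.sub_le_one ((hφ i (hsn i hi)).trans_lt hσ)])⟩
  have hE : MeasurableSet E := Finset.measurableSet_biUnion s fun i hi =>
    measurableSet_coe_image measurableSet_Ioc (hshort i hi)
  have hsum := hl.sum_le s (fun i => Ioc (a i) (g i)) a (fun i _ => measurableSet_Ioc)
    hshort 1 E hE
    (fun i hi x hx => mem_biUnion (show i ∈ (s : Set ℕ) from hi) ⟨x, hx, rfl⟩)
    (fun y u hu => P.coe_disjoint (fun i hi => (hφ i hi).le) hsep y u
      (hu.trans (Finset.filter_subset _ _)))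
  have hmass : ∀ i ∈ s, m (Ioc (a i) (g i)) = ENNReal.ofReal σ := fun i hi => by
    rw [hm, P.withDensity_Ioc (hag i (hsn i hi)), hφ i (hsn i hi)]
  rw [Finset.sum_congr rfl hmass, Finset.sum_const, nsmul_eq_mul, Nat.cast_one, one_mul] at hsum
  have hcard : (1 : ℝ) / 20 ≤ s.card * σ := by
    have h1 := P.sum_length_le hσ hag (fun i hi => (hφ i hi).le) hsep
    have h2 : ((n : ℝ) - s.card) * τ ≤ ∑ i ∈ Finset.range n, (g i - a i) := by
      rw [← Finset.sum_filter_add_sum_filter_not _ (fun i => g i - a i ≤ τ)]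
      have h3 : 0 ≤ ∑ i ∈ (Finset.range n).filter (fun i => g i - a i ≤ τ), (g i - a i) :=
        Finset.sum_nonneg fun i hi => by linarith [hag i (hsn i hi)]
      have h4 : (((Finset.range n).filter fun i => ¬ (g i - a i ≤ τ)).card : ℝ) * τ ≤
          ∑ i ∈ (Finset.range n).filter (fun i => ¬ (g i - a i ≤ τ)), (g i - a i) := by
        rw [← nsmul_eq_mul]
        exact Finset.card_nsmul_le_sum _ _ _ fun i hi =>
          (not_le.1 (Finset.mem_filter.1 hi).2).le
      have h5 := Finset.card_filter_add_card_filter_not (s := Finset.range n)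
        (fun i => g i - a i ≤ τ)
      rw [Finset.card_range] at h5
      have h6 : (n : ℝ) - s.card = ((Finset.range n).filter fun i => ¬ (g i - a i ≤ τ)).card := by
        have h5' : (s.card : ℝ) + ((Finset.range n).filter fun i => ¬ (g i - a i ≤ τ)).card = n := by
          exact_mod_cast h5
        linarith
      rw [h6]
      linarith
    have h7 : ((n : ℝ) - s.card) ≤ 1 / τ := by
      rw [le_div_iff₀ hτ]; linarith
    have h8 : ((n : ℝ) - s.card) * σ ≤ 1 / τ * σ := by gcongr
    have h9 : 1 / τ * σ = σ / τ := by ring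
    linarith
  have hνE : ENNReal.ofReal (1 / 20) ≤ circleMeasure h E := by
    refine le_trans ?_ hsum
    rw [← ENNReal.ofReal_natCast, ← ENNReal.ofReal_mul (Nat.cast_nonneg _)]
    exact ENNReal.ofReal_le_ofReal hcard
  rw [hl 0 E hE, zero_add] at hνE
  have hpre := measurable_coe_circle hE
  have h1 : m (Ioc 0 1) = 1 := by
    rw [hm, P.withDensity_Ioc zero_le_one, P.phi_sub, P.h_one, ENNReal.ofReal_one]
  have hdisj : {x | GoodPoint h ε τ x} ∩ Ioc 0 1 ⊆
      Ioc 0 1 \ ((fun x : ℝ => (x : UnitAddCircle)) ⁻¹' E) := by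
    rintro x ⟨hx, hx1⟩
    refine ⟨hx1, fun hxE => ?_⟩
    obtain ⟨i, hi, y, hy, hyx⟩ := mem_iUnion₂.1 hxE
    obtain ⟨p, hp⟩ := BimodData.coe_eq_coe_iff.1 hyx.symm
    refine hcon i (hsn i hi) (Finset.mem_filter.1 hi).2 y (Ioc_subset_Icc_self hy) ?_
    rw [hp]
    exact goodPoint_add_int P.h_add_int hx p
  have h2 := measure_inter_add_sdiff (μ := m) (Ioc (0:ℝ) 1) hpre
  rw [inter_comm, h1] at h2
  have h3 : ENNReal.ofReal (1 / 20) + ENNReal.ofReal (19 / 20) < 1 := by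
    calc ENNReal.ofReal (1 / 20) + ENNReal.ofReal (19 / 20)
        < m ((fun x : ℝ => (x : UnitAddCircle)) ⁻¹' E ∩ Ioc 0 1) +
          m (Ioc 0 1 \ ((fun x : ℝ => (x : UnitAddCircle)) ⁻¹' E)) :=
          ENNReal.add_lt_add_of_le_of_lt ENNReal.ofReal_ne_top hνE
            (hG.trans_le (measure_mono hdisj))
      _ = 1 := h2
  rw [← ENNReal.ofReal_add (by norm_num) (by norm_num)] at h3
  norm_num at h3

theorem goodPoint_estimate (P : PlateauSystem F h c d K) {ε τ x a g s t : ℝ}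
    (hx : GoodPoint h ε τ x) (hxag : x ∈ Icc a g) (hag : a < g) (hτ : g - a ≤ τ) (has : a ≤ s)
    (hst : s ≤ t) (htg : t ≤ g) :
    |(phi h d t - phi h d s) - h x * (t - s)| ≤ ε * h x * (g - a) := by
  refine le_trans ?_ (hx.2 a g hag hxag hτ)
  have hi : ∀ a b, IntervalIntegrable (fun t => h t - h x) volume a b := fun a b =>
    (P.ii a b).sub intervalIntegrable_const
  have e : (phi h d t - phi h d s) - h x * (t - s) = ∫ r in s..t, (h r - h x) := by
    rw [intervalIntegral.integral_sub (P.ii s t) intervalIntegrable_const, P.phi_sub,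
      intervalIntegral.integral_const, smul_eq_mul]
    ring
  rw [e]
  refine (intervalIntegral.abs_integral_le_integral_abs hst).trans ?_
  exact intervalIntegral.integral_mono_interval has hst htg
    (ae_of_all _ fun r => abs_nonneg _) (hi a g).abs

end PlateauSystem

namespace PlateauSystem

variable {F h : ℝ → ℝ} {c d K : ℝ}

theorem exists_preimage (P : PlateauSystem F h c d K) (z : ℝ) :
    ∃ x, F x = z ∧ ∃ n : ℤ, x ∈ Icc (d + n) (c + 1 + n) := by
  obtain ⟨n, hn⟩ := BimodData.exists_int_mem_Ico z (F d)
  have h1 : F (c + 1) = F d + 1 := by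
    have := P.F_add_int c 1
    push_cast at this
    rw [this, P.map_eq]
  obtain ⟨x, hx, hxz⟩ := intermediate_value_Icc P.lt_add_one.le P.cont.continuousOn
    (show z + n ∈ Icc (F d) (F (c + 1)) from ⟨hn.1, by rw [h1]; exact hn.2.le⟩)
  refine ⟨x + ((-n : ℤ) : ℝ), ?_, -n, ?_, ?_⟩
  · rw [P.F_add_int, hxz]; push_cast; ring
  · linarith [hx.1]
  · linarith [hx.2]

theorem exists_inverse_branch (P : PlateauSystem F h c d K) :
    ∃ ζ : ℝ → ℝ, StrictMono ζ ∧ (∀ z, F (ζ z) = z) ∧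
      ∀ z, phi h d (ζ z) = phi h d z - phi h d (F c) := by
  choose ζ h1 n hn using P.exists_preimage
  refine ⟨ζ, ?_, h1, fun z => ?_⟩
  · intro z z' hzz'
    by_contra! hle
    have key : F (ζ z') ≤ F (ζ z) := by
      rcases lt_trichotomy (n z') (n z) with hlt | heq | hgt
      · have a1 := (P.mono_lap (n z')).monotoneOn (hn z') ⟨(hn z').1.trans (hn z').2, le_rfl⟩
          (hn z').2
        have a2 := (P.mono_lap (n z)).monotoneOn ⟨le_rfl, (hn z).1.trans (hn z).2⟩ (hn z) (hn z).1
        have a3 : F (c + 1 + n z') = F c + 1 + n z' := by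
          rw [P.F_add_int]
          have := P.F_add_int c 1
          push_cast at this
          rw [this]
        have a4 : (n z' : ℝ) + 1 ≤ n z := by exact_mod_cast hlt
        rw [P.F_add_int, ← P.map_eq] at a2
        linarith
      · have := hn z'
        rw [heq] at this
        exact (P.mono_lap (n z)).monotoneOn this (hn z) hle
      · have a4 : (n z : ℝ) + 1 ≤ n z' := by exact_mod_cast hgt
        linarith [(hn z').1, (hn z).2, P.lt]
    rw [h1, h1] at key
    linarith
  · have := P.phi_map (hn z)
    rw [h1] at this
    linarith

theorem phi_critical_orbit (P : PlateauSystem F h c d K)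
    (horb : ∀ (k : ℕ) (j : ℤ), F^[k] (F c) + j ∉ Icc c d) (k : ℕ) :
    phi h d (F^[k] c) = k * phi h d (F c) := by
  have h1 : ∀ k : ℕ, phi h d (F^[k] (F c)) = (k + 1) * phi h d (F c) := by
    intro k
    induction k with
    | zero => simp
    | succ k ih =>
      obtain ⟨n, hn⟩ := BimodData.exists_int_mem_Ico (F^[k] (F c)) c
      have h2 := horb k n
      have h3 : d < F^[k] (F c) + n := by
        by_contra! h; exact h2 ⟨hn.1, h⟩
      rw [Function.iterate_succ_apply', P.phi_map (n := -n)
        ⟨by push_cast; linarith, by push_cast; linarith [hn.2]⟩, ih]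
      push_cast; ring
  cases k with
  | zero => simp [P.phi_c]
  | succ k => rw [Function.iterate_succ_apply, h1]; push_cast; ring

theorem phi_eq_of_tendsto (P : PlateauSystem F h c d K)
    (horb : ∀ (k : ℕ) (j : ℤ), F^[k] (F c) + j ∉ Icc c d) {ρ : ℝ}
    (hρ : Tendsto (fun k : ℕ => F^[k] c / k) atTop (nhds ρ)) : phi h d (F c) = ρ := by
  have hb : ∀ z, |phi h d z - z| ≤ |d| + 2 := by
    intro z
    obtain ⟨n, hn⟩ := BimodData.exists_int_mem_Ico z d
    have h1 := P.phi_mono hn.1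
    have h2 := P.phi_mono hn.2.le
    have h3 := P.phi_add_int d 1
    push_cast at h3
    rw [P.phi_add_int, phi_d] at h1
    rw [h3, P.phi_add_int, phi_d] at h2
    rw [abs_le]
    have := hn.1
    have := hn.2
    constructor <;> linarith [le_abs_self d, neg_abs_le d]
  have h1 : Tendsto (fun k : ℕ => (|d| + 2) / (k : ℝ)) atTop (nhds 0) :=
    tendsto_const_div_atTop_nhds_zero_nat _
  have h2 : Tendsto (fun k : ℕ => phi h d (F^[k] c) / k - F^[k] c / k) atTop (nhds 0) := by
    refine squeeze_zero_norm (fun k => ?_) h1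
    rw [← sub_div, norm_div, Real.norm_eq_abs, Real.norm_eq_abs, Nat.abs_cast]
    gcongr
    exact hb _
  have h3 := h2.add hρ
  simp only [sub_add_cancel, zero_add] at h3
  refine tendsto_nhds_unique (tendsto_const_nhds.congr' ?_) h3
  filter_upwards [eventually_gt_atTop 0] with k hk
  have : (k : ℝ) ≠ 0 := by exact_mod_cast hk.ne'
  rw [P.phi_critical_orbit horb]
  field_simp

/-- Pushing forward along the rotation with disjoint images costs a bounded factor. -/
theorem push_crossRatio (P : PlateauSystem F h c d K) {a b e g σ : ℝ} (hab : a < b) (hbe : b < e)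
    (heg : e < g) (hσ : phi h d g - phi h d a ≤ σ) (hσ1 : σ < 1) {m : ℕ}
    (hp : ∀ i < m, ∀ p : ℤ, σ < |phi h d a + i * phi h d (F c) - p|)
    (hsep : ∀ i < m, ∀ j < m, i ≠ j → ∀ p : ℤ, σ < |((i : ℝ) - j) * phi h d (F c) - p|) :
    Real.exp (-K) * crossRatio a b e g ≤
      crossRatio (F^[m] a) (F^[m] b) (F^[m] e) (F^[m] g) := by
  have hag : a < g := hab.trans (hbe.trans heg)
  have hpush := fun i (hi : i ≤ m) => P.push hag.le hσ (m := i) fun k hk => hp k (hk.trans_le hi)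
  have ma : a ∈ Icc a g := ⟨le_rfl, hag.le⟩
  have mg : g ∈ Icc a g := ⟨hag.le, le_rfl⟩
  refine le_trans ?_ ((hpush m le_rfl).2.2 b e hab hbe heg)
  have hsum := P.sum_length_le (n := m) (a := fun i => F^[i] a) (g := fun i => F^[i] g) hσ1
    (fun i hi => (hpush i hi.le).1.monotoneOn ma mg hag.le)
    (fun i hi => by
      rw [(hpush i hi.le).2.1 a ma, (hpush i hi.le).2.1 g mg]; linarith)
    (fun i hi j hj hij p => by
      rw [(hpush i hi.le).2.1 a ma, (hpush j hj.le).2.1 a ma]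
      have := hsep i hi j hj hij p
      convert this using 2
      ring)
  have hcr := (crossRatio_pos hab hbe heg).le
  gcongr
  nlinarith [P.K_nonneg]

set_option maxHeartbeats 1000000 in
/-- A plateau system with irrational rotation number and positive slope at `d` is impossible. -/
theorem contradiction (P : PlateauSystem F h c d K) {m₀ M₀ ρ : ℝ} (hm₀ : 0 < m₀)
    (hm : ∀ x ∈ Icc d (c + 1), m₀ * (x - d) ≤ F x - F d) (hM₀ : 0 < M₀)
    (hM : ∀ x y, x ≤ y → F y - F x ≤ M₀ * (y - x))
    (horb : ∀ (k : ℕ) (j : ℤ), F^[k] (F c) + j ∉ Icc c d)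
    (hρ : Irrational ρ) (hlim : Tendsto (fun k : ℕ => F^[k] c / k) atTop (nhds ρ)) : False := by
  have hφρ := P.phi_eq_of_tendsto horb hlim
  obtain ⟨ζ, hζm, hζF, hζφ⟩ := P.exists_inverse_branch
  rw [hφρ] at hζφ
  have hcd : 0 < d - c := by linarith [P.lt]
  set ε := min (Real.exp (-K) * Real.exp (-K) * (m₀ / M₀) * (d - c) / 49) (1 / 16) with hε
  have hε0 : 0 < ε := by positivity
  have hε1 : ε ≤ 1 / 16 := min_le_right _ _
  have hε2 : ε ≤ Real.exp (-K) * Real.exp (-K) * (m₀ / M₀) * (d - c) / 49 := min_le_left _ _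
  obtain ⟨τ₀, hτ₀, hG⟩ := P.exists_goodPoint_scale hε0
  obtain ⟨N, hN, hsp⟩ := exists_well_spaced hρ (max 10 ⌈2 / τ₀⌉₊)
  have hN10 : (10 : ℝ) ≤ N := by exact_mod_cast (le_max_left _ _).trans hN
  have hNτ : 2 ≤ N * τ₀ := by
    have h1 : (2 / τ₀ : ℝ) ≤ N := (Nat.le_ceil _).trans (by
      exact_mod_cast (le_max_right _ _).trans hN)
    rwa [div_le_iff₀ hτ₀] at h1
  have hN0 : (0 : ℝ) < N := by linarith
  set τ : ℝ := 1 / (9 * N) with hτdef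
  have hτN : τ * N = 1 / 9 := by rw [hτdef]; field_simp
  have hτ : 0 < τ := by positivity
  have hτs : τ ≤ 1 / 90 := by linarith [mul_le_mul_of_nonneg_left hN10 hτ.le]
  have hττ : 18 * τ ≤ τ₀ := by
    have h1 := mul_le_mul_of_nonneg_left hNτ hτ.le
    rw [← mul_assoc, hτN] at h1
    linarith
  have hτ1 : ∀ x : ℝ, 1 ≤ 2 * N * x → 4 * τ < x := by
    intro x hx
    have : 4 * τ * (2 * N) < x * (2 * N) := by linarith
    exact lt_of_mul_lt_mul_right this (by positivity)
  have hsp1 : ∀ j : ℕ, 1 ≤ j → j < N → ∀ p : ℤ, 4 * τ < |j * ρ - p| := fun j h1 h2 p =>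
    hτ1 _ (hsp j h1 h2 p)
  have hsp2 : ∀ i < N, ∀ j < N, i ≠ j → ∀ p : ℤ, 4 * τ < |((i : ℝ) - j) * ρ - p| := by
    intro i hi j hj hij p
    rcases lt_or_gt_of_ne hij with hlt | hlt
    · have := hsp1 (j - i) (by omega) (by omega) (-p)
      rw [Nat.cast_sub hlt.le, ← abs_neg] at this
      convert this using 2
      push_cast; ring
    · have := hsp1 (i - j) (by omega) (by omega) p
      rw [Nat.cast_sub hlt.le] at this
      exact this
  obtain ⟨u, hu⟩ := P.exists_phi_eq (-τ)
  obtain ⟨w1, hw1⟩ := P.exists_phi_eq τ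
  obtain ⟨w2, hw2⟩ := P.exists_phi_eq (2 * τ)
  have hφc := P.phi_c
  have hφd := phi_d h d
  have hφc1 : phi h d (c + 1) = 1 := by
    have := P.phi_add_int c 1
    push_cast at this; rw [this, hφc]; ring
  have hφd1 : phi h d (d - 1) = -1 := by
    have := P.phi_add_int d (-1)
    push_cast at this; rw [sub_eq_add_neg, this, hφd]; ring
  have hud : d - 1 < u := P.lt_of_phi_lt (by rw [hφd1, hu]; linarith)
  have huc : u < c := P.lt_of_phi_lt (by rw [hφc, hu]; linarith)
  have hdw : d < w1 := P.lt_of_phi_lt (by rw [hφd, hw1]; linarith)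
  have hww : w1 < w2 := P.lt_of_phi_lt (by rw [hw1, hw2]; linarith)
  have hwc : w2 < c + 1 := P.lt_of_phi_lt (by rw [hφc1, hw2]; linarith)
  -- backward orbit
  have hζk : ∀ (k : ℕ) (z : ℝ), phi h d (ζ^[k] z) = phi h d z - k * ρ := by
    intro k
    induction k with
    | zero => simp
    | succ k ih => intro z; rw [Function.iterate_succ_apply', hζφ, ih]; push_cast; ring
  have hζkm : ∀ k : ℕ, StrictMono (ζ^[k]) := fun k => hζm.iterate k
  have hFζ : ∀ (k : ℕ) (z : ℝ), F^[k] (ζ^[k] z) = z := fun k =>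
    Function.LeftInverse.iterate (g := F) (f := ζ) hζF k
  have hback : (d - c) * Real.exp (-K) / (3 * ε) ≤ (w1 - d) / (w2 - w1) := by
    obtain ⟨k, hk, hlen, x, hx, hgood⟩ := P.exists_good_index hτ₀ hG (n := N)
      (a := fun k => ζ^[k] c) (g := fun k => ζ^[k] w2) (σ := 2 * τ) (by positivity)
      (by linarith) (fun k _ => (hζkm k).monotone (by linarith))
      (fun k _ => by rw [hζk, hζk, hw2, hφc]; ring)
      (fun i hi j hj hij p => by
        rw [hζk, hζk]
        have := hsp2 j hj i hi hij.symm p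
        have e : phi h d c - i * ρ - (phi h d c - j * ρ) - p = ((j : ℝ) - i) * ρ - p := by ring
        rw [e]; linarith)
      (by
        have : 2 * τ / τ₀ ≤ 1 / 9 := by
          rw [div_le_iff₀ hτ₀]; linarith
        linarith)
    have h1 : ζ^[k] c < ζ^[k] d := hζkm k P.lt
    have h2 : ζ^[k] d < ζ^[k] w1 := hζkm k hdw
    have h3 : ζ^[k] w1 < ζ^[k] w2 := hζkm k hww
    have e1 := P.goodPoint_estimate hgood hx (by linarith) hlen le_rfl h1.le (by linarith)
    have e2 := P.goodPoint_estimate hgood hx (by linarith) hlen h1.le h2.le h3.le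
    have e3 := P.goodPoint_estimate hgood hx (by linarith) hlen le_rfl
      (show ζ^[k] c ≤ ζ^[k] w2 by linarith) le_rfl
    have hpush := P.push_crossRatio h1 h2 h3 (σ := 2 * τ) (by
        rw [hζk, hζk, hw2, hφc]; linarith) (by linarith) (m := k) (fun i hi p => by
        rw [hζk, hφc, hφρ]
        have := hsp1 (k - i) (by omega) (by omega) (-p)
        rw [Nat.cast_sub hi.le, ← abs_neg] at this
        have e : -(((k : ℝ) - i) * ρ - ((-p : ℤ) : ℝ)) = 0 - k * ρ + i * ρ - p := by
          push_cast; ring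
        rw [e] at this; linarith) (fun i hi j hj hij p => by
        rw [hφρ]
        have := hsp2 i (hi.trans hk) j (hj.trans hk) hij p
        linarith)
    simp only [hFζ] at hpush
    simp only [hζk, hφc, hφd, hw1, hw2] at e1 e2 e3
    generalize ζ^[k] c = A at *
    generalize ζ^[k] d = A1 at *
    generalize ζ^[k] w1 = A2 at *
    generalize ζ^[k] w2 = A3 at *
    have hhx := hgood.1
    have f1 : A1 - A ≤ ε * (A3 - A) := by
      have : h x * (A1 - A) ≤ h x * (ε * (A3 - A)) := by
        have := (abs_le.1 e1).1; linarith
      exact le_of_mul_le_mul_left this hhx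
    have f2 : (A3 - A) / 3 ≤ A2 - A1 := by
      have : h x * ((A3 - A) / 3) ≤ h x * (A2 - A1) := by
        have t1 := (abs_le.1 e2).2
        have t2 := (abs_le.1 e3).1
        have t3 : 0 < h x * (A3 - A) := mul_pos hhx (by linarith)
        have t4 : ε * (h x * (A3 - A)) ≤ 1 / 16 * (h x * (A3 - A)) := by gcongr
        linarith
      exact le_of_mul_le_mul_left this hhx
    have f3 : 1 / (3 * ε) ≤ crossRatio A A1 A2 A3 := by
      rw [crossRatio, div_le_div_iff₀ (by positivity)
        (mul_pos (by linarith) (by linarith)), one_mul]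
      have g1 : (A1 - A) * (A3 - A2) ≤ (ε * (A3 - A)) * (A3 - A) :=
        mul_le_mul f1 (by linarith) (by linarith) (mul_nonneg hε0.le (by linarith))
      have g2 : (A3 - A) * ((A3 - A) / 3) ≤ (A3 - A) * (A2 - A1) :=
        mul_le_mul_of_nonneg_left f2 (by linarith)
      have g3 := mul_le_mul_of_nonneg_left g2 (by positivity : 0 ≤ 3 * ε)
      linarith
    have f4 : crossRatio c d w1 w2 ≤ (w1 - d) / ((d - c) * (w2 - w1)) := by
      have h5 : (w2 - c) * (w1 - d) ≤ 1 * (w1 - d) :=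
        mul_le_mul_of_nonneg_right (by linarith) (by linarith)
      rw [one_mul] at h5
      exact div_le_div_of_nonneg_right h5 (mul_nonneg hcd.le (by linarith))
    have f5 : Real.exp (-K) * (1 / (3 * ε)) ≤ (w1 - d) / ((d - c) * (w2 - w1)) :=
      (mul_le_mul_of_nonneg_left f3 (Real.exp_pos _).le).trans (hpush.trans f4)
    calc (d - c) * Real.exp (-K) / (3 * ε) = (d - c) * (Real.exp (-K) * (1 / (3 * ε))) := by ring
      _ ≤ (d - c) * ((w1 - d) / ((d - c) * (w2 - w1))) := by gcongr
      _ = (w1 - d) / (w2 - w1) := by field_simp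
  -- forward orbit
  have hforw : Real.exp (-K) * (m₀ / M₀ * ((w1 - d) / (w2 - w1))) ≤ 16 := by
    have o1 : F u < F c := by
      have := P.mono_lap (-1) (a := u) ⟨by push_cast; linarith, by push_cast; linarith⟩ (b := c)
        ⟨by push_cast; linarith [P.lt_add_one], by push_cast; linarith⟩ huc
      exact this
    have o2 : F c < F w1 := by
      rw [P.map_eq]
      exact P.mono ⟨le_rfl, by linarith⟩ ⟨hdw.le, by linarith⟩ hdw
    have o3 : F w1 < F w2 := P.mono ⟨hdw.le, by linarith⟩ ⟨by linarith, by linarith⟩ hww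
    have pu : phi h d (F u) = ρ - τ := by
      rw [P.phi_map (n := -1) ⟨by push_cast; linarith, by push_cast; linarith⟩, hu, hφρ]; ring
    have p1 : phi h d (F w1) = ρ + τ := by
      rw [P.phi_map (n := 0) ⟨by push_cast; linarith, by push_cast; linarith⟩, hw1, hφρ]; ring
    have p2 : phi h d (F w2) = ρ + 2 * τ := by
      rw [P.phi_map (n := 0) ⟨by push_cast; linarith, by push_cast; linarith⟩, hw2, hφρ]; ring
    have hN1 : ((N - 1 : ℕ) : ℝ) = N - 1 := by
      rw [Nat.cast_sub (by exact_mod_cast (by linarith : (1 : ℝ) ≤ N))]; simp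
    have hs1 : phi h d (F w2) - phi h d (F u) = 3 * τ := by rw [pu, p2]; ring
    have hp : ∀ i < N - 1, ∀ p : ℤ, 3 * τ < |phi h d (F u) + i * phi h d (F c) - p| := by
      intro i hi p
      rw [pu, hφρ]
      have := hsp1 (i + 1) (by omega) (by omega) p
      push_cast at this
      have e : ρ - τ + i * ρ - p = ((i : ℝ) + 1) * ρ - p - τ := by ring
      rw [e]
      have := abs_sub_abs_le_abs_sub (((i : ℝ) + 1) * ρ - p) τ
      rw [abs_of_pos hτ] at this
      linarith
    have hpush := fun i (hi : i < N - 1) => P.push (by linarith : F u ≤ F w2) hs1.le (m := i)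
      fun k hk => hp k (hk.trans hi)
    have mu : F u ∈ Icc (F u) (F w2) := ⟨le_rfl, by linarith⟩
    have mc : F c ∈ Icc (F u) (F w2) := ⟨by linarith, by linarith⟩
    have m1 : F w1 ∈ Icc (F u) (F w2) := ⟨by linarith, by linarith⟩
    have m2 : F w2 ∈ Icc (F u) (F w2) := ⟨by linarith, by linarith⟩
    obtain ⟨i, hi, hlen, x, hx, hgood⟩ := P.exists_good_index hτ₀ hG (n := N - 1)
      (a := fun i => F^[i] (F u)) (g := fun i => F^[i] (F w2)) (σ := 3 * τ) (by positivity)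
      (by linarith) (fun i hi => (hpush i hi).1.monotoneOn mu m2 mu.2)
      (fun i hi => by rw [(hpush i hi).2.1 _ mu, (hpush i hi).2.1 _ m2]; linarith)
      (fun i hi j hj hij p => by
        rw [(hpush i hi).2.1 _ mu, (hpush j hj).2.1 _ mu, hφρ]
        have := hsp2 i (by omega) j (by omega) hij p
        have e : phi h d (F u) + i * ρ - (phi h d (F u) + j * ρ) - p = ((i : ℝ) - j) * ρ - p := by
          ring
        rw [e]; linarith)
      (by
        have : 3 * τ / τ₀ ≤ 1 / 6 := by
          rw [div_le_iff₀ hτ₀]; linarith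
        rw [hN1]
        linarith)
    have hcr := P.push_crossRatio o1 o2 o3 hs1.le (by linarith) (m := i)
      (fun k hk => hp k (hk.trans hi)) (fun k hk j hj hij p => by
        rw [hφρ]
        have := hsp2 k (by omega) j (by omega) hij p
        linarith)
    obtain ⟨q1, q2, -⟩ := hpush i hi
    have h1 := q1 mu mc o1
    have h2 := q1 mc m1 o2
    have h3 := q1 m1 m2 o3
    have e1 := P.goodPoint_estimate hgood hx (by linarith) hlen le_rfl h1.le (by linarith)
    have e2 := P.goodPoint_estimate hgood hx (by linarith) hlen (by linarith) h3.le le_rfl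
    have e3 := P.goodPoint_estimate hgood hx (by linarith) hlen le_rfl
      (show F^[i] (F u) ≤ F^[i] (F w2) by linarith) le_rfl
    simp only [q2 _ mu, q2 _ mc, q2 _ m1, q2 _ m2, hφρ, pu, p1, p2] at e1 e2 e3
    have g0 : m₀ / M₀ * ((w1 - d) / (w2 - w1)) ≤ crossRatio (F u) (F c) (F w1) (F w2) := by
      have a1 := hm w1 ⟨hdw.le, by linarith⟩
      have a2 := hM w1 w2 hww.le
      rw [← P.map_eq] at a1
      have d1 : 0 < w2 - w1 := by linarith
      have d2 : 0 < F c - F u := by linarith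
      have d3 : 0 < F w2 - F w1 := by linarith
      have d4 : 0 < w1 - d := by linarith
      calc m₀ / M₀ * ((w1 - d) / (w2 - w1)) = (m₀ * (w1 - d)) / (M₀ * (w2 - w1)) := by
            rw [div_mul_div_comm]
        _ ≤ (F w1 - F c) / (F w2 - F w1) := by gcongr
        _ = ((F c - F u) * (F w1 - F c)) / ((F c - F u) * (F w2 - F w1)) := by
            rw [mul_div_mul_left _ _ d2.ne']
        _ ≤ _ := by
            rw [crossRatio]
            gcongr
            linarith
    refine (mul_le_mul_of_nonneg_left g0 (Real.exp_pos _).le).trans (hcr.trans ?_)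
    generalize F^[i] (F u) = A at *
    generalize F^[i] (F c) = A1 at *
    generalize F^[i] (F w1) = A2 at *
    generalize F^[i] (F w2) = A3 at *
    have hhx := hgood.1
    have t3 : 0 < h x * (A3 - A) := mul_pos hhx (by linarith)
    have t4 : ε * (h x * (A3 - A)) ≤ 1 / 16 * (h x * (A3 - A)) := by gcongr
    have t2 := (abs_le.1 e3).1
    have f1 : (A3 - A) / 4 ≤ A1 - A := by
      have : h x * ((A3 - A) / 4) ≤ h x * (A1 - A) := by
        have t1 := (abs_le.1 e1).2
        linarith
      exact le_of_mul_le_mul_left this hhx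
    have f2 : (A3 - A) / 4 ≤ A3 - A2 := by
      have : h x * ((A3 - A) / 4) ≤ h x * (A3 - A2) := by
        have t1 := (abs_le.1 e2).2
        linarith
      exact le_of_mul_le_mul_left this hhx
    rw [crossRatio, div_le_iff₀ (mul_pos (by linarith) (by linarith))]
    have s1 : (A3 - A) * (A2 - A1) ≤ (A3 - A) * (A3 - A) :=
      mul_le_mul_of_nonneg_left (by linarith) (by linarith)
    have s2 : ((A3 - A) / 4) * ((A3 - A) / 4) ≤ (A1 - A) * (A3 - A2) :=
      mul_le_mul f1 f2 (by linarith) (by linarith)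
    linarith
  have h1 : Real.exp (-K) * (m₀ / M₀ * ((d - c) * Real.exp (-K) / (3 * ε))) ≤ 16 :=
    le_trans (by gcongr) hforw
  have h2 : Real.exp (-K) * Real.exp (-K) * (m₀ / M₀) * (d - c) ≤ 48 * ε := by
    have e : Real.exp (-K) * (m₀ / M₀ * ((d - c) * Real.exp (-K) / (3 * ε))) =
        (Real.exp (-K) * Real.exp (-K) * (m₀ / M₀) * (d - c)) / (3 * ε) := by
      field_simp
    rw [e, div_le_iff₀ (by positivity)] at h1
    linarith
  linarith

end PlateauSystem

/-- The real density of the lift of an absolutely continuous measure on the circle. -/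
def density (ν : Measure UnitAddCircle) (x : ℝ) : ℝ := (liftDensity ν x).toReal

theorem measurable_density (ν : Measure UnitAddCircle) : Measurable (density ν) :=
  (measurable_liftDensity ν).ennreal_toReal

theorem density_nonneg (ν : Measure UnitAddCircle) (x : ℝ) : 0 ≤ density ν x :=
  ENNReal.toReal_nonneg

theorem density_add_int (ν : Measure UnitAddCircle) (x : ℝ) (n : ℤ) :
    density ν (x + n) = density ν x := by
  rw [density, liftDensity_add_int, density]

section

variable {ν : Measure UnitAddCircle} [IsFiniteMeasure ν]

theorem ae_liftDensity_lt_top : ∀ᵐ x : ℝ, liftDensity ν x < ⊤ :=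
  isCircleLift_volume.ae_coe (Measure.rnDeriv_lt_top ν volume)

theorem liftMeasure_eq_withDensity_ofReal :
    liftMeasure ν = volume.withDensity fun x => ENNReal.ofReal (density ν x) := by
  refine withDensity_congr_ae ?_
  filter_upwards [ae_liftDensity_lt_top (ν := ν)] with x hx
  rw [density, ENNReal.ofReal_toReal hx.ne]

theorem liftMeasure_Ioc_lt_top (hν : ν ≪ volume) (a b : ℝ) : liftMeasure ν (Ioc a b) < ⊤ := by
  have key : ∀ k : ℕ, liftMeasure ν (Ioc a (a + k)) < ⊤ := by
    intro k
    induction k with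
    | zero => simp
    | succ k ih =>
      have hsub : Ioc a (a + (k + 1 : ℕ)) ⊆ Ioc a (a + k) ∪ Ioc (a + k) (a + k + 1) := by
        intro x hx
        push_cast at hx
        rcases le_or_gt x (a + k) with h | h
        · exact Or.inl ⟨hx.1, h⟩
        · exact Or.inr ⟨h, by linarith [hx.2]⟩
      refine (measure_mono hsub).trans_lt ((measure_union_le _ _).trans_lt ?_)
      rw [(isCircleLift_liftMeasure hν).measure_Ioc]
      exact ENNReal.add_lt_top.2 ⟨ih, measure_lt_top _ _⟩
  obtain ⟨k, hk⟩ := exists_nat_ge (b - a)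
  exact (measure_mono (Ioc_subset_Ioc_right (by linarith))).trans_lt (key k)

theorem intervalIntegrable_density (hν : ν ≪ volume) (a b : ℝ) :
    IntervalIntegrable (density ν) volume a b := by
  have key : ∀ a b, IntegrableOn (density ν) (Ioc a b) volume := by
    intro a b
    refine integrable_toReal_of_lintegral_ne_top (measurable_liftDensity ν).aemeasurable ?_
    have := liftMeasure_Ioc_lt_top hν a b
    rw [liftMeasure, withDensity_apply _ measurableSet_Ioc] at this
    exact this.ne
  exact ⟨key a b, key b a⟩

theorem locallyIntegrable_density (hν : ν ≪ volume) : LocallyIntegrable (density ν) volume := by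
  intro x
  refine ⟨Ioc (x - 1) (x + 1), Ioc_mem_nhds (by linarith) (by linarith),
    (intervalIntegrable_density hν (x - 1) (x + 1)).1⟩

theorem liftMeasure_apply (hν : ν ≪ volume) {S : Set ℝ} (hS : MeasurableSet S) {a b : ℝ}
    (hSab : S ⊆ Ioc a b) : liftMeasure ν S = ENNReal.ofReal (∫ x in S, density ν x) := by
  rw [liftMeasure_eq_withDensity_ofReal, withDensity_apply _ hS,
    ofReal_integral_eq_lintegral_ofReal ((intervalIntegrable_density hν a b).1.mono_set hSab)
      (ae_of_all _ (density_nonneg ν))]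

theorem liftMeasure_Ioc (hν : ν ≪ volume) {a b : ℝ} (hab : a ≤ b) :
    liftMeasure ν (Ioc a b) = ENNReal.ofReal (∫ x in a..b, density ν x) := by
  rw [liftMeasure_apply hν measurableSet_Ioc Subset.rfl, intervalIntegral.integral_of_le hab]

theorem integral_density_one [IsProbabilityMeasure ν] (hν : ν ≪ volume) :
    ∫ t in (0 : ℝ)..1, density ν t = 1 := by
  have h1 := (isCircleLift_liftMeasure hν).measure_Ioc 0
  rw [zero_add, liftMeasure_Ioc hν zero_le_one, measure_univ] at h1
  simpa using h1

end

theorem isProbabilityMeasure_cond {ν : Measure UnitAddCircle} [IsFiniteMeasure ν]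
    {E : Set UnitAddCircle} (hE : ν E ≠ 0) :
    IsProbabilityMeasure (ProbabilityTheory.cond ν E) :=
  ProbabilityTheory.cond_isProbabilityMeasure hE

theorem cond_ac {ν : Measure UnitAddCircle} (E : Set UnitAddCircle) :
    ProbabilityTheory.cond ν E ≪ ν := ProbabilityTheory.cond_absolutelyContinuous

/-- Conditioning an invariant measure on a forward invariant set. -/
theorem map_cond_eq {X : Type*} [MeasurableSpace X] {f : X → X} {ν : Measure X} [IsFiniteMeasure ν]
    (hf : MeasurePreserving f ν ν) {E : Set X} (hE : MeasurableSet E) (hEf : E ⊆ f ⁻¹' E) :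
    Measure.map f (ProbabilityTheory.cond ν E) = ProbabilityTheory.cond ν E := by
  have hae : (f ⁻¹' E : Set X) =ᵐ[ν] E :=
    (ae_eq_of_subset_of_measure_ge hEf (hf.measure_preimage hE.nullMeasurableSet).le
      hE.nullMeasurableSet (measure_ne_top _ _)).symm
  ext S hS
  rw [Measure.map_apply hf.measurable hS, ProbabilityTheory.cond_apply hE,
    ProbabilityTheory.cond_apply hE]
  congr 1
  rw [← hf.measure_preimage (hE.inter hS).nullMeasurableSet, preimage_inter]
  exact measure_congr (hae.symm.inter (ae_eq_refl _))

namespace PlateauSystem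

theorem reflect {F h : ℝ → ℝ} {c d K : ℝ} (P : PlateauSystem F h c d K) :
    PlateauSystem (fun x => -F (-x)) (fun x => h (-x)) (-d) (-c) K where
  F_add_int x n := by
    have := P.F_add_int (-x) (-n)
    push_cast at this
    rw [neg_add, this]; ring
  cont := (P.cont.comp continuous_neg).neg
  lt := by linarith [P.lt]
  lt_add_one := by linarith [P.lt_add_one]
  map_eq := by simp [P.map_eq]
  mono := by
    intro x hx y hy hxy
    have := P.mono_lap (-1) (a := -y) ⟨by push_cast; linarith [hy.2], by push_cast; linarith [hy.1]⟩
      (b := -x) ⟨by push_cast; linarith [hx.2], by push_cast; linarith [hx.1]⟩ (by linarith)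
    simpa using this
  K_nonneg := P.K_nonneg
  cr a b e g h1 h2 h3 h4 h5 := by
    have := P.cr_lap (-1) (a := -g) (b := -e) (e := -b) (g := -a) (by push_cast; linarith)
      (by linarith) (by linarith) (by linarith) (by push_cast; linarith)
    rw [crossRatio_neg, crossRatio_reverse, neg_sub_neg] at this
    rw [crossRatio_neg, ← crossRatio_reverse (F (-a))]
    exact this
  h_meas := P.h_meas.comp measurable_neg
  h_nonneg x := P.h_nonneg _
  h_add_int x n := by
    have := P.h_add_int (-x) (-n)
    push_cast at this
    rw [neg_add, this]
  h_int := by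
    intro x
    refine ⟨Ioc (x - 1) (x + 1), Ioc_mem_nhds (by linarith) (by linarith), ?_⟩
    have := ((IntervalIntegrable.iff_comp_neg enorm_ne_top).1 (P.ii (-(x - 1)) (-(x + 1)))).1
    simpa only [neg_neg] using this
  h_one := by
    rw [intervalIntegral.integral_comp_neg (fun x => h x)]
    have := P.phi_add_int (-1) 1
    have h2 := P.phi_sub (-1) (-0)
    rw [← h2]
    push_cast at this
    norm_num at this ⊢
    linarith
  h_zero := by
    rw [intervalIntegral.integral_comp_neg (fun x => h x)]
    simpa using P.h_zero
  inv a b h1 h2 h3 := by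
    rw [intervalIntegral.integral_comp_neg (fun x => h x),
      intervalIntegral.integral_comp_neg (fun x => h x), ← P.phi_sub, ← P.phi_sub]
    simp only [neg_neg]
    rw [P.phi_map (x := -a) (n := -1) ⟨by push_cast; linarith, by push_cast; linarith⟩,
      P.phi_map (x := -b) (n := -1) ⟨by push_cast; linarith, by push_cast; linarith⟩]
    ring

end PlateauSystem

namespace BimodData

variable (B : BimodData) {ν : Measure UnitAddCircle}

theorem plateauSystem [IsProbabilityMeasure ν] (hν : ν ≪ volume) (hinv : Measure.map B.f ν = ν)
    {c d K : ℝ} (hK : 0 ≤ K) (hcr : ∀ a b e d, a < b → b < e → e < d →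
      (∀ x ∈ Ioo a d, deriv B.F x ≠ 0) → Real.exp (-(K * (d - a))) * crossRatio a b e d ≤
        crossRatio (B.F a) (B.F b) (B.F e) (B.F d))
    (hcd : c < d) (hdc : d < c + 1) (hF : B.F c = B.F d) (hmono : StrictMonoOn B.F (Icc d (c + 1)))
    (hderiv : ∀ x ∈ Ioo d (c + 1), deriv B.F x ≠ 0)
    (hnull : ν ((fun x : ℝ => (x : UnitAddCircle)) '' Ioo c d) = 0) :
    PlateauSystem B.F (density ν) c d K := by
  have hl := isCircleLift_liftMeasure hν
  have hnull' : liftMeasure ν (Ioo c d) = 0 := by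
    rw [← hl.measure_image (t := c) measurableSet_Ioo
      (fun x hx => ⟨hx.1, by linarith [hx.2]⟩), hnull]
  have hnull2 : liftMeasure ν (Ioc c d) = 0 := by
    rw [← Ioo_union_right hcd]
    exact measure_union_null hnull' (measure_singleton d)
  have hF1 : B.F (c + 1) = B.F d + 1 := by rw [B.hlift, hF]
  have hnn : ∀ a b, a ≤ b → 0 ≤ ∫ t in a..b, density ν t := fun a b hab =>
    intervalIntegral.integral_nonneg hab fun t _ => density_nonneg ν t
  refine ⟨B.F_add_int, B.continuous_F, hcd, hdc, hF, hmono, hK, ?_, measurable_density ν,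
    density_nonneg ν, density_add_int ν, locallyIntegrable_density hν, integral_density_one hν,
    ?_, ?_⟩
  · intro a b e g h1 h2 h3 h4 h5
    exact hcr a b e g h2 h3 h4 fun x hx => hderiv x ⟨by linarith [hx.1], by linarith [hx.2]⟩
  · rw [liftMeasure_Ioc hν hcd.le, ENNReal.ofReal_eq_zero] at hnull2
    exact le_antisymm hnull2 (hnn _ _ hcd.le)
  · intro a b ha hab hb
    have md : d ∈ Icc d (c + 1) := ⟨le_rfl, hdc.le⟩
    have mc : c + 1 ∈ Icc d (c + 1) := ⟨hdc.le, le_rfl⟩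
    have ma : a ∈ Icc d (c + 1) := ⟨ha, by linarith⟩
    have mb : b ∈ Icc d (c + 1) := ⟨by linarith, hb⟩
    have hFab := hmono.monotoneOn ma mb hab
    have hFa := hmono.monotoneOn md ma ha
    have hFb := hmono.monotoneOn mb mc hb
    have hsub : Ioc (B.F a) (B.F b) ⊆ Ioc (B.F d) (B.F d + 1) := fun x hx =>
      ⟨by linarith [hx.1], by linarith [hx.2]⟩
    have e1 := hl.measure_image measurableSet_Ioc hsub
    have hmeas := measurableSet_coe_image (t := B.F d) (measurableSet_Ioc (a := B.F a) (b := B.F b))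
      hsub
    rw [← (B.measurePreserving_f hinv).measure_preimage hmeas.nullMeasurableSet,
      hl d _ (B.measurable_f hmeas)] at e1
    have e2 : liftMeasure ν (Ioc (B.F a) (B.F b)) = liftMeasure ν (Ioc a b) := by
      rw [← e1]
      refine measure_congr ?_
      have hz : liftMeasure ν ((fun x => x + ((-1 : ℤ) : ℝ)) ⁻¹' Ioc c d) = 0 := by
        rw [liftMeasure_preimage_add_int _ _ _ measurableSet_Ioc, hnull2]
      have hz' := measure_eq_zero_iff_ae_notMem.1 hz
      filter_upwards [hz'] with x hx
      refine propext ⟨?_, ?_⟩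
      · rintro ⟨⟨y, hy, hyx⟩, hxd⟩
        have hx1 : x ≤ c + 1 := by
          by_contra! hlt
          exact hx ⟨by push_cast; linarith, by push_cast; linarith [hxd.2]⟩
        have mx : x ∈ Icc d (c + 1) := ⟨hxd.1.le, hx1⟩
        have hxF : B.F x ∈ Ioc (B.F d) (B.F d + 1) :=
          ⟨hmono md mx hxd.1, by rw [← hF1]; exact hmono.monotoneOn mx mc hx1⟩
        have hyx' : ((y : ℝ) : UnitAddCircle) = ((B.F x : ℝ) : UnitAddCircle) := by
          rw [← B.hf]; exact hyx
        have := injOn_coe_Ioc (B.F d) (hsub hy) hxF hyx'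
        subst this
        exact ⟨(hmono.lt_iff_lt ma mx).1 hy.1, (hmono.le_iff_le mx mb).1 hy.2⟩
      · intro hxab
        have mx : x ∈ Icc d (c + 1) := ⟨by linarith [hxab.1], by linarith [hxab.2]⟩
        refine ⟨⟨B.F x, ⟨hmono ma mx hxab.1, hmono.monotoneOn mx mb hxab.2⟩, ?_⟩,
          by linarith [hxab.1], by linarith [hxab.2]⟩
        exact (B.hf x).symm
    rw [liftMeasure_Ioc hν hFab, liftMeasure_Ioc hν hab] at e2
    exact (ENNReal.ofReal_eq_ofReal_iff (hnn _ _ hFab) (hnn _ _ hab)).1 e2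

theorem exists_slope_bound {G : ℝ → ℝ} {d e : ℝ} (hG : ContDiff ℝ 1 G) (hde : d < e)
    (hmono : StrictMonoOn G (Icc d e)) (hd : 0 < deriv G d) :
    ∃ m₀ > 0, ∀ x ∈ Icc d e, m₀ * (x - d) ≤ G x - G d := by
  have hc : Continuous (deriv G) := hG.continuous_deriv le_rfl
  have hdiff : Differentiable ℝ G := hG.differentiable one_ne_zero
  obtain ⟨r, hr, hball⟩ := Metric.continuousAt_iff.1 (hc.continuousAt (x := d)) (deriv G d / 2) (half_pos hd)
  set s := min (r / 2) (e - d) with hs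
  have hs0 : 0 < s := lt_min (half_pos hr) (by linarith)
  have hsr : s ≤ r / 2 := min_le_left _ _
  have hse : s ≤ e - d := min_le_right _ _
  have md : d ∈ Icc d e := ⟨le_rfl, hde.le⟩
  have hloc : ∀ x ∈ Icc d (d + s), deriv G d / 2 * (x - d) ≤ G x - G d := by
    intro x hx
    refine (convex_Icc d (d + s)).mul_sub_le_image_sub_of_le_deriv hdiff.continuous.continuousOn
      hdiff.differentiableOn (fun y hy => ?_) d ⟨le_rfl, by linarith⟩ x hx hx.1
    rw [interior_Icc] at hy
    have := hball (x := y) (by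
      rw [Real.dist_eq, abs_lt]; constructor <;> linarith [hy.1, hy.2])
    rw [Real.dist_eq, abs_lt] at this
    linarith
  have hGs : 0 < G (d + s) - G d := by
    have := hmono md (b := d + s) ⟨by linarith, by linarith⟩ (by linarith)
    linarith
  refine ⟨min (deriv G d / 2) ((G (d + s) - G d) / (e - d)), lt_min (by linarith)
    (div_pos hGs (by linarith)), fun x hx => ?_⟩
  rcases le_or_gt x (d + s) with h | h
  · refine le_trans ?_ (hloc x ⟨hx.1, h⟩)
    exact mul_le_mul_of_nonneg_right (min_le_left _ _) (by linarith [hx.1])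
  · have h1 := hmono.monotoneOn (a := d + s) ⟨by linarith, by linarith⟩ hx h.le
    have h2 : min (deriv G d / 2) ((G (d + s) - G d) / (e - d)) * (x - d) ≤
        (G (d + s) - G d) / (e - d) * (e - d) :=
      mul_le_mul (min_le_right _ _) (by linarith [hx.2]) (by linarith [hx.1])
        (div_nonneg hGs.le (by linarith))
    rw [div_mul_cancel₀ _ (by linarith)] at h2
    linarith

theorem sub_le_of_deriv_bound {M : ℝ} (hM : ∀ x, |deriv B.F x| ≤ M) (x y : ℝ) (hxy : x ≤ y) :
    B.F y - B.F x ≤ M * (y - x) := by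
  exact Convex.image_sub_le_mul_sub_of_deriv_le convex_univ B.continuous_F.continuousOn
    B.differentiable_F.differentiableOn (fun z _ => (le_abs_self _).trans (hM z)) x (mem_univ _) y
    (mem_univ _) hxy

theorem strictMonoOn_lap : StrictMonoOn B.F (Icc B.ctm (B.ctp + 1)) :=
  strictMonoOn_of_deriv_pos (convex_Icc _ _) B.continuous_F.continuousOn fun x hx => by
    rw [interior_Icc] at hx; exact B.hincr x hx

/-- No absolutely continuous invariant probability avoids the plateau of the upper map. -/
theorem plateau_upper_pos [IsProbabilityMeasure ν] (hν : ν ≪ volume)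
    (hinv : Measure.map B.f ν = ν) :
    ν ((fun x : ℝ => (x : UnitAddCircle)) '' Ioo B.ctp B.dtp) ≠ 0 := by
  intro h0
  obtain ⟨K, hK, hcr⟩ := B.exists_crossRatio_bound
  obtain ⟨M, hM0, hM⟩ := B.exists_deriv_bound
  have hd := B.hdtp
  have hc := B.h1
  have hmono : StrictMonoOn B.F (Icc B.dtp (B.ctp + 1)) :=
    B.strictMonoOn_lap.mono (Icc_subset_Icc_left hd.1.le)
  have P := B.plateauSystem hν hinv hK hcr (c := B.ctp) (d := B.dtp) (by linarith [hd.1]) hd.2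
    B.hdtpF.symm hmono (fun x hx => (B.hincr x ⟨by linarith [hx.1, hd.1], hx.2⟩).ne') h0
  obtain ⟨m₀, hm₀, hm⟩ := exists_slope_bound (B.hC2.of_le (by norm_num)) hd.2 hmono
    (B.hincr _ hd)
  obtain ⟨ρ, hρ, hlim⟩ := B.exists_irrational_tendsto B.deriv_ctp
  exact P.contradiction hm₀ hm hM0 (B.sub_le_of_deriv_bound hM) (fun k => (B.orbit_ctp k).2) hρ hlim

/-- No absolutely continuous invariant probability avoids the plateau of the lower map. -/
theorem plateau_lower_pos [IsProbabilityMeasure ν] (hν : ν ≪ volume)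
    (hinv : Measure.map B.f ν = ν) :
    ν ((fun x : ℝ => (x : UnitAddCircle)) '' Ioo B.dtm B.ctm) ≠ 0 := by
  intro h0
  obtain ⟨K, hK, hcr⟩ := B.exists_crossRatio_bound
  obtain ⟨M, hM0, hM⟩ := B.exists_deriv_bound
  have hd := B.hdtm
  have hc := B.h1
  have hmono : StrictMonoOn B.F (Icc B.ctm (B.dtm + 1)) :=
    B.strictMonoOn_lap.mono (Icc_subset_Icc_right (by linarith [hd.2]))
  have P := (B.plateauSystem hν hinv hK hcr (c := B.dtm) (d := B.ctm) (by linarith [hd.2])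
    (by linarith [hd.1]) B.hdtmF hmono
    (fun x hx => (B.hincr x ⟨hx.1, by linarith [hx.2, hd.2]⟩).ne') h0).reflect
  have hit : ∀ (k : ℕ) (x : ℝ), (fun x => -B.F (-x))^[k] x = -(B.F^[k] (-x)) := by
    intro k
    induction k with
    | zero => simp
    | succ k ih => intro x; rw [Function.iterate_succ_apply', ih, Function.iterate_succ_apply',
        neg_neg]
  have hC : ContDiff ℝ 1 (fun x => -B.F (-x)) := ((B.hC2.of_le (by norm_num)).comp contDiff_neg).neg
  have hder : deriv (fun x => -B.F (-x)) (-B.dtm) = deriv B.F (B.dtm + (1 : ℤ)) := by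
    rw [B.deriv_add_int, deriv.fun_neg, deriv_comp_neg, neg_neg, neg_neg]
  obtain ⟨m₀, hm₀, hm⟩ := exists_slope_bound hC P.lt_add_one P.mono (by
    rw [hder]; push_cast; exact B.hincr _ ⟨by linarith [hd.1], by linarith [hd.2]⟩)
  obtain ⟨ρ, hρ, hlim⟩ := B.exists_irrational_tendsto B.deriv_ctm
  refine P.contradiction hm₀ hm hM0 (fun x y hxy => ?_) (fun k j => ?_) hρ.neg ?_
  · have := B.sub_le_of_deriv_bound hM (-y) (-x) (by linarith)
    linarith
  · rw [hit]
    intro h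
    refine (B.orbit_ctm k).2 (-j) ?_
    simp only [neg_neg] at h
    push_cast
    exact ⟨by linarith [h.2], by linarith [h.1]⟩
  · simp only [hit, neg_neg, neg_div]
    exact hlim.neg

/-- Forward orbit closures of the critical values carry no absolutely continuous invariant mass. -/
def postcritical : Set UnitAddCircle :=
  closure (range fun k : ℕ => ((B.F^[k] (B.F B.ctp) : ℝ) : UnitAddCircle)) ∪
    closure (range fun k : ℕ => ((B.F^[k] (B.F B.ctm) : ℝ) : UnitAddCircle))

theorem measure_orbit_closure_eq_zero [IsFiniteMeasure ν] (hν : ν ≪ volume)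
    (hinv : Measure.map B.f ν = ν) {c u v : ℝ} (havoid : ∀ (k : ℕ) (j : ℤ), B.F^[k] c + j ∉ Icc u v)
    (hpos : ∀ ν' : Measure UnitAddCircle, IsProbabilityMeasure ν' → ν' ≪ volume →
      Measure.map B.f ν' = ν' → ν' ((fun x : ℝ => (x : UnitAddCircle)) '' Ioo u v) ≠ 0) :
    ν (closure (range fun k : ℕ => ((B.F^[k] c : ℝ) : UnitAddCircle))) = 0 := by
  set O : Set UnitAddCircle := range fun k : ℕ => ((B.F^[k] c : ℝ) : UnitAddCircle) with hO
  by_contra h0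
  have hE : MeasurableSet (closure O) := isClosed_closure.measurableSet
  have hfor : closure O ⊆ B.f ⁻¹' closure O := by
    refine closure_minimal ?_ (isClosed_closure.preimage B.continuous_f)
    rintro _ ⟨k, rfl⟩
    refine subset_closure ⟨k + 1, ?_⟩
    simp only [Function.iterate_succ_apply', B.hf]
  have hprob := isProbabilityMeasure_cond h0
  refine hpos _ hprob ((cond_ac _).trans hν)
    (map_cond_eq (B.measurePreserving_f hinv) hE hfor) ?_
  rw [ProbabilityTheory.cond_apply hE]
  have hopen : IsOpen ((fun x : ℝ => (x : UnitAddCircle)) '' Ioo u v) :=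
    QuotientAddGroup.isOpenMap_coe _ isOpen_Ioo
  have hdisj : Disjoint ((fun x : ℝ => (x : UnitAddCircle)) '' Ioo u v) O := by
    rw [disjoint_left]
    rintro _ ⟨x, hx, rfl⟩ ⟨k, hk⟩
    obtain ⟨n, hn⟩ := coe_eq_coe_iff.1 hk
    exact havoid k n (hn ▸ Ioo_subset_Icc_self hx)
  rw [(hdisj.closure_right hopen).symm.inter_eq]
  simp

theorem measure_postcritical [IsFiniteMeasure ν] (hν : ν ≪ volume)
    (hinv : Measure.map B.f ν = ν) : ν B.postcritical = 0 :=
  measure_union_null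
    (B.measure_orbit_closure_eq_zero hν hinv (fun k => (B.orbit_ctp k).2)
      fun _ _ h1 h2 => B.plateau_upper_pos h1 h2)
    (B.measure_orbit_closure_eq_zero hν hinv (fun k => (B.orbit_ctm k).2)
      fun _ _ h1 h2 => B.plateau_lower_pos h1 h2)

theorem isClosed_postcritical : IsClosed B.postcritical := isClosed_closure.union isClosed_closure

theorem iterate_critical_mem {c : ℝ} (hc : deriv B.F c = 0) {n : ℕ} (hn : 1 ≤ n) :
    ((B.F^[n] c : ℝ) : UnitAddCircle) ∈ B.postcritical := by
  obtain ⟨k, rfl⟩ : ∃ k, n = k + 1 := ⟨n - 1, by omega⟩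
  obtain ⟨m, h | h⟩ := (B.deriv_eq_zero_iff c).1 hc
  · rw [h, B.iterate_add_int, coe_add_int]
    exact Or.inl (subset_closure ⟨k, rfl⟩)
  · rw [h, B.iterate_add_int, coe_add_int]
    exact Or.inr (subset_closure ⟨k, rfl⟩)

end BimodData

namespace BimodData

variable (B : BimodData)

/-- Points whose first `m + 1` iterates contain a critical point. -/
def critPre (m : ℕ) : Set ℝ := {t | ∃ i ≤ m, deriv B.F (B.F^[i] t) = 0}

theorem critPre_mono {m k : ℕ} (h : m ≤ k) : B.critPre m ⊆ B.critPre k :=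
  fun _ ⟨i, hi, hx⟩ => ⟨i, hi.trans h, hx⟩

theorem isClosed_critPre (m : ℕ) : IsClosed (B.critPre m) := by
  have : B.critPre m = ⋃ i ∈ Finset.range (m + 1), {t | deriv B.F (B.F^[i] t) = 0} := by
    ext t
    simp only [critPre, mem_ofPred_eq, mem_iUnion, Finset.mem_range, exists_prop,
      Nat.lt_succ_iff]
  rw [this]
  refine isClosed_biUnion_finset fun i _ => ?_
  exact isClosed_singleton.preimage (B.continuous_deriv_F.comp (B.continuous_iterate i))

theorem add_int_mem_critPre (m : ℕ) (t : ℝ) (j : ℤ) : t + j ∈ B.critPre m ↔ t ∈ B.critPre m := by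
  simp only [critPre, mem_ofPred_eq, B.iterate_add_int, B.deriv_add_int]

theorem ctp_add_mem_critPre (m : ℕ) (j : ℤ) : B.ctp + j ∈ B.critPre m :=
  (B.add_int_mem_critPre m _ j).2 ⟨0, Nat.zero_le _, B.deriv_ctp⟩

/-- Endpoints of the component containing `x` of the complement of `critPre m`. -/
def cutL (m : ℕ) (x : ℝ) : ℝ := sSup (B.critPre m ∩ Iic x)

/-- Endpoints of the component containing `x` of the complement of `critPre m`. -/
def cutR (m : ℕ) (x : ℝ) : ℝ := sInf (B.critPre m ∩ Ici x)

theorem cutL_mem (m : ℕ) (x : ℝ) : B.cutL m x ∈ B.critPre m ∩ Iic x := by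
  refine ((B.isClosed_critPre m).inter isClosed_Iic).csSup_mem ?_ ⟨x, fun t ht => ht.2⟩
  refine ⟨B.ctp + (⌊x - B.ctp⌋ : ℤ), B.ctp_add_mem_critPre m _, ?_⟩
  have := Int.floor_le (x - B.ctp)
  simp only [mem_Iic]; linarith

theorem cutR_mem (m : ℕ) (x : ℝ) : B.cutR m x ∈ B.critPre m ∩ Ici x := by
  refine ((B.isClosed_critPre m).inter isClosed_Ici).csInf_mem ?_ ⟨x, fun t ht => ht.2⟩
  refine ⟨B.ctp + (⌈x - B.ctp⌉ : ℤ), B.ctp_add_mem_critPre m _, ?_⟩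
  have := Int.le_ceil (x - B.ctp)
  simp only [mem_Ici]; linarith

theorem le_cutL {m : ℕ} {x t : ℝ} (ht : t ∈ B.critPre m) (htx : t ≤ x) : t ≤ B.cutL m x :=
  le_csSup ⟨x, fun _ ht => ht.2⟩ ⟨ht, htx⟩

theorem cutR_le {m : ℕ} {x t : ℝ} (ht : t ∈ B.critPre m) (htx : x ≤ t) : B.cutR m x ≤ t :=
  csInf_le ⟨x, fun _ ht => ht.2⟩ ⟨ht, htx⟩

theorem notMem_critPre {m : ℕ} {x t : ℝ} (ht : t ∈ Ioo (B.cutL m x) (B.cutR m x)) :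
    t ∉ B.critPre m := fun h => by
  rcases le_total t x with h1 | h1
  · exact (B.le_cutL h h1).not_gt ht.1
  · exact (B.cutR_le h h1).not_gt ht.2

theorem mem_cut {m : ℕ} {x : ℝ} (hx : x ∉ B.critPre m) :
    x ∈ Ioo (B.cutL m x) (B.cutR m x) := by
  refine ⟨lt_of_le_of_ne (B.cutL_mem m x).2 fun h => hx ?_,
    lt_of_le_of_ne (B.cutR_mem m x).2 fun h => hx ?_⟩
  · have := (B.cutL_mem m x).1; rwa [h] at this
  · have := (B.cutR_mem m x).1; rwa [← h] at this

theorem cut_eq {m : ℕ} {x r : ℝ} (hr : r ∈ Ioo (B.cutL m x) (B.cutR m x)) :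
    B.cutL m r = B.cutL m x ∧ B.cutR m r = B.cutR m x := by
  constructor
  · refine le_antisymm ?_ (B.le_cutL (B.cutL_mem m x).1 hr.1.le)
    by_contra! h
    exact B.notMem_critPre ⟨h, (B.cutL_mem m r).2.trans_lt hr.2⟩ (B.cutL_mem m r).1
  · refine le_antisymm (B.cutR_le (B.cutR_mem m x).1 hr.2.le) ?_
    by_contra! h
    exact B.notMem_critPre ⟨hr.1.trans_le (B.cutR_mem m r).2, h⟩ (B.cutR_mem m r).1

theorem cut_eq_of_mem {m : ℕ} {x x' r : ℝ} (hr : r ∈ Ioo (B.cutL m x) (B.cutR m x))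
    (hr' : r ∈ Ioo (B.cutL m x') (B.cutR m x')) :
    B.cutL m x = B.cutL m x' ∧ B.cutR m x = B.cutR m x' := by
  have h1 := B.cut_eq hr
  have h2 := B.cut_eq hr'
  exact ⟨h1.1.symm.trans h2.1, h1.2.symm.trans h2.2⟩

theorem cutL_mono {m k : ℕ} (h : m ≤ k) (x : ℝ) : B.cutL m x ≤ B.cutL k x :=
  B.le_cutL (B.critPre_mono h (B.cutL_mem m x).1) (B.cutL_mem m x).2

theorem cutR_anti {m k : ℕ} (h : m ≤ k) (x : ℝ) : B.cutR k x ≤ B.cutR m x :=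
  B.cutR_le (B.critPre_mono h (B.cutR_mem m x).1) (B.cutR_mem m x).2

/-- Points whose components shrink to a point, the middle being always kept from rank `m` on. -/
def midSet (m : ℕ) (r : ℝ) : Set ℝ :=
  {x | r ∈ Ioo (B.cutL m x) (B.cutR m x) ∧
    (∀ k ≥ m, (B.cutL k x + B.cutR k x) / 2 ∈ Ioo (B.cutL (k + 1) x) (B.cutR (k + 1) x)) ∧
    ∀ δ > 0, ∃ k, B.cutR k x - B.cutL k x < δ}

theorem subsingleton_midSet (m : ℕ) (r : ℝ) : (B.midSet m r).Subsingleton := by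
  rintro x ⟨h1, h2, h3⟩ x' ⟨h1', h2', -⟩
  have key : ∀ k ≥ m, B.cutL k x = B.cutL k x' ∧ B.cutR k x = B.cutR k x' := by
    intro k hk
    induction k, hk using Nat.le_induction with
    | base => exact B.cut_eq_of_mem h1 h1'
    | succ k hk ih =>
      have := h2 k hk
      have h4 := h2' k hk
      rw [← ih.1, ← ih.2] at h4
      exact B.cut_eq_of_mem this h4
  by_contra hne
  obtain ⟨k, hk⟩ := h3 |x - x'| (abs_pos.2 (sub_ne_zero.2 hne))
  have hkm := le_max_left k m
  obtain ⟨e1, e2⟩ := key (max k m) (le_max_right _ _)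
  have a1 := B.cutL_mono hkm x
  have a2 := B.cutR_anti hkm x
  have a3 := (B.cutL_mem (max k m) x).2
  have a4 := (B.cutR_mem (max k m) x).2
  have a5 := (B.cutL_mem (max k m) x').2
  have a6 := (B.cutR_mem (max k m) x').2
  rw [← e1] at a5
  rw [← e2] at a6
  simp only [mem_Iic, mem_Ici] at a3 a4 a5 a6
  have : |x - x'| ≤ B.cutR k x - B.cutL k x := abs_le.2 ⟨by linarith, by linarith⟩
  linarith

/-- Forward images of precritical points are precritical of lower rank, or postcritical. -/
theorem iterate_critPre {m n : ℕ} {e : ℝ} (he : e ∈ B.critPre (m + 1)) (hn : 1 ≤ n) (j : ℤ) :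
    B.F^[n] e + j ∈ B.critPre m ∨ ((B.F^[n] e : ℝ) : UnitAddCircle) ∈ B.postcritical := by
  obtain ⟨i, hi, hd⟩ := he
  rcases le_or_gt n i with h | h
  · refine Or.inl ((B.add_int_mem_critPre m _ j).2 ⟨i - n, by omega, ?_⟩)
    rw [← Function.iterate_add_apply, Nat.sub_add_cancel h]
    exact hd
  · right
    have := B.iterate_critical_mem hd (n := n - i) (by omega)
    rwa [← Function.iterate_add_apply, Nat.sub_add_cancel h.le] at this

/-- Preimages of countable sets are countable. -/
theorem countable_preimage {S : Set ℝ} (hS : S.Countable) : (B.F ⁻¹' S).Countable := by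
  have hsub : B.F ⁻¹' S ⊆ {x | deriv B.F x = 0} ∪
      ⋃ r : ℚ × ℚ, ⋃ _ : ∀ x ∈ Ioo (r.1 : ℝ) r.2, deriv B.F x ≠ 0,
        (B.F ⁻¹' S ∩ Ioo (r.1 : ℝ) r.2) := by
    intro x hx
    by_cases h0 : deriv B.F x = 0
    · exact Or.inl h0
    right
    have hopen : IsOpen {t | deriv B.F t ≠ 0} := isOpen_ne.preimage B.continuous_deriv_F
    obtain ⟨ε, hε, hball⟩ := Metric.isOpen_iff.1 hopen x h0
    obtain ⟨p, hp1, hp2⟩ := exists_rat_btwn (sub_lt_self x hε)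
    obtain ⟨q, hq1, hq2⟩ := exists_rat_btwn (lt_add_of_pos_right x hε)
    refine mem_iUnion.2 ⟨(p, q), mem_iUnion.2 ⟨fun t ht => hball ?_, hx, hp2, hq1⟩⟩
    rw [Real.ball_eq_Ioo]
    exact ⟨hp1.trans ht.1, ht.2.trans hq2⟩
  refine (B.countable_crit.union (countable_iUnion fun r => countable_iUnion fun hr => ?_)).mono
    hsub
  exact MapsTo.countable_of_injOn (f := B.F) (t := S) (fun x hx => hx.1)
    ((B.injOn_of_deriv_ne_zero hr).mono (inter_subset_right.trans Ioo_subset_Icc_self)) hS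

theorem countable_critPre (m : ℕ) : (B.critPre m).Countable := by
  have h : ∀ i : ℕ, {t | deriv B.F (B.F^[i] t) = 0}.Countable := by
    intro i
    induction i with
    | zero => exact B.countable_crit
    | succ i ih => exact B.countable_preimage ih
  refine (countable_iUnion h).mono ?_
  rintro t ⟨i, -, hi⟩
  exact mem_iUnion.2 ⟨i, hi⟩

/-- Off a countable set, points accumulated on both sides by precritical points lie in arbitrarily
small intervals whose endpoints do not return to a definite neighbourhood on one side. -/
theorem exists_countable_cut : ∃ S : Set ℝ, S.Countable ∧ ∀ x ∉ S,
    (∀ δ > 0, (∃ m, ∃ u ∈ Ioo (x - δ) x, u ∈ B.critPre m) ∧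
      ∃ m, ∃ u ∈ Ioo x (x + δ), u ∈ B.critPre m) →
    ∀ δ > 0, ∃ α β, x ∈ Ioo α β ∧ β - α < δ ∧
      ((∀ e ∈ ({α, β} : Set ℝ), ∀ n ≥ 1, ∀ j : ℤ, B.F^[n] e + j ∈ Ioo α (β + (β - α)) →
          ((B.F^[n] e : ℝ) : UnitAddCircle) ∈ B.postcritical) ∨
        (∀ e ∈ ({α, β} : Set ℝ), ∀ n ≥ 1, ∀ j : ℤ, B.F^[n] e + j ∈ Ioo (α - (β - α)) β →
          ((B.F^[n] e : ℝ) : UnitAddCircle) ∈ B.postcritical)) := by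
  refine ⟨(⋃ m : ℕ, B.critPre m) ∪ ⋃ m : ℕ, ⋃ r : ℚ, B.midSet m r,
    (countable_iUnion fun m => ?_).union
    (countable_iUnion fun m => countable_iUnion fun r => (B.subsingleton_midSet m r).countable),
    fun x hxS hacc δ hδ => ?_⟩
  · exact B.countable_critPre m
  simp only [mem_union, mem_iUnion, not_or, not_exists] at hxS
  obtain ⟨hxc, hxm⟩ := hxS
  have hshrink : ∀ δ > 0, ∃ k, B.cutR k x - B.cutL k x < δ := by
    intro δ hδ
    obtain ⟨⟨m, u, hu, hum⟩, m', u', hu', hum'⟩ := hacc (δ / 2) (half_pos hδ)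
    refine ⟨max m m', ?_⟩
    have h1 := B.le_cutL (B.critPre_mono (le_max_left m m') hum) hu.2.le
    have h2 := B.cutR_le (B.critPre_mono (le_max_right m m') hum') hu'.1.le
    linarith [hu.1, hu'.2]
  obtain ⟨m, hm⟩ := hshrink δ hδ
  obtain ⟨r, hr1, hr2⟩ := exists_rat_btwn ((B.mem_cut (hxc m)).1.trans (B.mem_cut (hxc m)).2)
  have hnot := hxm m r
  have : ∃ k ≥ m, (B.cutL k x + B.cutR k x) / 2 ∉
      Ioo (B.cutL (k + 1) x) (B.cutR (k + 1) x) := by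
    by_contra! hcon
    exact hnot ⟨⟨hr1, hr2⟩, hcon, hshrink⟩
  obtain ⟨k, hk, hmid⟩ := this
  have hx := B.mem_cut (hxc (k + 1))
  have a1 := B.cutL_mono (Nat.le_succ k) x
  have a2 := B.cutR_anti (Nat.le_succ k) x
  have a3 := B.cutL_mono hk x
  have a4 := B.cutR_anti hk x
  have hend : ∀ e ∈ ({B.cutL (k + 1) x, B.cutR (k + 1) x} : Set ℝ), ∀ n ≥ 1, ∀ j : ℤ,
      B.F^[n] e + j ∈ Ioo (B.cutL k x) (B.cutR k x) →
      ((B.F^[n] e : ℝ) : UnitAddCircle) ∈ B.postcritical := by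
    intro e he n hn j hj
    have hem : e ∈ B.critPre (k + 1) := by
      rcases he with rfl | rfl
      · exact (B.cutL_mem (k + 1) x).1
      · exact (B.cutR_mem (k + 1) x).1
    exact (B.iterate_critPre hem hn j).resolve_left (B.notMem_critPre hj)
  refine ⟨B.cutL (k + 1) x, B.cutR (k + 1) x, hx, by linarith, ?_⟩
  by_cases hc : B.cutR (k + 1) x + (B.cutR (k + 1) x - B.cutL (k + 1) x) ≤ B.cutR k x
  · exact Or.inl fun e he n hn j hj => hend e he n hn j ⟨by linarith [hj.1], by linarith [hj.2]⟩
  · by_cases hc' : B.cutL k x ≤ B.cutL (k + 1) x - (B.cutR (k + 1) x - B.cutL (k + 1) x)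
    · exact Or.inr fun e he n hn j hj => hend e he n hn j ⟨by linarith [hj.1], by linarith [hj.2]⟩
    · push Not at hc hc'
      exact absurd ⟨by linarith [hx.1, hx.2], by linarith [hx.1, hx.2]⟩ hmid

end BimodData

namespace BimodData

variable (B : BimodData)

/-- Monotone pullback of an interval free of critical values of `F^[n]`. -/
theorem exists_pullback {n : ℕ} (hn : 1 ≤ n) {a b z : ℝ} (hz : B.F^[n] z ∈ Ioo a b)
    (hc : ∀ c, deriv B.F c = 0 → ∀ i, 1 ≤ i → i ≤ n → B.F^[i] c ∉ Ioo a b) :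
    ∃ a' b', z ∈ Ioo a' b' ∧ (∀ i < n, ∀ t ∈ Ioo a' b', deriv B.F (B.F^[i] t) ≠ 0) ∧
      ((B.F^[n] a' = a ∧ B.F^[n] b' = b) ∨ (B.F^[n] a' = b ∧ B.F^[n] b' = a)) := by
  obtain ⟨m, rfl⟩ : ∃ m, n = m + 1 := ⟨n - 1, by omega⟩
  have hout : ∀ t ∈ B.critPre m, B.F^[m + 1] t ∉ Ioo a b := by
    rintro t ⟨i, hi, ht⟩
    have := hc _ ht (m + 1 - i) (by omega) (by omega)
    rwa [← Function.iterate_add_apply, Nat.sub_add_cancel (by omega)] at this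
  have hzc : z ∉ B.critPre m := fun h => hout z h hz
  have hzI := B.mem_cut hzc
  have h1 := hout _ (B.cutL_mem m z).1
  have h2 := hout _ (B.cutR_mem m z).1
  have hno : ∀ i < m + 1, ∀ t ∈ Ioo (B.cutL m z) (B.cutR m z), deriv B.F (B.F^[i] t) ≠ 0 :=
    fun i hi t ht h0 => B.notMem_critPre ht ⟨i, by omega, h0⟩
  have hL : B.cutL m z ∈ Icc (B.cutL m z) (B.cutR m z) := left_mem_Icc.2 (hzI.1.trans hzI.2).le
  have hR : B.cutR m z ∈ Icc (B.cutL m z) (B.cutR m z) := right_mem_Icc.2 (hzI.1.trans hzI.2).le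
  have hcont := B.continuous_iterate (m + 1)
  rcases B.strictMonoOn_or_strictAntiOn_iterate hno with hm | hm
  · have l1 := hm hL (Ioo_subset_Icc_self hzI) hzI.1
    have l2 := hm (Ioo_subset_Icc_self hzI) hR hzI.2
    have g1 : B.F^[m + 1] (B.cutL m z) ≤ a := by
      by_contra! h; exact h1 ⟨h, l1.trans hz.2⟩
    have g2 : b ≤ B.F^[m + 1] (B.cutR m z) := by
      by_contra! h; exact h2 ⟨hz.1.trans l2, h⟩
    obtain ⟨a', ha', hFa⟩ := intermediate_value_Icc hzI.1.le hcont.continuousOn ⟨g1, hz.1.le⟩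
    obtain ⟨b', hb', hFb⟩ := intermediate_value_Icc hzI.2.le hcont.continuousOn ⟨hz.2.le, g2⟩
    refine ⟨a', b', ⟨lt_of_le_of_ne ha'.2 ?_, lt_of_le_of_ne hb'.1 ?_⟩, fun i hi t ht =>
      hno i hi t ⟨ha'.1.trans_lt ht.1, ht.2.trans_le hb'.2⟩, Or.inl ⟨hFa, hFb⟩⟩
    · rintro rfl; exact hz.1.ne' hFa
    · rintro rfl; exact hz.2.ne hFb
  · have l1 := hm hL (Ioo_subset_Icc_self hzI) hzI.1
    have l2 := hm (Ioo_subset_Icc_self hzI) hR hzI.2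
    have g1 : b ≤ B.F^[m + 1] (B.cutL m z) := by
      by_contra! h; exact h1 ⟨hz.1.trans l1, h⟩
    have g2 : B.F^[m + 1] (B.cutR m z) ≤ a := by
      by_contra! h; exact h2 ⟨h, l2.trans hz.2⟩
    obtain ⟨a', ha', hFa⟩ := intermediate_value_Icc' hzI.1.le hcont.continuousOn ⟨hz.2.le, g1⟩
    obtain ⟨b', hb', hFb⟩ := intermediate_value_Icc' hzI.2.le hcont.continuousOn ⟨g2, hz.1.le⟩
    refine ⟨a', b', ⟨lt_of_le_of_ne ha'.2 ?_, lt_of_le_of_ne hb'.1 ?_⟩, fun i hi t ht =>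
      hno i hi t ⟨ha'.1.trans_lt ht.1, ht.2.trans_le hb'.2⟩, Or.inr ⟨hFa, hFb⟩⟩
    · rintro rfl; exact hz.2.ne hFa
    · rintro rfl; exact hz.1.ne' hFb

end BimodData

/-- Points of `D` whose iterate of order `i` lies in `E`, before or at which there is no return
to `D`. -/
def visitSet {α : Type*} (f : α → α) (D E : Set α) (i : ℕ) : Set α :=
  {y | y ∈ D ∧ (∀ l, 1 ≤ l → l ≤ i → f^[l] y ∉ D) ∧ f^[i] y ∈ E}

theorem measurableSet_visitSet {α : Type*} [MeasurableSpace α] {f : α → α} (hf : Measurable f)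
    {D E : Set α} (hD : MeasurableSet D) (hE : MeasurableSet E) (i : ℕ) :
    MeasurableSet (visitSet f D E i) := by
  have : visitSet f D E i =
      D ∩ ((⋂ l, ⋂ _ : 1 ≤ l, ⋂ _ : l ≤ i, (f^[l] ⁻¹' D)ᶜ) ∩ f^[i] ⁻¹' E) := by
    ext y; simp [visitSet]; tauto
  rw [this]
  exact hD.inter ((MeasurableSet.iInter fun l => MeasurableSet.iInter fun _ =>
    MeasurableSet.iInter fun _ => ((hf.iterate l) hD).compl).inter ((hf.iterate i) hE))

/-- Kac-type estimate: the total measure of the excursion visits to `E` is at most `ν E`. -/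
theorem sum_measure_visitSet_le {α : Type*} [MeasurableSpace α] {ν : Measure α} {f : α → α}
    (hf : MeasurePreserving f ν ν) {D E : Set α} (hD : MeasurableSet D) (hE : MeasurableSet E)
    (N : ℕ) : ∑ i ∈ Finset.range N, ν (visitSet f D E i) ≤ ν E := by
  have hm := fun i => measurableSet_visitSet hf.measurable hD hE i
  have h1 : ∀ i, ν (visitSet f D E i) = ν (f^[N - i] ⁻¹' visitSet f D E i) := fun i =>
    ((hf.iterate (N - i)).measure_preimage (hm i).nullMeasurableSet).symm
  simp only [h1]
  rw [← measure_biUnion_finset]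
  · rw [← (hf.iterate N).measure_preimage hE.nullMeasurableSet]
    refine measure_mono (iUnion₂_subset fun i hi y hy => ?_)
    have hi := Finset.mem_range.1 hi
    have := hy.2.2
    rw [← Function.iterate_add_apply] at this
    rwa [mem_preimage, show N = i + (N - i) by omega]
  · have key : ∀ i j, i < j → j < N →
        Disjoint (f^[N - i] ⁻¹' visitSet f D E i) (f^[N - j] ⁻¹' visitSet f D E j) := by
      intro i j hij hj
      rw [Set.disjoint_left]
      intro y hy hy'
      refine hy'.2.1 (j - i) (by omega) (by omega) ?_
      rw [← Function.iterate_add_apply, show j - i + (N - j) = N - i by omega]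
      exact hy.1
    intro i hi j hj hij
    have hi := Finset.mem_range.1 hi
    have hj := Finset.mem_range.1 hj
    rcases lt_or_gt_of_ne hij with h | h
    · exact key i j h hj
    · exact (key j i h hi).symm
  · exact fun i _ => (hf.iterate (N - i)).measurable (hm i)

/-- Off a set of measure at most `ν E / M`, excursions from `D` visit `E` less than `M` times. -/
theorem exists_few_visits {α : Type*} [MeasurableSpace α] {ν : Measure α} {f : α → α}
    (hf : MeasurePreserving f ν ν) {D E : Set α} (hD : MeasurableSet D) (hE : MeasurableSet E)
    (M : ℕ) : ∃ S : Set α, MeasurableSet S ∧ M * ν S ≤ ν E ∧ ∀ y ∉ S, ∀ u : Finset ℕ,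
      (∀ i ∈ u, y ∈ visitSet f D E i) → u.card < M := by
  have hm := fun i => measurableSet_visitSet hf.measurable hD hE i
  set V : α → ENNReal := fun y => ∑' i, (visitSet f D E i).indicator 1 y with hV
  have hVm : Measurable V := Measurable.tsum fun i => measurable_one.indicator (hm i)
  have hintg : ∫⁻ y, V y ∂ν ≤ ν E := by
    rw [hV, lintegral_tsum fun i => (measurable_one.indicator (hm i)).aemeasurable]
    simp only [lintegral_indicator_one (hm _)]
    exact ENNReal.tsum_le_of_sum_range_le fun N => sum_measure_visitSet_le hf hD hE N
  refine ⟨{y | (M : ENNReal) ≤ V y}, measurableSet_le measurable_const hVm,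
    (mul_meas_ge_le_lintegral hVm _).trans hintg, fun y hy u hu => ?_⟩
  by_contra! hcon
  refine hy ?_
  have : ∑ i ∈ u, (visitSet f D E i).indicator (1 : α → ENNReal) y = u.card := by
    rw [Finset.sum_congr rfl fun i hi => indicator_of_mem (hu i hi) _]
    simp
  change (M : ENNReal) ≤ V y
  calc (M : ENNReal) ≤ u.card := by exact_mod_cast hcon
    _ = _ := this.symm
    _ ≤ V y := ENNReal.sum_le_tsum _

theorem image_Ioo_of_strictMonoOn_or_strictAntiOn {g : ℝ → ℝ} (hg : Continuous g) {a b : ℝ}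
    (hab : a < b) (hm : StrictMonoOn g (Icc a b) ∨ StrictAntiOn g (Icc a b)) :
    g '' Ioo a b = Ioo (min (g a) (g b)) (max (g a) (g b)) := by
  have ha : a ∈ Icc a b := left_mem_Icc.2 hab.le
  have hb : b ∈ Icc a b := right_mem_Icc.2 hab.le
  rcases hm with hm | hm
  · rw [min_eq_left (hm ha hb hab).le, max_eq_right (hm ha hb hab).le]
    refine Subset.antisymm ?_ (intermediate_value_Ioo hab.le hg.continuousOn)
    rintro _ ⟨t, ht, rfl⟩
    exact ⟨hm ha (Ioo_subset_Icc_self ht) ht.1, hm (Ioo_subset_Icc_self ht) hb ht.2⟩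
  · rw [min_eq_right (hm ha hb hab).le, max_eq_left (hm ha hb hab).le]
    refine Subset.antisymm ?_ (intermediate_value_Ioo' hab.le hg.continuousOn)
    rintro _ ⟨t, ht, rfl⟩
    exact ⟨hm (Ioo_subset_Icc_self ht) hb ht.2, hm ha (Ioo_subset_Icc_self ht) ht.1⟩

namespace BimodData

variable (B : BimodData)

theorem length_lt_one {n : ℕ} {a b : ℝ} (hab : a < b)
    (hno : ∀ i < n, ∀ t ∈ Ioo a b, deriv B.F (B.F^[i] t) ≠ 0)
    (hlen : |B.F^[n] b - B.F^[n] a| < 1) : b - a < 1 := by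
  by_contra! hcon
  have ha : a ∈ Icc a b := left_mem_Icc.2 hab.le
  have hb : b ∈ Icc a b := right_mem_Icc.2 hab.le
  have ha1 : a + 1 ∈ Icc a b := ⟨by linarith, by linarith⟩
  have h1 : B.F^[n] (a + 1) = B.F^[n] a + 1 := by simpa using B.iterate_add_int n a 1
  rw [abs_lt] at hlen
  rcases B.strictMonoOn_or_strictAntiOn_iterate hno with hm | hm
  · have := hm.monotoneOn ha1 hb ha1.2
    linarith
  · have := hm ha ha1 (by linarith)
    linarith

theorem exists_image_interval {n : ℕ} {a b : ℝ} (hab : a < b)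
    (hno : ∀ i < n, ∀ t ∈ Ioo a b, deriv B.F (B.F^[i] t) ≠ 0)
    (hlen : |B.F^[n] b - B.F^[n] a| < 1) {i : ℕ} (hi : i ≤ n) :
    ∃ p q, p < q ∧ B.F^[i] '' Ioo a b = Ioo p q ∧ q - p = |B.F^[i] b - B.F^[i] a| ∧ q - p < 1 ∧
      ∀ l < n - i, ∀ t ∈ Ioo p q, deriv B.F (B.F^[l] t) ≠ 0 := by
  have hm := B.strictMonoOn_or_strictAntiOn_iterate (n := i) (a := a) (d := b)
    fun l hl => hno l (by omega)
  have himg := image_Ioo_of_strictMonoOn_or_strictAntiOn (B.continuous_iterate i) hab hm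
  have hne : B.F^[i] a ≠ B.F^[i] b := by
    rcases hm with hm | hm
    · exact (hm (left_mem_Icc.2 hab.le) (right_mem_Icc.2 hab.le) hab).ne
    · exact (hm (left_mem_Icc.2 hab.le) (right_mem_Icc.2 hab.le) hab).ne'
  have hno' : ∀ l < n - i, ∀ t ∈ Ioo (min (B.F^[i] a) (B.F^[i] b)) (max (B.F^[i] a) (B.F^[i] b)),
      deriv B.F (B.F^[l] t) ≠ 0 := by
    intro l hl t ht
    rw [← himg] at ht
    obtain ⟨t', ht', rfl⟩ := ht
    rw [← Function.iterate_add_apply]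
    exact hno _ (by omega) t' ht'
  refine ⟨_, _, min_lt_max.2 hne, himg, max_sub_min_eq_abs _ _, ?_, hno'⟩
  refine B.length_lt_one (min_lt_max.2 hne) hno' ?_
  have hcomp : ∀ t, B.F^[n - i] (B.F^[i] t) = B.F^[n] t := fun t => by
    rw [← Function.iterate_add_apply, Nat.sub_add_cancel hi]
  rcases le_total (B.F^[i] a) (B.F^[i] b) with h | h
  · rw [min_eq_left h, max_eq_right h, hcomp, hcomp]; exact hlen
  · rw [min_eq_right h, max_eq_left h, hcomp, hcomp, abs_sub_comm]; exact hlen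

theorem liftMeasure_image_le {ν : Measure UnitAddCircle} [IsFiniteMeasure ν] (hν : ν ≪ volume)
    (hinv : Measure.map B.f ν = ν) {n : ℕ} {a b : ℝ} (hab : a < b)
    (hno : ∀ i < n, ∀ t ∈ Ioo a b, deriv B.F (B.F^[i] t) ≠ 0)
    (hlen : |B.F^[n] b - B.F^[n] a| < 1) {i : ℕ} (hi : i ≤ n) :
    liftMeasure ν (B.F^[i] '' Ioo a b) ≤ liftMeasure ν (B.F^[n] '' Ioo a b) := by
  obtain ⟨p, q, hpq, himg, -, hl, hno'⟩ := B.exists_image_interval hab hno hlen hi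
  obtain ⟨p', q', -, himg', -, hl', -⟩ := B.exists_image_interval hab hno hlen le_rfl
  have hcomp : B.F^[n] '' Ioo a b = B.F^[n - i] '' (B.F^[i] '' Ioo a b) := by
    rw [image_image]
    refine image_congr fun t _ => ?_
    rw [← Function.iterate_add_apply, Nat.sub_add_cancel hi]
  have hinj : InjOn (B.F^[n - i]) (Ioo p q) := by
    rcases B.strictMonoOn_or_strictAntiOn_iterate hno' with h | h
    · exact h.injOn.mono Ioo_subset_Icc_self
    · exact h.injOn.mono Ioo_subset_Icc_self
  rw [hcomp, himg]
  refine B.liftMeasure_le_image_iterate hν hinv (s := p) (t := p') measurableSet_Ioo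
    (fun t ht => ⟨ht.1, by linarith [ht.2]⟩) hinj ?_
  rw [← himg, ← hcomp, himg']
  exact fun t ht => ⟨ht.1, by linarith [ht.2]⟩

theorem sum_length_le {n : ℕ} {a b : ℝ} (hab : a < b)
    (hno : ∀ i < n, ∀ t ∈ Ioo a b, deriv B.F (B.F^[i] t) ≠ 0)
    (hlen : |B.F^[n] b - B.F^[n] a| < 1) (M : ℕ)
    (hM : ∀ y : UnitAddCircle, ∀ u ⊆ Finset.range n,
      (∀ i ∈ u, ∃ x ∈ B.F^[i] '' Ioo a b, (x : UnitAddCircle) = y) → u.card ≤ M) :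
    ∑ i ∈ Finset.range n, |B.F^[i] b - B.F^[i] a| ≤ M := by
  have hex : ∀ i : ℕ, ∃ p q, i < n → p < q ∧ B.F^[i] '' Ioo a b = Ioo p q ∧
      q - p = |B.F^[i] b - B.F^[i] a| ∧ q - p < 1 := by
    intro i
    by_cases hi : i < n
    · obtain ⟨p, q, h1, h2, h3, h4, -⟩ := B.exists_image_interval hab hno hlen hi.le
      exact ⟨p, q, fun _ => ⟨h1, h2, h3, h4⟩⟩
    · exact ⟨0, 0, fun h => absurd h hi⟩
  choose p q hpq using hex
  have hle := isCircleLift_volume.sum_le (Finset.range n) (fun i => B.F^[i] '' Ioo a b) p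
    (fun i hi => by
      rw [(hpq i (Finset.mem_range.1 hi)).2.1]; exact measurableSet_Ioo)
    (fun i hi => by
      obtain ⟨h1, h2, h3, h4⟩ := hpq i (Finset.mem_range.1 hi)
      simp only [h2]
      exact fun t ht => ⟨ht.1, by linarith [ht.2]⟩) M univ MeasurableSet.univ
    (fun _ _ _ _ => mem_univ _) hM
  have hsum : ∑ i ∈ Finset.range n, volume (B.F^[i] '' Ioo a b) =
      ENNReal.ofReal (∑ i ∈ Finset.range n, |B.F^[i] b - B.F^[i] a|) := by
    rw [ENNReal.ofReal_sum_of_nonneg fun _ _ => abs_nonneg _]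
    refine Finset.sum_congr rfl fun i hi => ?_
    obtain ⟨h1, h2, h3, h4⟩ := hpq i (Finset.mem_range.1 hi)
    rw [h2, Real.volume_Ioo, h3]
  rw [hsum, show (volume : Measure UnitAddCircle) univ = 1 from UnitAddCircle.measure_univ, mul_one,
    ← ENNReal.ofReal_natCast] at hle
  exact (ENNReal.ofReal_le_ofReal_iff (Nat.cast_nonneg M)).1 hle

end BimodData

section window

variable {ν : Measure UnitAddCircle} [IsFiniteMeasure ν]

theorem abs_integral_density_sub_le (hν : ν ≪ volume) {L R a δ u v : ℝ}
    (hδ : ∫ t in L..R, |density ν t - a| ≤ δ) (hLu : L ≤ u) (huv : u ≤ v) (hvR : v ≤ R) :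
    |(∫ t in u..v, density ν t) - a * (v - u)| ≤ δ := by
  have hi := fun x y => intervalIntegrable_density hν x y
  have hi2 : ∀ x y, IntervalIntegrable (fun t => |density ν t - a|) volume x y := fun x y =>
    ((hi x y).sub intervalIntegrable_const).abs
  have h1 : (∫ t in u..v, density ν t) - a * (v - u) = ∫ t in u..v, (density ν t - a) := by
    rw [intervalIntegral.integral_sub (hi u v) intervalIntegrable_const]
    simp [mul_comm]
  rw [h1]
  refine (intervalIntegral.abs_integral_le_integral_abs huv).trans (le_trans ?_ hδ)
  exact intervalIntegral.integral_mono_interval hLu huv hvR (ae_of_all _ fun t => abs_nonneg _)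
    (hi2 L R)

theorem liftMeasure_le_of_subset (hν : ν ≪ volume) {L R a δ e : ℝ} (hLR : L ≤ R) (ha : 0 ≤ a)
    (he : 0 ≤ e) (hδ : ∫ t in L..R, |density ν t - a| ≤ δ) {G : Set ℝ} (hG : MeasurableSet G)
    (hGs : G ⊆ Ioc L R) (hvol : volume G ≤ ENNReal.ofReal e) :
    liftMeasure ν G ≤ ENNReal.ofReal (a * e + δ) := by
  rw [liftMeasure_apply hν hG hGs]
  refine ENNReal.ofReal_le_ofReal ?_
  have hi : IntegrableOn (density ν) (Ioc L R) := (intervalIntegrable_density hν L R).1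
  have hi2 : IntegrableOn (fun t => |density ν t - a|) (Ioc L R) :=
    (hi.sub (integrableOn_const (by simp))).abs
  have hfin : volume G ≠ ⊤ := (hvol.trans_lt ENNReal.ofReal_lt_top).ne
  calc ∫ x in G, density ν x ≤ ∫ x in G, (a + |density ν x - a|) := by
        refine setIntegral_mono (hi.mono_set hGs) ((integrableOn_const hfin).add
          (hi2.mono_set hGs)) fun x => ?_
        simp only; linarith [le_abs_self (density ν x - a)]
    _ = a * volume.real G + ∫ x in G, |density ν x - a| := by
        rw [integral_add (show Integrable (fun _ => a) _ from integrableOn_const hfin)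
          (hi2.mono_set hGs)]
        simp [mul_comm]
    _ ≤ a * e + δ := by
        refine add_le_add (mul_le_mul_of_nonneg_left ?_ ha) ?_
        · exact ENNReal.toReal_le_of_le_ofReal he hvol
        · rw [intervalIntegral.integral_of_le hLR] at hδ
          exact (setIntegral_mono_set hi2 (ae_of_all _ fun t => abs_nonneg _)
            hGs.eventuallyLE).trans hδ

theorem liftMeasure_Ioo (hν : ν ≪ volume) {a b : ℝ} (hab : a ≤ b) :
    liftMeasure ν (Ioo a b) = ENNReal.ofReal (∫ x in a..b, density ν x) := by
  rw [measure_congr Ioo_ae_eq_Ioc, liftMeasure_Ioc hν hab]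

end window

theorem volume_image_le_of_lipschitz {g : ℝ → ℝ} {S : Set ℝ} {Λ e : ℝ} (hΛ : 0 ≤ Λ)
    (hg : ∀ x ∈ S, ∀ y ∈ S, x < y → |g y - g x| ≤ Λ * (y - x))
    (hS : volume S ≤ ENNReal.ofReal e) : volume (g '' S) ≤ ENNReal.ofReal (Λ * e) := by
  have hl : LipschitzOnWith (Real.toNNReal Λ) g S := by
    refine LipschitzOnWith.of_dist_le_mul fun x hx y hy => ?_
    rw [Real.coe_toNNReal _ hΛ, Real.dist_eq, Real.dist_eq]
    rcases lt_trichotomy x y with h | h | h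
    · rw [abs_sub_comm, abs_sub_comm x, abs_of_pos (sub_pos.2 h)]; exact hg x hx y hy h
    · simp [h]
    · rw [abs_of_pos (sub_pos.2 h)]; exact hg y hy x hx h
  have := hl.hausdorffMeasure_image_le (d := 1) zero_le_one
  rw [hausdorffMeasure_real, ENNReal.rpow_one] at this
  rw [ENNReal.ofReal_mul hΛ]
  exact this.trans (mul_le_mul_right hS _)

namespace BimodData

variable (B : BimodData)

theorem liftMeasure_image_add_int (ν : Measure UnitAddCircle) {T : Set ℝ} (hT : MeasurableSet T)
    (j : ℤ) : liftMeasure ν ((fun t => t + (j : ℝ)) '' T) = liftMeasure ν T := by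
  rw [← liftMeasure_preimage_add_int ν (-j) T hT]
  congr 1
  ext t
  simp only [mem_image, mem_preimage, Int.cast_neg]
  constructor
  · rintro ⟨s, hs, rfl⟩; simpa using hs
  · intro ht; exact ⟨_, ht, by ring⟩

/-- If the Jacobian of the invariant measure is trivial then branches of iterates between regions
of nearly constant density nearly preserve lengths. -/
theorem abs_length_sub_le {ν : Measure UnitAddCircle} [IsProbabilityMeasure ν] (hν : ν ≪ volume)
    (hinv : Measure.map B.f ν = ν)
    (hJ : ∀ᵐ y ∂ν, ν.rnDeriv volume y = ENNReal.ofReal |B.Df y| * ν.rnDeriv volume (B.f y))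
    {n : ℕ} {j : ℤ} {g : ℝ → ℝ} (hgdef : g = fun t => B.F^[n] t + j) {p q L R a δ Λ e : ℝ}
    (hm : StrictMonoOn g (Icc p q) ∨ StrictAntiOn g (Icc p q)) (hLp : L ≤ p) (hqR : q ≤ R)
    (hgLR : ∀ t ∈ Icc p q, g t ∈ Icc L R) (ha : 0 ≤ a) (he : 0 ≤ e)
    (hδ : ∫ t in L..R, |density ν t - a| ≤ δ) (hΛ : 0 ≤ Λ)
    (hLip : ∀ x y, p ≤ x → x < y → y ≤ q → |g y - g x| ≤ Λ * (y - x))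
    (hN : volume (Icc p q \ {t | 0 < density ν t}) ≤ ENNReal.ofReal e) {u v : ℝ} (hpu : p ≤ u)
    (huv : u < v) (hvq : v ≤ q) :
    |a * |g v - g u| - a * (v - u)| ≤ 3 * δ + a * (Λ * e) := by
  have hgc : Continuous g := by rw [hgdef]; exact (B.continuous_iterate n).add continuous_const
  have hinj : InjOn g (Icc p q) := hm.elim (fun h => h.injOn) fun h => h.injOn
  have hsub : Icc u v ⊆ Icc p q := Icc_subset_Icc hpu hvq
  have hinj' : InjOn (B.F^[n]) (Ioo u v) := fun x hx y hy hxy =>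
    hinj (hsub (Ioo_subset_Icc_self hx)) (hsub (Ioo_subset_Icc_self hy)) (by
      rw [hgdef]; simp only; rw [hxy])
  have himg : ∀ S, g '' S = (fun t => t + (j : ℝ)) '' (B.F^[n] '' S) := fun S => by
    rw [hgdef, image_image]
  set A : Set ℝ := {t | 0 < density ν t} with hA
  have hAm : MeasurableSet A := measurableSet_lt measurable_const (measurable_density ν)
  have hmeas : ∀ S ⊆ Ioo u v, MeasurableSet S → MeasurableSet (B.F^[n] '' S) := fun S hS hSm =>
    hSm.image_of_measurable_injOn (B.continuous_iterate n).measurable (hinj'.mono hS)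
  have hmeas' : ∀ S ⊆ Ioo u v, MeasurableSet S → MeasurableSet (g '' S) := fun S hS hSm =>
    hSm.image_of_measurable_injOn hgc.measurable
      (hinj.mono (hS.trans (Ioo_subset_Icc_self.trans hsub)))
  have hA0 : liftMeasure ν Aᶜ = 0 := by
    rw [liftMeasure_eq_withDensity_ofReal, withDensity_apply _ hAm.compl]
    refine setLIntegral_eq_zero hAm.compl fun t ht => ?_
    simp only [hA, mem_compl_iff, mem_ofPred_eq, not_lt] at ht
    simp [ht]
  have e1 : liftMeasure ν (g '' (Ioo u v ∩ A)) = liftMeasure ν (Ioo u v) := by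
    rw [himg, liftMeasure_image_add_int ν (hmeas _ inter_subset_left (measurableSet_Ioo.inter hAm)),
      B.liftMeasure_image_iterate hν hinv hJ (measurableSet_Ioo.inter hAm)
      (hinj'.mono inter_subset_left) fun t ht h0 => by
        have := ht.2; simp [hA, density, h0] at this]
    have := measure_inter_add_sdiff (μ := liftMeasure ν) (Ioo u v) hAm
    rw [← this, show liftMeasure ν (Ioo u v \ A) = 0 from
      measure_mono_null (fun t ht => ht.2) hA0, add_zero]
  have hLR : L ≤ R := by linarith
  have e2 : liftMeasure ν (g '' (Ioo u v \ A)) ≤ ENNReal.ofReal (a * (Λ * e) + δ) := by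
    refine liftMeasure_le_of_subset hν hLR ha (mul_nonneg hΛ he) hδ
      (hmeas' _ sdiff_subset (measurableSet_Ioo.diff hAm)) ?_ ?_
    · rintro _ ⟨t, ht, rfl⟩
      have ht' := hsub (Ioo_subset_Icc_self ht.1)
      have hb := hgLR t ht'
      refine ⟨lt_of_le_of_ne hb.1 fun hc => ?_, hb.2⟩
      have hp' := hgLR u (hsub (left_mem_Icc.2 huv.le))
      have hq' := hgLR v (hsub (right_mem_Icc.2 huv.le))
      rcases hm with h | h
      · have := h (hsub (left_mem_Icc.2 huv.le)) ht' ht.1.1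
        linarith [hp'.1]
      · have := h ht' (hsub (right_mem_Icc.2 huv.le)) ht.1.2
        linarith [hq'.1]
    · refine volume_image_le_of_lipschitz hΛ (fun x hx y hy hxy => ?_)
        ((measure_mono ?_).trans hN)
      · exact hLip x y (hsub (Ioo_subset_Icc_self hx.1)).1 hxy (hsub (Ioo_subset_Icc_self hy.1)).2
      · exact fun t ht => ⟨hsub (Ioo_subset_Icc_self ht.1), ht.2⟩
  have huv' := image_Ioo_of_strictMonoOn_or_strictAntiOn hgc huv
    (hm.imp (fun h => h.mono hsub) fun h => h.mono hsub)
  have hle1 : liftMeasure ν (Ioo u v) ≤ liftMeasure ν (g '' Ioo u v) := by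
    rw [← e1]; exact measure_mono (image_mono inter_subset_left)
  have hle2 : liftMeasure ν (g '' Ioo u v) ≤
      liftMeasure ν (Ioo u v) + ENNReal.ofReal (a * (Λ * e) + δ) := by
    rw [← e1]
    refine le_trans ?_ (add_le_add le_rfl e2)
    rw [← inter_union_sdiff (Ioo u v) A, image_union, inter_union_sdiff]
    exact measure_union_le _ _
  have hδ0 : 0 ≤ δ := le_trans (intervalIntegral.integral_nonneg hLR fun t _ => abs_nonneg _) hδ
  have hnn : ∀ x y, x ≤ y → 0 ≤ ∫ t in x..y, density ν t := fun x y hxy =>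
    intervalIntegral.integral_nonneg hxy fun t _ => density_nonneg ν t
  rw [huv', liftMeasure_Ioo hν min_le_max, liftMeasure_Ioo hν huv.le] at hle1 hle2
  rw [← ENNReal.ofReal_add (hnn _ _ huv.le) (by positivity)] at hle2
  rw [ENNReal.ofReal_le_ofReal_iff (hnn _ _ min_le_max)] at hle1
  rw [ENNReal.ofReal_le_ofReal_iff (by have := hnn _ _ huv.le; positivity)] at hle2
  have hu := hgLR u (hsub (left_mem_Icc.2 huv.le))
  have hv := hgLR v (hsub (right_mem_Icc.2 huv.le))
  have w1 := abs_integral_density_sub_le hν hδ (le_min hu.1 hv.1) min_le_max (max_le hu.2 hv.2)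
  have w2 := abs_integral_density_sub_le hν hδ (hLp.trans hpu) huv.le (hvq.trans hqR)
  rw [max_sub_min_eq_abs] at w1
  rw [abs_le] at w1 w2 ⊢
  constructor <;> linarith

end BimodData

section window

variable {ν : Measure UnitAddCircle} [IsFiniteMeasure ν]

theorem liftMeasure_Ioo_add_int (ν : Measure UnitAddCircle) (p q : ℝ) (j : ℤ) :
    liftMeasure ν (Ioo (p + j) (q + j)) = liftMeasure ν (Ioo p q) := by
  rw [← BimodData.liftMeasure_image_add_int ν (measurableSet_Ioo (a := p) (b := q)) j,
    image_add_const_Ioo]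

/-- An interval of small mass meeting the middle of a window of nearly constant density is
contained in the window. -/
theorem subset_window (hν : ν ≪ volume) {x s a p q t : ℝ} (hs : 0 < s) (ha : 0 < a)
    (hδ : ∫ t in (x - 20 * s)..(x + 20 * s), |density ν t - a| ≤ a * s)
    (hmass : liftMeasure ν (Ioo p q) ≤ ENNReal.ofReal (6 * (a * s))) (ht : t ∈ Ioo p q) (j : ℤ)
    (htj : t + j ∈ Ioo (x - 3 * s) (x + 3 * s)) : x - 20 * s ≤ p + j ∧ q + j ≤ x + 20 * s := by
  rw [← liftMeasure_Ioo_add_int ν p q j] at hmass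
  have has : 0 < a * s := mul_pos ha hs
  have key : ∀ u v, x - 20 * s ≤ u → u ≤ v → v ≤ x + 20 * s → 17 * s ≤ v - u →
      Ioo u v ⊆ Ioo (p + j) (q + j) → False := by
    intro u v hu huv hv hlen hsub
    have h1 := abs_integral_density_sub_le hν hδ hu huv hv
    have h2 := (measure_mono hsub).trans hmass
    rw [liftMeasure_Ioo hν huv, ENNReal.ofReal_le_ofReal_iff (by positivity)] at h2
    have h3 := mul_le_mul_of_nonneg_left hlen ha.le
    have := (abs_le.1 h1).1
    linarith
  constructor
  · by_contra! hcon
    refine key (x - 20 * s) (x - 3 * s) le_rfl (by linarith) (by linarith) (by linarith)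
      (Ioo_subset_Ioo hcon.le ?_)
    linarith [htj.1, ht.2]
  · by_contra! hcon
    refine key (x + 3 * s) (x + 20 * s) (by linarith) (by linarith) le_rfl (by linarith)
      (Ioo_subset_Ioo ?_ hcon.le)
    linarith [htj.2, ht.1]

theorem volume_diff_le_of_goodPoint (hν : ν ≪ volume) {ε τ y p q : ℝ}
    (hy : GoodPoint (density ν) ε τ y) (hpq : p < q) (hyI : y ∈ Icc p q) (hτ : q - p ≤ τ) :
    volume (Icc p q \ {t | 0 < density ν t}) ≤ ENNReal.ofReal (ε * (q - p)) := by
  have hA : MeasurableSet {t | 0 < density ν t} :=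
    measurableSet_lt measurable_const (measurable_density ν)
  have h1 := hy.2 p q hpq hyI hτ
  have hy0 := hy.1
  have hi : IntegrableOn (fun t => |density ν t - density ν y|) (Icc p q) := by
    rw [integrableOn_Icc_iff_integrableOn_Ioc]
    exact ((intervalIntegrable_density hν p q).1.sub (integrableOn_const (by simp))).abs
  rw [intervalIntegral.integral_of_le hpq.le, ← integral_Icc_eq_integral_Ioc] at h1
  have h2 : ∫ t in Icc p q \ {t | 0 < density ν t}, density ν y ≤
      ∫ t in Icc p q, |density ν t - density ν y| := by
    refine le_trans ?_ (setIntegral_mono_set hi (ae_of_all _ fun t => abs_nonneg _)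
      (sdiff_subset (t := {t | 0 < density ν t})).eventuallyLE)
    refine setIntegral_mono_on (integrableOn_const ((measure_mono sdiff_subset).trans_lt
      (by simp : volume (Icc p q) < ⊤)).ne)
      (hi.mono_set sdiff_subset) (measurableSet_Icc.diff hA) fun t ht => ?_
    have := ht.2
    simp only [mem_ofPred_eq, not_lt] at this
    rw [le_antisymm this (density_nonneg ν t), zero_sub, abs_neg, abs_of_pos hy0]
  have h3 : volume.real (Icc p q \ {t | 0 < density ν t}) * density ν y ≤
      ε * density ν y * (q - p) := by
    refine le_trans (le_of_eq ?_) (h2.trans h1)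
    simp
  have h4 : volume.real (Icc p q \ {t | 0 < density ν t}) ≤ ε * (q - p) := by
    refine le_of_mul_le_mul_right ?_ hy0
    linarith
  have hfin : volume (Icc p q \ {t | 0 < density ν t}) ≠ ⊤ :=
    ((measure_mono sdiff_subset).trans_lt (by simp : volume (Icc p q) < ⊤)).ne
  rw [← ENNReal.ofReal_toReal hfin]
  exact ENNReal.ofReal_le_ofReal h4

end window

namespace BimodData

variable (B : BimodData)

/-- Cross-ratio control on a branch whose orbit of intervals has bounded multiplicity. -/
theorem crossRatio_branch_bound {K : ℝ} (hK : 0 ≤ K)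
    (hcr : ∀ (n : ℕ) (a b e d : ℝ), a < b → b < e → e < d →
      (∀ i < n, ∀ x ∈ Ioo a d, deriv B.F (B.F^[i] x) ≠ 0) →
      Real.exp (-(K * ∑ i ∈ Finset.range n, |B.F^[i] d - B.F^[i] a|)) * crossRatio a b e d ≤
        crossRatio (B.F^[n] a) (B.F^[n] b) (B.F^[n] e) (B.F^[n] d))
    {n : ℕ} {a' b' : ℝ} (hno : ∀ i < n, ∀ t ∈ Ioo a' b', deriv B.F (B.F^[i] t) ≠ 0) {M : ℝ}
    (hM : ∑ i ∈ Finset.range n, |B.F^[i] b' - B.F^[i] a'| ≤ M) {a b e d : ℝ} (ha : a' ≤ a)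
    (hab : a < b) (hbe : b < e) (hed : e < d) (hd : d ≤ b') :
    Real.exp (-(K * M)) * crossRatio a b e d ≤
      crossRatio (B.F^[n] a) (B.F^[n] b) (B.F^[n] e) (B.F^[n] d) := by
  have hsub : Ioo a d ⊆ Ioo a' b' := Ioo_subset_Ioo ha hd
  refine le_trans (mul_le_mul_of_nonneg_right ?_ (crossRatio_pos hab hbe hed).le)
    (hcr n a b e d hab hbe hed fun i hi t ht => hno i hi t (hsub ht))
  rw [Real.exp_le_exp, neg_le_neg_iff]
  refine mul_le_mul_of_nonneg_left (le_trans (Finset.sum_le_sum fun i hi => ?_) hM) hK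
  have hi := Finset.mem_range.1 hi
  have a1 : a ∈ Icc a' b' := ⟨ha, by linarith⟩
  have d1 : d ∈ Icc a' b' := ⟨by linarith, hd⟩
  have a0 : a' ∈ Icc a' b' := ⟨le_rfl, by linarith⟩
  have b0 : b' ∈ Icc a' b' := ⟨by linarith, le_rfl⟩
  rcases B.strictMonoOn_or_strictAntiOn_iterate (n := i) (fun l hl => hno l (by omega)) with h | h
  · have := h.monotoneOn a0 a1 ha
    have := h.monotoneOn d1 b0 hd
    have := h.monotoneOn a1 d1 (by linarith)
    rw [abs_of_nonneg (by linarith), abs_of_nonneg (by linarith)]; linarith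
  · have := h.antitoneOn a0 a1 ha
    have := h.antitoneOn d1 b0 hd
    have := h.antitoneOn a1 d1 (by linarith)
    rw [abs_of_nonpos (by linarith), abs_of_nonpos (by linarith)]; linarith

/-- The orbit of the pulled back interval has multiplicity at most `M`. -/
theorem card_le_of_few_visits {n : ℕ} {a' b' y x s : ℝ} {W : Set ℝ} {M : ℕ}
    (hW : ∀ t ∈ B.F^[n] '' Ioo a' b', ∃ j : ℤ, t + j ∈ W)
    (hwin : ∀ k, 1 ≤ k → k < n → ∀ t ∈ B.F^[k] '' Ioo a' b', ∀ j : ℤ, t + j ∈ W →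
      ∃ j' : ℤ, B.F^[k] y + j' ∈ Ioo (x - 20 * s) (x + 20 * s))
    (hvis : ∀ u : Finset ℕ, (∀ k ∈ u, 1 ≤ k ∧ k < n ∧
      ∃ j' : ℤ, B.F^[k] y + j' ∈ Ioo (x - 20 * s) (x + 20 * s)) → u.card < M)
    (z : UnitAddCircle) (u : Finset ℕ) (hu : u ⊆ Finset.range n)
    (hz : ∀ i ∈ u, ∃ t ∈ B.F^[i] '' Ioo a' b', (t : UnitAddCircle) = z) : u.card ≤ M := by
  classical
  rcases u.eq_empty_or_nonempty with rfl | hne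
  · simp
  set m := u.max' hne with hm
  have hmu : m ∈ u := u.max'_mem hne
  have hmn : m < n := Finset.mem_range.1 (hu hmu)
  obtain ⟨tm, ⟨r, hr, rfl⟩, htmz⟩ := hz m hmu
  obtain ⟨j, hj⟩ := hW _ ⟨r, hr, rfl⟩
  have hsplit : B.F^[n] r = B.F^[n - m] (B.F^[m] r) := by
    rw [← Function.iterate_add_apply, Nat.sub_add_cancel hmn.le]
  have hlt := hvis ((u.erase m).image fun i => n - m + i) (by
    intro k hk
    obtain ⟨i, hi, rfl⟩ := Finset.mem_image.1 hk
    have hiu := Finset.mem_of_mem_erase hi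
    have him : i < m := lt_of_le_of_ne (u.le_max' i hiu) (Finset.ne_of_mem_erase hi)
    refine ⟨by omega, by omega, ?_⟩
    obtain ⟨ti, ⟨r', hr', rfl⟩, hti⟩ := hz i hiu
    obtain ⟨l, hl⟩ := coe_eq_coe_iff.1 (hti.trans htmz.symm)
    refine hwin _ (by omega) (by omega) (B.F^[n - m + i] r') ⟨r', hr', rfl⟩ (l + j) ?_
    rw [hsplit, hl, B.iterate_add_int] at hj
    rw [Function.iterate_add_apply]
    push_cast
    rwa [← add_assoc])
  rw [Finset.card_image_of_injective _ (fun i i' h => by simpa using h),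
    Finset.card_erase_of_mem hmu] at hlt
  omega

end BimodData

namespace BimodData

variable (B : BimodData)

/-- Subinterval of a branch whose image is concentric to the image of the branch. -/
theorem exists_middle {g : ℝ → ℝ} (hg : Continuous g) {a' b' y α β s : ℝ} (hs : s = β - α)
    (hy : y ∈ Ioo a' b') (hgy : g y ∈ Ioo α β)
    (hm : StrictMonoOn g (Icc a' b') ∨ StrictAntiOn g (Icc a' b'))
    (hends : (g a' = α - 2 * s ∧ g b' = β + 2 * s) ∨ (g a' = β + 2 * s ∧ g b' = α - 2 * s)) :
    ∃ p q, a' < p ∧ p < y ∧ y < q ∧ q < b' ∧ |g q - g p| = 4 * s ∧ |g p - g a'| = s / 2 ∧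
      |g b' - g q| = s / 2 ∧ 3 / 2 * s ≤ |g q - g y| ∧ 3 / 2 * s ≤ |g y - g p| := by
  have hab : a' < b' := hy.1.trans hy.2
  have ha0 : a' ∈ Icc a' b' := left_mem_Icc.2 hab.le
  have hb0 : b' ∈ Icc a' b' := right_mem_Icc.2 hab.le
  have hy0 := Ioo_subset_Icc_self hy
  obtain ⟨gy1, gy2⟩ := hgy
  have hgab : |g b' - g a'| = 5 * s := by
    rcases hends with ⟨h1, h2⟩ | ⟨h1, h2⟩
    · rw [h1, h2, abs_of_pos (by linarith)]; linarith
    · rw [h1, h2, abs_of_neg (by linarith)]; linarith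
  rcases hm with hm | hm
  · have hlt := hm ha0 hb0 hab
    obtain ⟨h1, h2⟩ : g a' = α - 2 * s ∧ g b' = β + 2 * s := by
      rcases hends with h | ⟨h1, h2⟩
      · exact h
      · linarith
    obtain ⟨p, hp, hgp⟩ := intermediate_value_Ioo hy.1.le hg.continuousOn
      (show α - 3 / 2 * s ∈ Ioo (g a') (g y) from ⟨by linarith, by linarith⟩)
    obtain ⟨q, hq, hgq⟩ := intermediate_value_Ioo hy.2.le hg.continuousOn
      (show β + 3 / 2 * s ∈ Ioo (g y) (g b') from ⟨by linarith, by linarith⟩)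
    refine ⟨p, q, hp.1, hp.2, hq.1, hq.2, ?_, ?_, ?_, ?_, ?_⟩ <;> rw [abs_of_pos (by linarith)] <;>
      linarith
  · have hlt := hm ha0 hb0 hab
    obtain ⟨h1, h2⟩ : g a' = β + 2 * s ∧ g b' = α - 2 * s := by
      rcases hends with ⟨h1, h2⟩ | h
      · linarith
      · exact h
    obtain ⟨p, hp, hgp⟩ := intermediate_value_Ioo' hy.1.le hg.continuousOn
      (show β + 3 / 2 * s ∈ Ioo (g y) (g a') from ⟨by linarith, by linarith⟩)
    obtain ⟨q, hq, hgq⟩ := intermediate_value_Ioo' hy.2.le hg.continuousOn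
      (show α - 3 / 2 * s ∈ Ioo (g b') (g y) from ⟨by linarith, by linarith⟩)
    refine ⟨p, q, hp.1, hp.2, hq.1, hq.2, ?_, ?_, ?_, ?_, ?_⟩ <;> rw [abs_of_neg (by linarith)] <;>
      linarith

/-- If the Jacobian of the invariant measure is trivial, suitable first returns to a small interval
are close to isometries on that interval. -/
theorem return_estimate {ν : Measure UnitAddCircle} [IsProbabilityMeasure ν] (hν : ν ≪ volume)
    (hinv : Measure.map B.f ν = ν)
    (hJ : ∀ᵐ y ∂ν, ν.rnDeriv volume y = ENNReal.ofReal |B.Df y| * ν.rnDeriv volume (B.f y))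
    {K : ℝ} (hK : 0 ≤ K)
    (hcr : ∀ (n : ℕ) (a b e d : ℝ), a < b → b < e → e < d →
      (∀ i < n, ∀ x ∈ Ioo a d, deriv B.F (B.F^[i] x) ≠ 0) →
      Real.exp (-(K * ∑ i ∈ Finset.range n, |B.F^[i] d - B.F^[i] a|)) * crossRatio a b e d ≤
        crossRatio (B.F^[n] a) (B.F^[n] b) (B.F^[n] e) (B.F^[n] d))
    {M : ℕ} {x α β s a κ ε τ y : ℝ} (hs : s = β - α) (hs0 : 0 < s) (hs1 : 40 * s < 1)
    (hx : x ∈ Ioo α β) (ha : 0 < a) (hκ1 : κ ≤ 1)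
    (hδ : ∫ t in (x - 20 * s)..(x + 20 * s), |density ν t - a| ≤ κ * (a * s))
    (hpc : ∀ t ∈ Ioo (x - 20 * s) (x + 20 * s), (t : UnitAddCircle) ∉ B.postcritical)
    (hy : y ∈ Ioo α β) (hgood : GoodPoint (density ν) ε τ y) (hτ : 40 * s ≤ τ) (hε : 0 ≤ ε)
    (hsmall : 3 * κ + 40 * Real.exp (K * M) * ε ≤ 1 / 2) {n : ℕ} (hn : 1 ≤ n) {j : ℤ}
    (hret : B.F^[n] y + j ∈ Ioo α β)
    (hvis : ∀ u : Finset ℕ, (∀ k ∈ u, 1 ≤ k ∧ k < n ∧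
      ∃ j' : ℤ, B.F^[k] y + j' ∈ Ioo (x - 20 * s) (x + 20 * s)) → u.card < M) :
    ∃ σ : ℝ, (σ = 1 ∨ σ = -1) ∧ ∀ u ∈ ({α, β} : Set ℝ),
      |B.F^[n] u + j - (B.F^[n] y + j) - σ * (u - y)| ≤
        (3 * κ + 40 * Real.exp (K * M) * ε) * s := by
  obtain ⟨hx1, hx2⟩ := hx
  have has : 0 < a * s := mul_pos ha hs0
  have hδ' : ∫ t in (x - 20 * s)..(x + 20 * s), |density ν t - a| ≤ a * s :=
    hδ.trans (mul_le_of_le_one_left has.le hκ1)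
  -- the branch
  obtain ⟨a', b', hyI, hno, hends⟩ := B.exists_pullback hn (z := y)
    (a := α - 2 * s - j) (b := β + 2 * s - j) ⟨by linarith [hret.1], by linarith [hret.2]⟩ (by
      intro c hc i hi _ hmem
      refine hpc (B.F^[i] c + j) ⟨by linarith [hmem.1], by linarith [hmem.2]⟩ ?_
      rw [coe_add_int]
      exact B.iterate_critical_mem hc hi)
  have hab : a' < b' := hyI.1.trans hyI.2
  have hmF := B.strictMonoOn_or_strictAntiOn_iterate hno
  set g : ℝ → ℝ := fun t => B.F^[n] t + j with hg
  have hgc : Continuous g := (B.continuous_iterate n).add continuous_const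
  have hm : StrictMonoOn g (Icc a' b') ∨ StrictAntiOn g (Icc a' b') := by
    rcases hmF with h | h
    · exact Or.inl fun u hu v hv huv => by simp only [hg]; linarith [h hu hv huv]
    · exact Or.inr fun u hu v hv huv => by simp only [hg]; linarith [h hu hv huv]
  have hgends : (g a' = α - 2 * s ∧ g b' = β + 2 * s) ∨ (g a' = β + 2 * s ∧ g b' = α - 2 * s) := by
    rcases hends with ⟨h1, h2⟩ | ⟨h1, h2⟩
    · exact Or.inl ⟨by simp only [hg]; linarith, by simp only [hg]; linarith⟩
    · exact Or.inr ⟨by simp only [hg]; linarith, by simp only [hg]; linarith⟩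
  have hlen5 : |B.F^[n] b' - B.F^[n] a'| = 5 * s := by
    rcases hends with ⟨h1, h2⟩ | ⟨h1, h2⟩
    · rw [h1, h2, abs_of_pos (by linarith)]; linarith
    · rw [h1, h2, abs_of_neg (by linarith)]; linarith
  have hlen : |B.F^[n] b' - B.F^[n] a'| < 1 := by rw [hlen5]; linarith
  have himgn : B.F^[n] '' Ioo a' b' = Ioo (α - 2 * s - j) (β + 2 * s - j) := by
    rw [image_Ioo_of_strictMonoOn_or_strictAntiOn (B.continuous_iterate n) hab hmF]
    have h0 : α - 2 * s - j ≤ β + 2 * s - j := by linarith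
    rcases hends with ⟨h1, h2⟩ | ⟨h1, h2⟩
    · rw [h1, h2, min_eq_left h0, max_eq_right h0]
    · rw [h1, h2, min_eq_right h0, max_eq_left h0]
  have hmass : liftMeasure ν (B.F^[n] '' Ioo a' b') ≤ ENNReal.ofReal (6 * (a * s)) := by
    rw [himgn, ← liftMeasure_Ioo_add_int ν _ _ j, sub_add_cancel, sub_add_cancel,
      liftMeasure_Ioo hν (by linarith)]
    refine ENNReal.ofReal_le_ofReal ?_
    have := (abs_le.1 (abs_integral_density_sub_le hν hδ' (u := α - 2 * s) (v := β + 2 * s)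
      (by linarith) (by linarith) (by linarith))).2
    have h5 : a * (β + 2 * s - (α - 2 * s)) = 5 * (a * s) := by rw [hs]; ring
    linarith
  have hwin : ∀ k ≤ n, ∀ t ∈ B.F^[k] '' Ioo a' b', ∀ j' : ℤ,
      t + j' ∈ Ioo (α - 2 * s) (β + 2 * s) → ∃ p q, B.F^[k] '' Ioo a' b' = Ioo p q ∧
        x - 20 * s ≤ p + j' ∧ q + j' ≤ x + 20 * s := by
    intro k hk t ht j' htj
    obtain ⟨p, q, -, himg, -, -, -⟩ := B.exists_image_interval hab hno hlen hk
    have hle := (B.liftMeasure_image_le hν hinv hab hno hlen hk).trans hmass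
    rw [himg] at hle ht
    exact ⟨p, q, himg, subset_window hν hs0 ha hδ' hle ht j'
      ⟨by linarith [htj.1], by linarith [htj.2]⟩⟩
  have hab' : x - 20 * s ≤ a' ∧ b' ≤ x + 20 * s := by
    obtain ⟨p, q, himg, h1, h2⟩ := hwin 0 (Nat.zero_le _) y ⟨y, hyI, rfl⟩ 0
      ⟨by push_cast; linarith [hy.1], by push_cast; linarith [hy.2]⟩
    simp only [Function.iterate_zero, image_id] at himg
    have h3 := (Ioo_subset_Ioo_iff hab).1 himg.subset
    push_cast at h1 h2
    constructor <;> linarith [h3.1, h3.2]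
  have hsum := B.sum_length_le hab hno hlen M (B.card_le_of_few_visits (y := y) (x := x) (s := s)
    (W := Ioo (α - 2 * s) (β + 2 * s))
    (fun t ht => ⟨j, by rw [himgn] at ht; constructor <;> linarith [ht.1, ht.2]⟩)
    (fun k _ hk t ht j' htj => by
      obtain ⟨p, q, himg, h1, h2⟩ := hwin k hk.le t ht j' htj
      have hyk : B.F^[k] y ∈ Ioo p q := himg ▸ mem_image_of_mem _ hyI
      exact ⟨j', by linarith [hyk.1], by linarith [hyk.2]⟩) hvis)
  -- distortion on the middle part
  obtain ⟨p, q, hap, hpy, hyq, hqb, l1, l2, l3, l4, l5⟩ :=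
    exists_middle hgc hs hyI hret hm hgends
  have hpq : p < q := hpy.trans hyq
  have hgsub : ∀ u v, g v - g u = B.F^[n] v - B.F^[n] u := fun u v => by simp only [hg]; ring
  set c := Real.exp (-(K * M)) with hc
  have hc0 : 0 < c := Real.exp_pos _
  have hc1 : c ≤ 1 := Real.exp_le_one_iff.2 (by
    have : 0 ≤ K * M := by positivity
    linarith)
  have hcinv : Real.exp (K * M) = 1 / c := by rw [hc, Real.exp_neg, one_div, inv_inv]
  have hLip : ∀ u v, p ≤ u → u < v → v ≤ q → |g v - g u| ≤ 40 * s / (c * (q - p)) * (v - u) := by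
    intro u v hpu huv hvq
    have := slope_le_of_crossRatio hmF hap hpq hqb hc0 hc1 (η := 1 / 10) (by norm_num)
      (fun a b e d h1 h2 h3 h4 h5 => B.crossRatio_branch_bound hK hcr hno hsum h1 h2 h3 h4 h5)
      (by rw [hlen5, ← hgsub, l2]; linarith) (by rw [hlen5, ← hgsub, l3]; linarith) hpu huv hvq
    rw [← hgsub, ← hgsub, l1] at this
    have hcq : 0 < c * (q - p) := mul_pos hc0 (sub_pos.2 hpq)
    rw [div_mul_eq_mul_div, le_div_iff₀ hcq]
    linarith
  have hsubpq : Icc p q ⊆ Icc a' b' := Icc_subset_Icc hap.le hqb.le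
  have hgW : ∀ t ∈ Icc p q, g t ∈ Icc (x - 20 * s) (x + 20 * s) := by
    intro t ht
    have : B.F^[n] t ∈ B.F^[n] '' Ioo a' b' := ⟨t, ⟨hap.trans_le ht.1, ht.2.trans_lt hqb⟩, rfl⟩
    rw [himgn] at this
    simp only [hg]
    constructor <;> linarith [this.1, this.2]
  have hmpq := hm.imp (fun h => h.mono hsubpq) fun h => h.mono hsubpq
  have hcomp : ∀ u v, p ≤ u → u < v → v ≤ q →
      |(|g v - g u|) - (v - u)| ≤ (3 * κ + 40 * Real.exp (K * M) * ε) * s := by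
    intro u v hpu huv hvq
    have := B.abs_length_sub_le hν hinv hJ (g := g) hg hmpq (hab'.1.trans hap.le)
      (hqb.le.trans hab'.2) hgW ha.le (e := ε * (q - p)) (mul_nonneg hε (sub_pos.2 hpq).le) hδ
      (Λ := 40 * s / (c * (q - p)))
      (div_nonneg (by linarith) (mul_nonneg hc0.le (sub_pos.2 hpq).le)) hLip
      (volume_diff_le_of_goodPoint hν hgood hpq ⟨hpy.le, hyq.le⟩ (by linarith)) hpu huv hvq
    rw [← mul_sub, abs_mul, abs_of_pos ha] at this
    have hqp : q - p ≠ 0 := (sub_pos.2 hpq).ne'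
    have heq : 3 * (κ * (a * s)) + a * (40 * s / (c * (q - p)) * (ε * (q - p))) =
        a * ((3 * κ + 40 * Real.exp (K * M) * ε) * s) := by
      rw [hcinv]; field_simp
    rw [heq] at this
    exact le_of_mul_le_mul_left this ha
  have hks : (3 * κ + 40 * Real.exp (K * M) * ε) * s ≤ 1 / 2 * s :=
    mul_le_mul_of_nonneg_right hsmall hs0.le
  have hβq : β ≤ q := by
    have := (abs_le.1 (hcomp y q hpy.le hyq le_rfl)).2
    linarith [hy.1]
  have hpα : p ≤ α := by
    have := (abs_le.1 (hcomp p y le_rfl hpy hyq.le)).2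
    linarith [hy.2]
  have cβ := hcomp y β hpy.le hy.2 hβq
  have cα := hcomp α y hpα hy.1 hyq.le
  have mα : α ∈ Icc p q := ⟨hpα, by linarith [hy.1]⟩
  have mβ : β ∈ Icc p q := ⟨by linarith [hy.2], hβq⟩
  have my : y ∈ Icc p q := ⟨hpy.le, hyq.le⟩
  rcases hmpq with h | h
  · refine ⟨1, Or.inl rfl, ?_⟩
    rintro u (rfl | rfl)
    · rw [abs_of_pos (sub_pos.2 (h mα my hy.1)), abs_sub_comm] at cα
      convert cα using 2
      simp only [hg]; ring
    · rw [abs_of_pos (sub_pos.2 (h my mβ hy.2))] at cβ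
      convert cβ using 2
      simp only [hg]; ring
  · refine ⟨-1, Or.inr rfl, ?_⟩
    rintro u (rfl | rfl)
    · rw [abs_of_neg (sub_neg.2 (h mα my hy.1))] at cα
      convert cα using 2
      simp only [hg]; ring
    · rw [abs_of_neg (sub_neg.2 (h my mβ hy.2)), abs_sub_comm] at cβ
      convert cβ using 2
      simp only [hg]; ring

end BimodData

namespace BimodData

variable (B : BimodData)

theorem isOpen_coe_image (a b : ℝ) :
    IsOpen ((fun x : ℝ => (x : UnitAddCircle)) '' Ioo a b) :=
  QuotientAddGroup.isOpenMap_coe _ isOpen_Ioo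

theorem mem_coe_image_iff {S : Set ℝ} {x : ℝ} :
    (x : UnitAddCircle) ∈ (fun x : ℝ => (x : UnitAddCircle)) '' S ↔ ∃ j : ℤ, x + j ∈ S := by
  constructor
  · rintro ⟨y, hy, h⟩
    obtain ⟨n, hn⟩ := coe_eq_coe_iff.1 (h : (y : UnitAddCircle) = x).symm
    exact ⟨n, hn ▸ hy⟩
  · rintro ⟨j, hj⟩
    exact ⟨_, hj, coe_add_int x j⟩

/-- Poincaré recurrence on the line. -/
theorem ae_returns {ν : Measure UnitAddCircle} [IsProbabilityMeasure ν] (hν : ν ≪ volume)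
    (hinv : Measure.map B.f ν = ν) (a b : ℝ) : ∀ᵐ y ∂(liftMeasure ν), y ∈ Ioo a b →
      ∃ n, 1 ≤ n ∧ ∃ j : ℤ, B.F^[n] y + j ∈ Ioo a b := by
  have h := (B.measurePreserving_f hinv).conservative.ae_mem_imp_frequently_image_mem
    (isOpen_coe_image a b).measurableSet.nullMeasurableSet
  filter_upwards [(isCircleLift_liftMeasure hν).ae_coe h] with y hy hyab
  obtain ⟨n, hn, hn'⟩ := frequently_atTop.1 (hy ⟨y, hyab, rfl⟩) 1
  rw [B.f_iterate_coe, mem_coe_image_iff] at hn'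
  exact ⟨n, hn, hn'⟩

/-- An interval of positive measure covers the circle under iteration. -/
theorem exists_iterate_eq_of_pos {ν : Measure UnitAddCircle} [IsProbabilityMeasure ν]
    (hν : ν ≪ volume) (hinv : Measure.map B.f ν = ν) {a b : ℝ}
    (hpos : liftMeasure ν (Ioo a b) ≠ 0) (t : ℝ) :
    ∃ (k : ℕ) (i : ℤ) (y : ℝ), y ∈ Ioo a b ∧ B.F^[k] y = t + i := by
  obtain ⟨y, hy, hy'⟩ := (frequently_ae_mem_iff.2 hpos).and_eventually
    (B.ae_returns hν hinv a b) |>.exists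
  obtain ⟨n, hn, j, hj⟩ := hy' hy
  exact B.exists_iterate_eq_add_int hn (-j) hy (by push_cast; rwa [sub_neg_eq_add]) t

theorem exists_critPre_of_pos {ν : Measure UnitAddCircle} [IsProbabilityMeasure ν]
    (hν : ν ≪ volume) (hinv : Measure.map B.f ν = ν) {a b : ℝ}
    (hpos : liftMeasure ν (Ioo a b) ≠ 0) : ∃ m, ∃ u ∈ Ioo a b, u ∈ B.critPre m := by
  obtain ⟨k, i, y, hy, h⟩ := B.exists_iterate_eq_of_pos hν hinv hpos B.ctp
  refine ⟨k, y, hy, k, le_rfl, ?_⟩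
  rw [h, B.deriv_add_int, B.deriv_ctp]

/-- Intervals adjacent to a Lebesgue point of positive density have positive measure. -/
theorem liftMeasure_Ioo_pos {ν : Measure UnitAddCircle} [IsProbabilityMeasure ν] (hν : ν ≪ volume)
    {x : ℝ} (hx : 0 < density ν x)
    (hleb : ∀ ε > 0, ∃ τ > 0, ∀ a b, a < b → x ∈ Icc a b → b - a ≤ τ →
      ∫ t in a..b, |density ν t - density ν x| ≤ ε * (b - a)) {a b : ℝ} (hab : a < b)
    (hxab : x ∈ Icc a b) : liftMeasure ν (Ioo a b) ≠ 0 := by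
  obtain ⟨τ, hτ, h⟩ := hleb (density ν x / 2) (half_pos hx)
  obtain ⟨a', b', ha, hab', hb, hx', hτ'⟩ : ∃ a' b', a ≤ a' ∧ a' < b' ∧ b' ≤ b ∧ x ∈ Icc a' b' ∧
      b' - a' ≤ τ := by
    rcases hxab.1.lt_or_eq with h1 | h1
    · refine ⟨max a (x - τ), x, le_max_left _ _, max_lt h1 (by linarith), hxab.2,
        ⟨max_le h1.le (by linarith), le_rfl⟩, ?_⟩
      linarith [le_max_right a (x - τ)]
    · refine ⟨x, min b (x + τ), h1.le, lt_min (by linarith) (by linarith), min_le_left _ _,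
        ⟨le_rfl, le_min hxab.2 (by linarith)⟩, ?_⟩
      linarith [min_le_right b (x + τ)]
  have h2 := (abs_le.1 (abs_integral_density_sub_le hν (h a' b' hab' hx' hτ') le_rfl hab'.le
    le_rfl)).1
  have h3 : 0 < density ν x * (b' - a') := mul_pos hx (sub_pos.2 hab')
  have h4 : 0 < liftMeasure ν (Ioo a' b') := by
    rw [liftMeasure_Ioo hν hab'.le, ENNReal.ofReal_pos]
    linarith
  exact (h4.trans_le (measure_mono (Ioo_subset_Ioo ha hb))).ne'

/-- Sets of small measure have small length in a window of nearly constant density. -/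
theorem volume_preimage_inter_le {ν : Measure UnitAddCircle} [IsProbabilityMeasure ν]
    (hν : ν ≪ volume) {M : ℕ} {x α β s a κ : ℝ} (hs : s = β - α) (hs0 : 0 < s)
    (hs1 : 40 * s < 1) (hx : x ∈ Ioo α β) (ha : 0 < a) (hM : 0 < M) (hκ1 : κ ≤ 1)
    (hδ : ∫ t in (x - 20 * s)..(x + 20 * s), |density ν t - a| ≤ κ * (a * s))
    {S : Set UnitAddCircle} (hS : MeasurableSet S)
    (hSM : M * ν S ≤ ν ((fun x : ℝ => (x : UnitAddCircle)) '' Ioo (x - 20 * s) (x + 20 * s))) :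
    volume ((fun x : ℝ => (x : UnitAddCircle)) ⁻¹' S ∩ Ioo α β) ≤
      ENNReal.ofReal ((41 / M + κ) * s) := by
  set T := (fun x : ℝ => (x : UnitAddCircle)) ⁻¹' S ∩ Ioo α β with hT
  have hM' : (0 : ℝ) < M := by exact_mod_cast hM
  have hTm : MeasurableSet T := (measurable_coe_circle hS).inter measurableSet_Ioo
  have hl := isCircleLift_liftMeasure hν
  have has : 0 < a * s := mul_pos ha hs0
  have hTw : T ⊆ Ioc (x - 20 * s) (x + 20 * s) := fun t ht =>
    ⟨by linarith [ht.2.1, hx.2], by linarith [ht.2.2, hx.1]⟩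
  have h1 : liftMeasure ν T ≤ ν S := by
    rw [← hl.measure_image (t := x - 20 * s) hTm
      (hTw.trans (Ioc_subset_Ioc_right (by linarith)))]
    refine measure_mono ?_
    rintro _ ⟨t, ht, rfl⟩
    exact ht.1
  rw [hl.measure_image (t := x - 20 * s) measurableSet_Ioo
    (Ioo_subset_Ioc_self.trans (Ioc_subset_Ioc_right (by linarith))),
    liftMeasure_Ioo hν (by linarith)] at hSM
  have h2 := (abs_le.1 (abs_integral_density_sub_le hν hδ le_rfl (by linarith) le_rfl)).2
  have h3 := (mul_le_mul_right h1 (M : ENNReal)).trans hSM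
  rw [liftMeasure_apply hν hTm hTw, ← ENNReal.ofReal_natCast,
    ← ENNReal.ofReal_mul (by positivity)] at h3
  have hκs : κ * (a * s) ≤ 1 * (a * s) := mul_le_mul_of_nonneg_right hκ1 has.le
  have hi0 : 0 ≤ ∫ t in (x - 20 * s)..(x + 20 * s), density ν t :=
    intervalIntegral.integral_nonneg (by linarith) fun t _ => density_nonneg ν t
  have h4 : (M : ℝ) * ∫ t in T, density ν t ≤ 41 * (a * s) := by
    refine ((ENNReal.ofReal_le_ofReal_iff hi0).1 h3).trans ?_
    linarith
  have hi : IntegrableOn (density ν) (Ioc (x - 20 * s) (x + 20 * s)) :=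
    (intervalIntegrable_density hν _ _).1
  have hi2 : IntegrableOn (fun t => |density ν t - a|) (Ioc (x - 20 * s) (x + 20 * s)) :=
    (hi.sub (integrableOn_const (by simp))).abs
  have hfin : volume T ≠ ⊤ :=
    ((measure_mono hTw).trans_lt (by rw [Real.volume_Ioc]; exact ENNReal.ofReal_lt_top)).ne
  have h5 : a * volume.real T ≤ (∫ t in T, density ν t) + κ * (a * s) := by
    have e1 : a * volume.real T = ∫ _ in T, a := by simp [mul_comm]
    rw [intervalIntegral.integral_of_le (by linarith)] at hδ
    have e2 : ∫ t in T, |density ν t - a| ≤ κ * (a * s) :=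
      (setIntegral_mono_set hi2 (ae_of_all _ fun t => abs_nonneg _) hTw.eventuallyLE).trans hδ
    have e3 : ∫ _ in T, a ≤ ∫ t in T, (density ν t + |density ν t - a|) := by
      refine setIntegral_mono (integrableOn_const hfin)
        ((hi.mono_set hTw).add (hi2.mono_set hTw)) fun t => ?_
      have := neg_abs_le (density ν t - a)
      simp only
      linarith
    rw [integral_add (hi.mono_set hTw) (hi2.mono_set hTw)] at e3
    rw [e1]
    linarith
  rw [← ENNReal.ofReal_toReal hfin]
  refine ENNReal.ofReal_le_ofReal ?_
  have h6 : ∫ t in T, density ν t ≤ 41 / M * (a * s) := by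
    rw [div_mul_eq_mul_div, le_div_iff₀ hM']
    linarith
  have h7 : a * volume.real T ≤ a * ((41 / M + κ) * s) := by
    refine h5.trans ?_
    linarith
  exact le_of_mul_le_mul_left h7 ha

/-- Selection of a point of a set of large outer measure away from small bad sets. -/
theorem exists_mem_selection {G Bd : Set ℝ} {p : ℝ → Prop} {x α β s : ℝ} (hs : s = β - α)
    (hs0 : 0 < s) (hx : x ∈ Ioo α β)
    (hG : ENNReal.ofReal (19 / 10 * s) ≤ volume (G ∩ Metric.closedBall x s))
    (hBd : volume (Bd ∩ Ioo α β) ≤ ENNReal.ofReal (1 / 10 * s)) (hp : ∀ᵐ y : ℝ, p y) :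
    ∃ y ∈ G, y ∈ Ioo (α + s / 10) (β - s / 10) ∧ y ∉ Bd ∧ p y := by
  by_contra hcon
  push Not at hcon
  have hsub : G ∩ Metric.closedBall x s ⊆ ((Icc (x - s) (α + s / 10) ∪ Icc (β - s / 10) (x + s)) ∪
      (Bd ∩ Ioo α β)) ∪ {y | ¬ p y} := by
    rintro y ⟨hyG, hyb⟩
    rw [Real.closedBall_eq_Icc] at hyb
    by_cases hym : y ∈ Ioo (α + s / 10) (β - s / 10)
    · by_cases hyB : y ∈ Bd
      · exact Or.inl (Or.inr ⟨hyB, by linarith [hym.1], by linarith [hym.2]⟩)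
      · exact Or.inr (hcon y hyG hym hyB)
    · refine Or.inl (Or.inl ?_)
      rcases le_or_gt y (α + s / 10) with h | h
      · exact Or.inl ⟨hyb.1, h⟩
      · refine Or.inr ⟨?_, hyb.2⟩
        by_contra h'
        exact hym ⟨h, lt_of_not_ge h'⟩
  have h1 := hG.trans (measure_mono hsub)
  have h2 : volume (((Icc (x - s) (α + s / 10) ∪ Icc (β - s / 10) (x + s)) ∪
      (Bd ∩ Ioo α β)) ∪ {y | ¬ p y}) ≤ ENNReal.ofReal (13 / 10 * s) := by
    refine (measure_union_le _ _).trans ?_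
    rw [ae_iff.1 hp, add_zero]
    refine (measure_union_le _ _).trans ((add_le_add (measure_union_le _ _) hBd).trans ?_)
    rw [Real.volume_Icc, Real.volume_Icc, ← ENNReal.ofReal_add (by linarith [hx.1, hx.2])
      (by linarith [hx.1, hx.2]), ← ENNReal.ofReal_add (by linarith [hx.1, hx.2]) (by linarith)]
    exact ENNReal.ofReal_le_ofReal (by linarith)
  have h3 := (ENNReal.ofReal_le_ofReal_iff (by linarith)).1 (h1.trans h2)
  linarith

end BimodData

theorem ae_of_ae_liftMeasure {ν : Measure UnitAddCircle} {p : ℝ → Prop}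
    (h : ∀ᵐ x ∂(liftMeasure ν), p x) : ∀ᵐ x : ℝ, 0 < density ν x → p x := by
  rw [liftMeasure, ae_withDensity_iff (measurable_liftDensity ν)] at h
  filter_upwards [h] with x hx h0
  refine hx fun h1 => ?_
  rw [density, h1] at h0
  simp at h0

theorem frequently_density_pos {ν : Measure UnitAddCircle} [IsProbabilityMeasure ν]
    (hν : ν ≪ volume) : ∃ᶠ x in ae (volume : Measure ℝ), 0 < density ν x := by
  intro h
  have h1 := integral_density_one hν
  have h2 : ∫ t in (0 : ℝ)..1, density ν t = ∫ _ in (0 : ℝ)..1, (0 : ℝ) := by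
    refine intervalIntegral.integral_congr_ae ?_
    filter_upwards [h] with x hx _
    exact le_antisymm (not_lt.1 hx) (density_nonneg ν x)
  rw [h1] at h2
  simp at h2

/-- Outer density of an arbitrary set at almost all of its points. -/
theorem ae_mem_imp_measure_closedBall (G : Set ℝ) : ∀ᵐ x : ℝ, x ∈ G → ∀ q < (1 : ℝ), 0 ≤ q →
    ∃ r₀ > 0, ∀ r, 0 < r → r < r₀ →
      ENNReal.ofReal (q * (2 * r)) ≤ volume (G ∩ Metric.closedBall x r) := by
  filter_upwards [ae_imp_of_ae_restrict
    (IsUnifLocDoublingMeasure.ae_tendsto_measure_inter_div (volume : Measure ℝ) G 1)]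
    with x hx hxG q hq hq0
  have ht := hx hxG (ι := ℝ) (l := nhdsWithin 0 (Ioi 0)) (fun _ => x) id tendsto_id (by
    filter_upwards [self_mem_nhdsWithin] with r hr
    exact Metric.mem_closedBall_self (by simpa using (mem_Ioi.1 hr).le))
  have hev := ht.eventually (lt_mem_nhds (show ENNReal.ofReal q < 1 by
    rw [← ENNReal.ofReal_one]; exact (ENNReal.ofReal_lt_ofReal_iff one_pos).2 hq))
  rw [eventually_nhdsWithin_iff] at hev
  obtain ⟨r₀, hr₀, hball⟩ := Metric.eventually_nhds_iff.1 hev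
  refine ⟨r₀, hr₀, fun r hr hrr => ?_⟩
  have h1 := hball (y := r) (by rw [Real.dist_eq, sub_zero, abs_of_pos hr]; exact hrr) hr
  simp only [id, Real.volume_closedBall] at h1
  have h2 : ENNReal.ofReal (2 * r) ≠ 0 := by simpa using hr
  rw [ENNReal.ofReal_mul hq0]
  exact (ENNReal.le_div_iff_mul_le (Or.inl h2) (Or.inl ENNReal.ofReal_ne_top)).1 h1.le

namespace BimodData

variable (B : BimodData)

/-- The endpoints of an interval of return cannot avoid the window. -/
theorem false_of_return {g : ℝ → ℝ} {α β s y κ σ : ℝ} (hs : s = β - α) (hs0 : 0 < s)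
    (hσ : σ = 1 ∨ σ = -1) (hκ : κ ≤ 1 / 20)
    (hy : y ∈ Ioo (α + s / 10) (β - s / 10)) (hgy : g y ∈ Ioo α β)
    (hest : ∀ u ∈ ({α, β} : Set ℝ), |g u - g y - σ * (u - y)| ≤ κ * s)
    (hcut : (∀ e ∈ ({α, β} : Set ℝ), g e ∉ Ioo α (β + (β - α))) ∨
      (∀ e ∈ ({α, β} : Set ℝ), g e ∉ Ioo (α - (β - α)) β)) : False := by
  have hks : κ * s ≤ 1 / 20 * s := mul_le_mul_of_nonneg_right hκ hs0.le
  obtain ⟨a1, a2⟩ := abs_le.1 (hest α (by simp))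
  obtain ⟨b1, b2⟩ := abs_le.1 (hest β (by simp))
  obtain ⟨y1, y2⟩ := hy
  obtain ⟨g1, g2⟩ := hgy
  rcases hcut with hc | hc <;> rcases hσ with rfl | rfl
  · exact hc β (by simp) ⟨by linarith, by linarith⟩
  · exact hc α (by simp) ⟨by linarith, by linarith⟩
  · exact hc α (by simp) ⟨by linarith, by linarith⟩
  · exact hc β (by simp) ⟨by linarith, by linarith⟩

/-- Every absolutely continuous invariant probability has positive Lyapunov exponent. -/
theorem integral_log_Df_pos {ν : Measure UnitAddCircle} [IsProbabilityMeasure ν] (hν : ν ≪ volume)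
    (hinv : Measure.map B.f ν = ν) : 0 < ∫ y, Real.log |B.Df y| ∂ν := by
  obtain ⟨-, hnonneg, hzero⟩ := B.integrable_log_Df hν hinv
  refine hnonneg.lt_of_ne fun h0 => ?_
  have hJ := hzero h0.symm
  obtain ⟨K, hK, hcr⟩ := B.exists_crossRatio_iterate_bound
  obtain ⟨Sc, hSc, hcut⟩ := B.exists_countable_cut
  set ε : ℝ := Real.exp (-(K * (1000 : ℕ))) / 4000 with hε
  have hε0 : 0 < ε := by positivity
  have hκ : 3 * (1 / 100) + 40 * Real.exp (K * (1000 : ℕ)) * ε = 1 / 25 := by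
    have : Real.exp (K * (1000 : ℕ)) * Real.exp (-(K * (1000 : ℕ))) = 1 := by
      rw [← Real.exp_add, add_neg_cancel, Real.exp_zero]
    rw [hε, show 40 * Real.exp (K * (1000 : ℕ)) * (Real.exp (-(K * (1000 : ℕ))) / 4000) =
      Real.exp (K * (1000 : ℕ)) * Real.exp (-(K * (1000 : ℕ))) / 100 by ring, this]
    norm_num
  set G : ℕ → Set ℝ := fun k => {y | GoodPoint (density ν) ε (1 / (k + 1)) y} with hG
  have hpc0 : ∀ᵐ y ∂ν, y ∉ B.postcritical := by
    rw [ae_iff]; simpa using B.measure_postcritical hν hinv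
  obtain ⟨x, ha, hleb, hxS, hpc, hdens⟩ := ((frequently_density_pos hν).and_eventually
    ((ae_forall_interval_integral_le (locallyIntegrable_density hν)).and
      ((show ∀ᵐ x : ℝ, x ∉ Sc from by rw [ae_iff]; simpa using hSc.measure_zero volume).and
      ((ae_of_ae_liftMeasure ((isCircleLift_liftMeasure hν).ae_coe hpc0)).and
      (ae_all_iff.2 fun k => ae_mem_imp_measure_closedBall (G k)))))).exists
  have hpcx := hpc ha
  set a := density ν x with hadef
  obtain ⟨τ₁, hτ₁, hl₁⟩ := hleb (ε * a) (mul_pos hε0 ha)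
  obtain ⟨k, hk⟩ := exists_nat_one_div_lt hτ₁
  have hxG : x ∈ G k := ⟨ha, fun u v huv hxuv hle => hl₁ u v huv hxuv (hle.trans hk.le)⟩
  obtain ⟨r₀, hr₀, hrG⟩ := hdens k hxG (19 / 20) (by norm_num) (by norm_num)
  obtain ⟨τ₂, hτ₂, hl₂⟩ := hleb (1 / 100 * a / 40) (by positivity)
  obtain ⟨ρ, hρ, hball⟩ := Metric.isOpen_iff.1
    (B.isClosed_postcritical.isOpen_compl.preimage
      (AddCircle.continuous_mk' (1 : ℝ))) x hpcx
  have hk0 : (0 : ℝ) < 1 / (k + 1) := by positivity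
  obtain ⟨α, β, hxαβ, hδ, hcutαβ⟩ := hcut x hxS (fun δ hδ =>
    ⟨B.exists_critPre_of_pos hν hinv (liftMeasure_Ioo_pos hν ha hleb (by linarith)
      ⟨by linarith, le_rfl⟩), B.exists_critPre_of_pos hν hinv (liftMeasure_Ioo_pos hν ha hleb
      (by linarith) ⟨le_rfl, by linarith⟩)⟩)
    (min (min r₀ (ρ / 20)) (min (min (τ₂ / 40) (1 / (k + 1) / 40)) (1 / 40)))
    (by positivity)
  set s := β - α with hs
  have hs0 : 0 < s := by linarith [hxαβ.1, hxαβ.2]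
  simp only [lt_min_iff] at hδ
  obtain ⟨⟨hd1, hd2⟩, ⟨hd3, hd4⟩, hd5⟩ := hδ
  have hs1 : 40 * s < 1 := by linarith
  have hintg : ∫ t in (x - 20 * s)..(x + 20 * s), |density ν t - a| ≤ 1 / 100 * (a * s) := by
    refine (hl₂ _ _ (by linarith) ⟨by linarith, by linarith⟩ (by linarith)).trans ?_
    linarith
  have hpcw : ∀ t ∈ Ioo (x - 20 * s) (x + 20 * s), (t : UnitAddCircle) ∉ B.postcritical := by
    intro t ht
    refine hball ?_
    rw [Metric.mem_ball, Real.dist_eq, abs_lt]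
    constructor <;> linarith [ht.1, ht.2]
  obtain ⟨S, hS, hSM, hfew⟩ := exists_few_visits (B.measurePreserving_f hinv)
    (isOpen_coe_image α β).measurableSet
    (isOpen_coe_image (x - 20 * s) (x + 20 * s)).measurableSet 1000
  obtain ⟨y, hyG, hym, hyS, hyret⟩ := exists_mem_selection (G := G k)
    (Bd := (fun x : ℝ => (x : UnitAddCircle)) ⁻¹' S) hs hs0 hxαβ
    (by convert hrG s hs0 hd1 using 2; ring)
    ((volume_preimage_inter_le hν hs hs0 hs1 hxαβ ha (by norm_num) (by norm_num) hintg hS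
      hSM).trans (ENNReal.ofReal_le_ofReal (by push_cast; linarith)))
    (ae_of_ae_liftMeasure (B.ae_returns hν hinv α β))
  have hyD : y ∈ Ioo α β := ⟨by linarith [hym.1], by linarith [hym.2]⟩
  have hex := hyret hyG.1 hyD
  classical
  set n := Nat.find hex with hn
  obtain ⟨hn1, j, hj⟩ := Nat.find_spec hex
  rw [← hn] at hn1 hj
  obtain ⟨σ, hσ, hest⟩ := B.return_estimate hν hinv hJ hK hcr (M := 1000) hs hs0 hs1 hxαβ ha
    (by norm_num) hintg hpcw hyD hyG (by linarith) hε0.le (by rw [hκ]; norm_num) hn1 hj (by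
      intro u hu
      refine hfew _ hyS u fun i hi => ?_
      obtain ⟨-, hin, hij⟩ := hu i hi
      refine ⟨⟨y, hyD, rfl⟩, fun l hl hli hmem => ?_, ?_⟩
      · rw [B.f_iterate_coe, mem_coe_image_iff] at hmem
        exact Nat.find_min hex (m := l) (by omega) ⟨hl, hmem⟩
      · rw [B.f_iterate_coe, mem_coe_image_iff]
        exact hij)
  rw [hκ] at hest
  have hnot : ∀ t : ℝ, t + j ∈ Ioo (x - 20 * s) (x + 20 * s) →
      (t : UnitAddCircle) ∉ B.postcritical := by
    intro t ht h
    exact hpcw _ ht (by rwa [coe_add_int])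
  refine false_of_return (g := fun t => B.F^[n] t + j) hs hs0 hσ (by norm_num) hym hj hest
    (hcutαβ.imp (fun h e he hmem => hnot _ ?_ (h e he n hn1 j hmem))
      (fun h e he hmem => hnot _ ?_ (h e he n hn1 j hmem)))
  · exact ⟨by linarith [hmem.1, hxαβ.2], by linarith [hmem.2, hxαβ.1]⟩
  · exact ⟨by linarith [hmem.1, hxαβ.2], by linarith [hmem.2, hxαβ.1]⟩

end BimodData

section HyperbolicTimes

variable {X : Type*}

/-- The minimum of `0` and of the sums of `ψ` along the final segments of an orbit. -/
def minSuffix (f : X → X) (ψ : X → ℝ) : ℕ → X → ℝ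
  | 0, _ => 0
  | n + 1, x => min 0 (minSuffix f ψ n x + ψ (f^[n] x))

theorem minSuffix_nonpos (f : X → X) (ψ : X → ℝ) (n : ℕ) (x : X) : minSuffix f ψ n x ≤ 0 := by
  cases n with
  | zero => exact le_rfl
  | succ n => exact min_le_left _ _

theorem minSuffix_le_sum (f : X → X) (ψ : X → ℝ) (x : X) (n : ℕ) :
    ∀ j ≤ n, minSuffix f ψ n x ≤ ∑ i ∈ Finset.Ico j n, ψ (f^[i] x) := by
  induction n with
  | zero => intro j _; simp [minSuffix]
  | succ n ih =>
    intro j hj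
    rcases hj.lt_or_eq with h | h
    · rw [Finset.sum_Ico_succ_top (by omega)]
      exact (min_le_right _ _).trans (add_le_add_left (ih j (by omega)) _)
    · rw [h, Finset.Ico_self, Finset.sum_empty]
      exact minSuffix_nonpos f ψ _ x

variable [MeasurableSpace X] {ν : Measure X} {f : X → X} {ψ : X → ℝ}

theorem integrable_minSuffix (hf : MeasurePreserving f ν ν) (hψ : Integrable ψ ν) (n : ℕ) :
    Integrable (minSuffix f ψ n) ν := by
  induction n with
  | zero => exact integrable_zero X ℝ ν
  | succ n ih =>
    exact (integrable_zero X ℝ ν).inf (ih.add ((hf.iterate n).integrable_comp_of_integrable hψ))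

/-- Points for which all final segments of the orbit up to time `n` have nonnegative sums. -/
def hyperbolicSet (f : X → X) (ψ : X → ℝ) (n : ℕ) : Set X :=
  {x | ∀ j < n, 0 ≤ ∑ i ∈ Finset.Ico j n, ψ (f^[i] x)}

theorem measurableSet_hyperbolicSet (hf : Measurable f) (hψ : Measurable ψ) (n : ℕ) :
    MeasurableSet (hyperbolicSet f ψ n) := by
  have : hyperbolicSet f ψ n = ⋂ j, ⋂ _ : j < n, {x | 0 ≤ ∑ i ∈ Finset.Ico j n, ψ (f^[i] x)} := by
    ext x; simp [hyperbolicSet]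
  rw [this]
  exact MeasurableSet.iInter fun j => MeasurableSet.iInter fun _ =>
    measurableSet_le measurable_const
      (Finset.measurable_sum _ fun i _ => hψ.comp (hf.iterate i))

variable [IsProbabilityMeasure ν]

theorem integral_minSuffix_succ (hf : MeasurePreserving f ν ν) (hψm : Measurable ψ)
    (hψ : Integrable ψ ν) {C : ℝ} (hC0 : 0 ≤ C) (hC : ∀ x, ψ x ≤ C) (n : ℕ) :
    (∫ x, minSuffix f ψ n x ∂ν) + ∫ x, ψ x ∂ν ≤
      (∫ x, minSuffix f ψ (n + 1) x ∂ν) + C * ν.real (hyperbolicSet f ψ (n + 1)) := by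
  have hi : Integrable (fun x => ψ (f^[n] x)) ν :=
    (hf.iterate n).integrable_comp_of_integrable hψ
  have hm := measurableSet_hyperbolicSet hf.measurable hψm (n + 1)
  have h1 : ∫ x, ψ x ∂ν = ∫ x, ψ (f^[n] x) ∂ν := by
    have := (hf.iterate n).map_eq
    conv_lhs => rw [← this]
    rw [integral_map (hf.iterate n).aemeasurable hψm.aestronglyMeasurable]
  have h2 : C * ν.real (hyperbolicSet f ψ (n + 1)) =
      ∫ x, (hyperbolicSet f ψ (n + 1)).indicator (fun _ => C) x ∂ν := by
    rw [integral_indicator_const _ hm, smul_eq_mul, mul_comm]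
  rw [h1, h2, ← integral_add (integrable_minSuffix hf hψ n) hi,
    ← integral_add (integrable_minSuffix hf hψ (n + 1))
      ((integrable_const C).indicator hm)]
  refine integral_mono ((integrable_minSuffix hf hψ n).add hi)
    ((integrable_minSuffix hf hψ (n + 1)).add ((integrable_const C).indicator hm)) fun x => ?_
  dsimp only
  by_cases hx : minSuffix f ψ n x + ψ (f^[n] x) ≤ 0
  · rw [minSuffix, min_eq_right hx]
    have : 0 ≤ (hyperbolicSet f ψ (n + 1)).indicator (fun _ => C) x :=
      indicator_nonneg (fun _ _ => hC0) x
    linarith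
  · push Not at hx
    rw [minSuffix, min_eq_left hx.le, indicator_of_mem]
    · linarith [minSuffix_nonpos f ψ n x, hC (f^[n] x)]
    · intro j hj
      rw [Finset.sum_Ico_succ_top (by omega)]
      linarith [minSuffix_le_sum f ψ x n j (by omega)]

/-- A positive proportion of points has a hyperbolic time at infinitely many moments. -/
theorem exists_frequently_hyperbolicSet (hf : MeasurePreserving f ν ν) (hψm : Measurable ψ)
    (hψ : Integrable ψ ν) (hpos : 0 < ∫ x, ψ x ∂ν) {C : ℝ} (hC : ∀ x, ψ x ≤ C) :
    ∃ θ > 0, ∃ᶠ n in atTop, θ ≤ ν.real (hyperbolicSet f ψ n) := by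
  have hC0 : 0 < C := by
    refine hpos.trans_le ((integral_mono hψ (integrable_const C) hC).trans ?_)
    simp
  set I := ∫ x, ψ x ∂ν with hI
  refine ⟨I / (2 * C), by positivity, fun hev => ?_⟩
  have hev' : ∀ᶠ n in atTop, ν.real (hyperbolicSet f ψ (n + 1)) < I / (2 * C) := by
    have := (tendsto_add_atTop_nat 1).eventually hev
    filter_upwards [this] with n hn
    exact not_le.1 hn
  obtain ⟨n₀, hn₀⟩ := eventually_atTop.1 hev'
  have key : ∀ N : ℕ, N * (I / 2) ≤ (∫ x, minSuffix f ψ (n₀ + N) x ∂ν) -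
      ∫ x, minSuffix f ψ n₀ x ∂ν := by
    intro N
    induction N with
    | zero => simp
    | succ N ih =>
      have h1 := integral_minSuffix_succ hf hψm hψ hC0.le hC (n₀ + N)
      have h2 : C * ν.real (hyperbolicSet f ψ (n₀ + N + 1)) ≤ I / 2 := by
        have := mul_le_mul_of_nonneg_left (hn₀ (n₀ + N) (by omega)).le hC0.le
        refine this.trans_eq ?_
        field_simp
      rw [← hI] at h1
      push_cast
      rw [← add_assoc n₀ N 1]
      linarith
  obtain ⟨N, hN⟩ := exists_nat_gt (-(∫ x, minSuffix f ψ n₀ x ∂ν) / (I / 2))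
  rw [div_lt_iff₀ (by positivity)] at hN
  have h3 : ∫ x, minSuffix f ψ (n₀ + N) x ∂ν ≤ 0 :=
    integral_nonpos fun x => minSuffix_nonpos f ψ _ x
  linarith [key N]

/-- Tail estimate for the values of an integrable function along orbits. -/
theorem exists_slow_bound (hf : MeasurePreserving f ν ν) (hψm : Measurable ψ)
    (hψ : Integrable ψ ν) {b θ : ℝ} (hb : 0 < b) (hθ : 0 < θ) :
    ∃ J : ℕ, ∀ n : ℕ, ν {x | ∃ i < n, ψ (f^[i] x) < -(b * ((n - i : ℕ) + J))} ≤
      ENNReal.ofReal θ := by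
  have hX : Integrable (fun x => |ψ x| / b) ν := hψ.abs.div_const b
  have hsum := @ProbabilityTheory.tsum_prob_mem_Ioi_lt_top X ⟨ν⟩ ‹_› _ hX
    (fun x => div_nonneg (abs_nonneg _) hb.le)
  have ht := ENNReal.tendsto_sum_nat_add _ hsum.ne
  obtain ⟨J, hJ⟩ := (ht.eventually (gt_mem_nhds (ENNReal.ofReal_pos.2 hθ))).exists
  refine ⟨J, fun n => ?_⟩
  have hsub : {x | ∃ i < n, ψ (f^[i] x) < -(b * ((n - i : ℕ) + J))} ⊆
      ⋃ i ∈ Finset.range n, f^[i] ⁻¹' {x | |ψ x| / b ∈ Ioi (((n - i : ℕ) + J : ℕ) : ℝ)} := by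
    rintro x ⟨i, hi, hx⟩
    simp only [mem_iUnion, Finset.mem_range]
    refine ⟨i, hi, ?_⟩
    show ((n - i + J : ℕ) : ℝ) < |ψ (f^[i] x)| / b
    rw [lt_div_iff₀ hb]
    push_cast
    linarith [neg_le_abs (ψ (f^[i] x))]
  have hmeas : ∀ k : ℕ, MeasurableSet {x | |ψ x| / b ∈ Ioi (k : ℝ)} := fun k =>
    (hψm.abs.div_const b) measurableSet_Ioi
  refine (measure_mono hsub).trans ((measure_biUnion_finset_le _ _).trans ?_)
  refine le_trans ?_ hJ.le
  have h1 : ∀ i, ν (f^[i] ⁻¹' {x | |ψ x| / b ∈ Ioi (((n - i : ℕ) + J : ℕ) : ℝ)}) =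
      ν {x | |ψ x| / b ∈ Ioi (((n - i : ℕ) + J : ℕ) : ℝ)} := fun i =>
    (hf.iterate i).measure_preimage (hmeas _).nullMeasurableSet
  simp only [h1]
  have h2 : ∑ i ∈ Finset.range n, ν {x | |ψ x| / b ∈ Ioi (((n - i : ℕ) + J : ℕ) : ℝ)} ≤
      ∑ i ∈ Finset.range (n + 1), ν {x | |ψ x| / b ∈ Ioi ((i + J : ℕ) : ℝ)} := by
    rw [← Finset.sum_range_reflect (fun i => ν {x | |ψ x| / b ∈ Ioi ((i + J : ℕ) : ℝ)}),
      Finset.sum_range_succ]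
    simp only [Nat.add_sub_cancel]
    exact le_self_add
  exact h2.trans (ENNReal.sum_le_tsum _)

end HyperbolicTimes

theorem sum_pow_sub_le {q : ℝ} (hq0 : 0 ≤ q) (hq1 : q < 1) {i n : ℕ} (hi : i ≤ n) :
    ∑ k ∈ Finset.range i, q ^ (n - k) ≤ 1 / (1 - q) := by
  have h1 : ∑ k ∈ Finset.range i, q ^ (n - k) ≤ ∑ k ∈ Finset.range (n + 1), q ^ (n - k) :=
    Finset.sum_le_sum_of_subset_of_nonneg (Finset.range_subset_range.2 (by omega))
      fun k _ _ => pow_nonneg hq0 _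
  refine h1.trans ?_
  have h2 : ∑ k ∈ Finset.range (n + 1), q ^ (n - k) = ∑ k ∈ Finset.range (n + 1), q ^ k := by
    rw [← Finset.sum_range_reflect (fun k => q ^ k)]
    simp
  rw [h2, one_div, ← tsum_geometric_of_lt_one hq0 hq1]
  exact (summable_geometric_of_lt_one hq0 hq1).sum_le_tsum _ fun k _ => pow_nonneg hq0 _

namespace BimodData

variable (B : BimodData)

theorem exists_lipschitz_deriv : ∃ Λ > 0, ∀ x y, |deriv B.F x - deriv B.F y| ≤ Λ * |x - y| := by
  have hC1 : ContDiff ℝ 1 (deriv B.F) := by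
    have := B.hC2
    rw [show (2 : WithTop ℕ∞) = 1 + 1 by norm_num, contDiff_succ_iff_deriv] at this
    exact this.2.2
  have hper : Function.Periodic (deriv (deriv B.F)) 1 := by
    intro x
    have h1 : (fun y => deriv B.F (y + 1)) = deriv B.F := by
      funext y; simpa using B.deriv_add_int y 1
    rw [← deriv_comp_add_const, h1]
  obtain ⟨M, hM⟩ := (isCompact_Icc (a := (0 : ℝ)) (b := 1)).exists_bound_of_continuousOn
    (hC1.continuous_deriv le_rfl).continuousOn
  refine ⟨max M 1, by positivity, fun x y => ?_⟩
  have hb : ∀ z, ‖deriv (deriv B.F) z‖ ≤ max M 1 := by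
    intro z
    obtain ⟨w, hw, hzw⟩ := hper.exists_mem_Ico₀ one_pos z
    rw [hzw]
    exact (hM w ⟨hw.1, hw.2.le⟩).trans (le_max_left _ _)
  exact Convex.norm_image_sub_le_of_norm_deriv_le
    (fun z _ => (hC1.differentiable one_ne_zero) z) (fun z _ => hb z) convex_univ (mem_univ y)
    (mem_univ x)

/-- Bounded distortion at hyperbolic times. -/
theorem exists_distortion_radius {b c : ℝ} (hbc : b < c) (J : ℕ) :
    ∃ r > 0, ∀ (n : ℕ) (x : ℝ),
      (∀ i < n, Real.exp (c * (n - i : ℕ)) ≤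
        |∏ k ∈ Finset.Ico i n, deriv B.F (B.F^[k] x)|) →
      (∀ i < n, Real.exp (-(b * ((n - i : ℕ) + J))) ≤ |deriv B.F (B.F^[i] x)|) →
      ∀ t, |t - x| * |∏ k ∈ Finset.range n, deriv B.F (B.F^[k] x)| ≤ r →
        |∏ k ∈ Finset.range n, deriv B.F (B.F^[k] x)| / 2 ≤ |deriv (B.F^[n]) t| ∧
        |deriv (B.F^[n]) t| ≤ 2 * |∏ k ∈ Finset.range n, deriv B.F (B.F^[k] x)| := by
  obtain ⟨Λ, hΛ, hlip⟩ := B.exists_lipschitz_deriv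
  set q := Real.exp (-(c - b)) with hq
  have hq0 : 0 < q := Real.exp_pos _
  have hq1 : q < 1 := by rw [hq, Real.exp_lt_one_iff]; linarith
  set r := (1 - q) * Real.exp (-(b * J)) / (8 * Λ) with hr
  have h1q : 0 < 1 - q := by linarith
  refine ⟨r, by positivity, fun n x hexp hslow => ?_⟩
  set p : ℕ → ℝ := fun i => |∏ k ∈ Finset.range i, deriv B.F (B.F^[k] x)| with hp
  have hp0 : ∀ i, 0 ≤ p i := fun i => abs_nonneg _
  have hpsucc : ∀ i, p (i + 1) = p i * |deriv B.F (B.F^[i] x)| := by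
    intro i; simp only [hp]; rw [Finset.prod_range_succ, abs_mul]
  have hpn : ∀ i < n, p i * Real.exp (c * (n - i : ℕ)) ≤ p n := by
    intro i hi
    refine (mul_le_mul_of_nonneg_left (hexp i hi) (hp0 i)).trans_eq ?_
    simp only [hp]
    rw [← abs_mul, Finset.prod_range_mul_prod_Ico _ hi.le]
  set s : ℕ → ℝ := fun i => (1 - q) / 4 * ∑ k ∈ Finset.range i, q ^ (n - k) with hs
  have hs0 : ∀ i, 0 ≤ s i := fun i => by
    simp only [hs]
    exact mul_nonneg (by linarith) (Finset.sum_nonneg fun k _ => by positivity)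
  have hs1 : ∀ i ≤ n, s i ≤ 1 / 4 := by
    intro i hi
    have := mul_le_mul_of_nonneg_left (sum_pow_sub_le hq0.le hq1 hi)
      (show 0 ≤ (1 - q) / 4 by linarith)
    refine this.trans_eq ?_
    field_simp
  have hexp4 : Real.exp (1 / 4) ≤ 2 := by
    have h1 := Real.add_one_le_exp (-(1 / 4) : ℝ)
    rw [Real.exp_neg] at h1
    have h2 := Real.exp_pos (1 / 4)
    have h3 : (1 / 2 : ℝ) ≤ (Real.exp (1 / 4))⁻¹ := by linarith
    have h4 := (le_inv_comm₀ (by norm_num) h2).1 h3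
    linarith
  have key : ∀ i ≤ n, ∀ t, |t - x| * p n ≤ r →
      p i * (1 - s i) ≤ |∏ k ∈ Finset.range i, deriv B.F (B.F^[k] t)| ∧
      |∏ k ∈ Finset.range i, deriv B.F (B.F^[k] t)| ≤ p i * Real.exp (s i) := by
    intro i
    induction i with
    | zero => intro _ t _; simp [hp, hs]
    | succ i ih =>
      intro hi t ht
      obtain ⟨l1, l2⟩ := ih (by omega) t ht
      have hi' : i < n := by omega
      have hdist : |B.F^[i] t - B.F^[i] x| ≤ 2 * p i * |t - x| := by
        refine Convex.norm_image_sub_le_of_norm_hasDerivWithin_le (f := B.F^[i])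
          (s := Icc (x - |t - x|) (x + |t - x|))
          (f' := fun z => ∏ k ∈ Finset.range i, deriv B.F (B.F^[k] z))
          (fun z _ => (B.hasDerivAt_iterate i z).hasDerivWithinAt) (fun z hz => ?_)
          (convex_Icc _ _) ⟨by linarith [abs_nonneg (t - x)], by linarith [abs_nonneg (t - x)]⟩
          ⟨by linarith [neg_abs_le (t - x)], by linarith [le_abs_self (t - x)]⟩
        have hz' : |z - x| ≤ |t - x| := abs_le.2 ⟨by linarith [hz.1], by linarith [hz.2]⟩
        have h1 := (ih (by omega) z ((mul_le_mul_of_nonneg_right hz' (hp0 n)).trans ht)).2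
        refine h1.trans ?_
        rw [mul_comm 2]
        exact mul_le_mul_of_nonneg_left
          ((Real.exp_le_exp.2 (hs1 i hi'.le)).trans hexp4) (hp0 i)
      have hη : |deriv B.F (B.F^[i] t) - deriv B.F (B.F^[i] x)| ≤
          (1 - q) / 4 * q ^ (n - i) * |deriv B.F (B.F^[i] x)| := by
        have e1 : p i * |t - x| ≤ r * Real.exp (-(c * (n - i : ℕ))) := by
          rw [Real.exp_neg, ← div_eq_mul_inv, le_div_iff₀ (Real.exp_pos _)]
          refine le_trans ?_ ht
          have := mul_le_mul_of_nonneg_left (hpn i hi') (abs_nonneg (t - x))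
          linarith
        have e2 : Real.exp (-(c * (n - i : ℕ))) =
            Real.exp (b * J) * q ^ (n - i) * Real.exp (-(b * ((n - i : ℕ) + J))) := by
          rw [hq, ← Real.exp_nat_mul, ← Real.exp_add, ← Real.exp_add]
          congr 1; ring
        have e3 : Λ * (2 * (r * Real.exp (-(c * (n - i : ℕ))))) =
            (1 - q) / 4 * q ^ (n - i) * Real.exp (-(b * ((n - i : ℕ) + J))) := by
          rw [e2, hr, Real.exp_neg (b * J)]
          have := (Real.exp_pos (b * J)).ne'
          field_simp
          ring
        have e4 := mul_le_mul_of_nonneg_left (hslow i hi')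
          (show 0 ≤ (1 - q) / 4 * q ^ (n - i) by positivity)
        refine (hlip _ _).trans (le_trans ?_ e4)
        rw [← e3]
        refine mul_le_mul_of_nonneg_left ?_ hΛ.le
        linarith
      set η := (1 - q) / 4 * q ^ (n - i) with hηdef
      have hη0 : 0 ≤ η := by positivity
      have hss : s (i + 1) = s i + η := by
        simp only [hs, hηdef]; rw [Finset.sum_range_succ, mul_add]
      rw [Finset.prod_range_succ, abs_mul, hpsucc, hss]
      have hd0 := abs_nonneg (deriv B.F (B.F^[i] x))
      have hu : |deriv B.F (B.F^[i] t)| ≤ |deriv B.F (B.F^[i] x)| * (1 + η) := by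
        have := abs_sub_abs_le_abs_sub (deriv B.F (B.F^[i] t)) (deriv B.F (B.F^[i] x))
        linarith
      have hl : |deriv B.F (B.F^[i] x)| * (1 - η) ≤ |deriv B.F (B.F^[i] t)| := by
        have := abs_sub_abs_le_abs_sub (deriv B.F (B.F^[i] x)) (deriv B.F (B.F^[i] t))
        rw [abs_sub_comm (deriv B.F (B.F^[i] x))] at this
        linarith
      have hη1 : s i + η ≤ 1 / 4 := hss ▸ hs1 (i + 1) hi
      have hsi := hs0 i
      constructor
      · have h1 : p i * (1 - s i) * (|deriv B.F (B.F^[i] x)| * (1 - η)) ≤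
            |∏ k ∈ Finset.range i, deriv B.F (B.F^[k] t)| * |deriv B.F (B.F^[i] t)| :=
          mul_le_mul l1 hl (mul_nonneg hd0 (by linarith)) (abs_nonneg _)
        refine le_trans ?_ h1
        have h2 : 0 ≤ p i * |deriv B.F (B.F^[i] x)| * (s i * η) := by
          have := hp0 i
          positivity
        linarith
      · have h1 := mul_le_mul l2 hu (abs_nonneg _) (mul_nonneg (hp0 i) (Real.exp_pos _).le)
        refine h1.trans ?_
        rw [Real.exp_add]
        have h2 : 1 + η ≤ Real.exp η := by linarith [Real.add_one_le_exp η]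
        have h3 := mul_le_mul_of_nonneg_left h2
          (show 0 ≤ p i * |deriv B.F (B.F^[i] x)| * Real.exp (s i) by
            have := hp0 i
            positivity)
        linarith
  intro t ht
  obtain ⟨l1, l2⟩ := key n le_rfl t ht
  rw [(B.hasDerivAt_iterate n t).deriv]
  have h1 := hs1 n le_rfl
  refine ⟨le_trans ?_ l1, l2.trans ?_⟩
  · rw [div_eq_mul_inv]
    exact mul_le_mul_of_nonneg_left (by linarith) (hp0 n)
  · rw [mul_comm]
    exact mul_le_mul_of_nonneg_right ((Real.exp_le_exp.2 h1).trans hexp4) (hp0 n)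

end BimodData

theorem frequently_ae_frequently_mem {X : Type*} [MeasurableSpace X] {ν : Measure X}
    [IsFiniteMeasure ν] {s : ℕ → Set X} (hs : ∀ n, MeasurableSet (s n)) {θ : ENNReal}
    (hθ : 0 < θ) (h : ∃ᶠ n in atTop, θ ≤ ν (s n)) :
    ∃ᶠ x in ae ν, ∃ᶠ n in atTop, x ∈ s n := by
  intro hae
  set V : ℕ → Set X := fun N => ⋃ n, ⋃ _ : N ≤ n, s n with hV
  have hVm : ∀ N, MeasurableSet (V N) := fun N =>
    MeasurableSet.iUnion fun n => MeasurableSet.iUnion fun _ => hs n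
  have hanti : Antitone V := by
    intro N N' hN x hx
    simp only [hV, mem_iUnion] at hx ⊢
    obtain ⟨n, hn, hx⟩ := hx
    exact ⟨n, hN.trans hn, hx⟩
  have ht := tendsto_measure_iInter_atTop (μ := ν) (fun N => (hVm N).nullMeasurableSet) hanti
    ⟨0, measure_ne_top _ _⟩
  have h0 : ν (⋂ N, V N) = 0 := by
    refine measure_mono_null (fun x hx => ?_) (ae_iff.1 hae)
    simp only [mem_ofPred_eq, not_not]
    rw [frequently_atTop]
    intro N
    have := mem_iInter.1 hx N
    simp only [hV, mem_iUnion] at this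
    obtain ⟨n, hn, hx⟩ := this
    exact ⟨n, hn, hx⟩
  rw [h0] at ht
  obtain ⟨N, hN⟩ := eventually_atTop.1 (ht.eventually (gt_mem_nhds hθ))
  obtain ⟨n, hn, hle⟩ := frequently_atTop.1 h N
  have h1 : ν (s n) ≤ ν (V N) := measure_mono fun x hx => by
    simp only [hV, mem_iUnion]; exact ⟨n, hn, hx⟩
  exact absurd (hN N le_rfl) (not_lt.2 (hle.trans h1))

theorem volume_closedBall_diff_le {Q : Set ℝ} (hQ : MeasurableSet Q) {x r ζ : ℝ} (hr : 0 < r)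
    (h : ENNReal.ofReal ((1 - ζ) * (2 * r)) ≤ volume (Q ∩ Metric.closedBall x r)) :
    volume (Metric.closedBall x r \ Q) ≤ ENNReal.ofReal (ζ * (2 * r)) := by
  have h1 := measure_inter_add_sdiff (μ := volume) (Metric.closedBall x r) hQ
  rw [inter_comm, Real.volume_closedBall] at h1
  have hfin : volume (Q ∩ Metric.closedBall x r) ≠ ⊤ := by
    refine (lt_of_le_of_lt ?_ (ENNReal.ofReal_lt_top (r := 2 * r))).ne
    rw [← h1]; exact le_self_add
  have hfin' : volume (Metric.closedBall x r \ Q) ≠ ⊤ := by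
    refine (lt_of_le_of_lt ?_ (ENNReal.ofReal_lt_top (r := 2 * r))).ne
    rw [← h1]; exact le_add_self
  rw [← ENNReal.ofReal_toReal hfin, ← ENNReal.ofReal_toReal hfin',
    ← ENNReal.ofReal_add ENNReal.toReal_nonneg ENNReal.toReal_nonneg,
    ENNReal.ofReal_eq_ofReal_iff (add_nonneg ENNReal.toReal_nonneg ENNReal.toReal_nonneg)
      (by linarith)] at h1
  rw [← ENNReal.ofReal_toReal hfin, ENNReal.ofReal_le_ofReal_iff ENNReal.toReal_nonneg] at h
  rw [← ENNReal.ofReal_toReal hfin']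
  refine ENNReal.ofReal_le_ofReal ?_
  linarith

/-- A map with large derivative on an interval covers a neighbourhood of the image of the centre. -/
theorem Ioo_subset_image_Icc {g : ℝ → ℝ} (hg : Differentiable ℝ g) {x ρ P r : ℝ} (hρ : 0 < ρ)
    (hPρ : P * ρ = r)
    (hm : StrictMonoOn g (Icc (x - ρ) (x + ρ)) ∨ StrictAntiOn g (Icc (x - ρ) (x + ρ)))
    (hd : ∀ t ∈ Icc (x - ρ) (x + ρ), P / 2 ≤ |deriv g t|) :
    Ioo (g x - r / 2) (g x + r / 2) ⊆ g '' Icc (x - ρ) (x + ρ) := by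
  have hx : x ∈ Icc (x - ρ) (x + ρ) := ⟨by linarith, by linarith⟩
  have hl : x - ρ ∈ Icc (x - ρ) (x + ρ) := ⟨le_rfl, by linarith⟩
  have hu : x + ρ ∈ Icc (x - ρ) (x + ρ) := ⟨by linarith, le_rfl⟩
  have key : ∀ u v, u < v → u ∈ Icc (x - ρ) (x + ρ) → v ∈ Icc (x - ρ) (x + ρ) → v - u = ρ →
      r / 2 ≤ |g v - g u| := by
    intro u v huv hu hv hvu
    obtain ⟨t, ht, hs⟩ := exists_deriv_eq_slope g huv hg.continuous.continuousOn
      hg.differentiableOn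
    have h1 := hd t ⟨hu.1.trans ht.1.le, ht.2.le.trans hv.2⟩
    rw [hs, hvu, abs_div, abs_of_pos hρ, le_div_iff₀ hρ] at h1
    linarith
  have k1 := key (x - ρ) x (by linarith) hl hx (by ring)
  have k2 := key x (x + ρ) (by linarith) hx hu (by ring)
  rcases hm with hm | hm
  · have m1 := hm hl hx (by linarith)
    have m2 := hm hx hu (by linarith)
    rw [abs_of_pos (by linarith)] at k1 k2
    exact (Ioo_subset_Icc_self.trans (Icc_subset_Icc (by linarith) (by linarith))).trans
      (intermediate_value_Icc (by linarith) hg.continuous.continuousOn)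
  · have m1 := hm hl hx (by linarith)
    have m2 := hm hx hu (by linarith)
    rw [abs_of_neg (by linarith)] at k1 k2
    exact (Ioo_subset_Icc_self.trans (Icc_subset_Icc (by linarith) (by linarith))).trans
      (intermediate_value_Icc' (by linarith) hg.continuous.continuousOn)

namespace BimodData

variable (B : BimodData)

theorem volume_diff_le_at_hyperbolic_time {Q : Set ℝ} (hQ : ∀ t ∈ Q, B.F t ∈ Q) {n : ℕ}
    {x r P e : ℝ} (hr : 0 < r) (hP : 0 < P)
    (hd : ∀ t, |t - x| * P ≤ r → P / 2 ≤ |deriv (B.F^[n]) t| ∧ |deriv (B.F^[n]) t| ≤ 2 * P)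
    (hvol : volume (Metric.closedBall x (r / P) \ Q) ≤ ENNReal.ofReal e) :
    volume (Ioo (B.F^[n] x - r / 2) (B.F^[n] x + r / 2) \ Q) ≤ ENNReal.ofReal (2 * P * e) := by
  set ρ := r / P with hρ
  have hρ0 : 0 < ρ := by positivity
  have hPρ : P * ρ = r := by rw [hρ]; field_simp
  have hdiff : Differentiable ℝ (B.F^[n]) := (B.contDiff_iterate n).differentiable (by norm_num)
  have hd' : ∀ t ∈ Icc (x - ρ) (x + ρ),
      P / 2 ≤ |deriv (B.F^[n]) t| ∧ |deriv (B.F^[n]) t| ≤ 2 * P := by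
    intro t ht
    refine hd t ?_
    have : |t - x| ≤ ρ := abs_le.2 ⟨by linarith [ht.1], by linarith [ht.2]⟩
    calc |t - x| * P ≤ ρ * P := mul_le_mul_of_nonneg_right this hP.le
      _ = r := by rw [mul_comm]; exact hPρ
  have hm := B.strictMonoOn_or_strictAntiOn_iterate (a := x - ρ) (d := x + ρ) (n := n) (by
    intro i hi t ht h0
    have h1 := (hd' t (Ioo_subset_Icc_self ht)).1
    rw [(B.hasDerivAt_iterate n t).deriv, Finset.prod_eq_zero (Finset.mem_range.2 hi) h0,
      abs_zero] at h1
    linarith)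
  have hcov := Ioo_subset_image_Icc hdiff hρ0 hPρ hm fun t ht => (hd' t ht).1
  have hQn : ∀ t ∈ Q, B.F^[n] t ∈ Q := fun t ht =>
    (MapsTo.iterate (s := Q) (f := B.F) hQ n) ht
  rw [Real.closedBall_eq_Icc] at hvol
  have hsub : Ioo (B.F^[n] x - r / 2) (B.F^[n] x + r / 2) \ Q ⊆
      B.F^[n] '' (Icc (x - ρ) (x + ρ) \ Q) := by
    rintro w ⟨hw, hwQ⟩
    obtain ⟨t, ht, rfl⟩ := hcov hw
    exact ⟨t, ⟨ht, fun h => hwQ (hQn t h)⟩, rfl⟩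
  refine (measure_mono hsub).trans (volume_image_le_of_lipschitz (by positivity) ?_ hvol)
  intro u hu v hv huv
  have := Convex.norm_image_sub_le_of_norm_deriv_le (f := B.F^[n])
    (fun z _ => hdiff z) (fun z hz => (hd' z hz).2) (convex_Icc _ _) hu.1 hv.1
  rwa [Real.norm_eq_abs, Real.norm_eq_abs, abs_of_pos (sub_pos.2 huv)] at this

/-- Points in the hyperbolic set satisfy the hypotheses of the distortion estimate. -/
theorem exp_le_of_mem_hyperbolicSet {c : ℝ} {n : ℕ} {x : ℝ}
    (hne : ∀ i, deriv B.F (B.F^[i] x) ≠ 0)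
    (hx : (x : UnitAddCircle) ∈ hyperbolicSet B.f (fun y => Real.log |B.Df y| - c) n) :
    ∀ i < n, Real.exp (c * (n - i : ℕ)) ≤ |∏ k ∈ Finset.Ico i n, deriv B.F (B.F^[k] x)| := by
  intro i hi
  have h1 := hx i hi
  simp only [B.f_iterate_coe, B.Df_coe] at h1
  rw [Finset.sum_sub_distrib, Finset.sum_const, Nat.card_Ico, nsmul_eq_mul] at h1
  rw [Finset.abs_prod, ← Real.le_log_iff_exp_le (Finset.prod_pos fun k _ => abs_pos.2 (hne k)),
    Real.log_prod fun k _ => (abs_pos.2 (hne k)).ne']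
  linarith

end BimodData

namespace BimodData

variable (B : BimodData)

/-- Hyperbolic times with slow approach to the critical set occur infinitely often on a set of
positive measure. -/
theorem exists_frequently_good_times {ν : Measure UnitAddCircle} [IsProbabilityMeasure ν]
    (hν : ν ≪ volume) (hinv : Measure.map B.f ν = ν) :
    ∃ r > 0, ∃ c > 0, ∃ᶠ x in ae (liftMeasure ν), ∃ᶠ n : ℕ in atTop, ∃ P > 0,
      Real.exp (c * n) ≤ P ∧ ∀ t, |t - x| * P ≤ r →
        P / 2 ≤ |deriv (B.F^[n]) t| ∧ |deriv (B.F^[n]) t| ≤ 2 * P := by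
  obtain ⟨hLi, -, -⟩ := B.integrable_log_Df hν hinv
  have hpos := B.integral_log_Df_pos hν hinv
  have hf := B.measurePreserving_f hinv
  set L : UnitAddCircle → ℝ := fun y => Real.log |B.Df y| with hL
  have hLm : Measurable L := Real.measurable_log.comp B.continuous_Df.abs.measurable
  set c := (∫ y, L y ∂ν) / 2 with hc
  have hc0 : 0 < c := half_pos hpos
  obtain ⟨M, hM0, hM⟩ := B.exists_deriv_bound
  have hψpos : 0 < ∫ y, (L y - c) ∂ν := by
    rw [integral_sub hLi (integrable_const c)]
    simp only [integral_const, probReal_univ, smul_eq_mul, one_mul]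
    linarith
  obtain ⟨θ, hθ, hfreq⟩ := exists_frequently_hyperbolicSet (ψ := fun y => L y - c) hf
    (hLm.sub_const c) (hLi.sub (integrable_const c)) hψpos (C := M) (fun y => by
      obtain ⟨x, rfl⟩ := exists_coe_eq y
      have h1 := Real.log_le_self (abs_nonneg (deriv B.F x))
      simp only [hL, B.Df_coe]
      linarith [hM x])
  obtain ⟨J, hJ⟩ := exists_slow_bound (ψ := L) hf hLm hLi (half_pos hc0) (half_pos hθ)
  obtain ⟨r, hr, hdist⟩ := B.exists_distortion_radius (half_lt_self hc0) J
  refine ⟨r, hr, c, hc0, ?_⟩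
  set Bd : ℕ → Set UnitAddCircle := fun n =>
    {x | ∃ i < n, L (B.f^[i] x) < -(c / 2 * ((n - i : ℕ) + J))} with hBd
  have hBdm : ∀ n, MeasurableSet (Bd n) := by
    intro n
    have : Bd n = ⋃ i, ⋃ _ : i < n, {x | L (B.f^[i] x) < -(c / 2 * ((n - i : ℕ) + J))} := by
      ext x; simp [hBd]
    rw [this]
    exact MeasurableSet.iUnion fun i => MeasurableSet.iUnion fun _ =>
      measurableSet_lt (hLm.comp (hf.measurable.iterate i)) measurable_const
  set W : ℕ → Set UnitAddCircle := fun n => hyperbolicSet B.f (fun y => L y - c) n \ Bd n with hW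
  have hWm : ∀ n, MeasurableSet (W n) := fun n =>
    (measurableSet_hyperbolicSet hf.measurable (hLm.sub_const c) n).diff (hBdm n)
  have hlift := isCircleLift_liftMeasure hν
  have hWfreq : ∃ᶠ n in atTop, ENNReal.ofReal (θ / 2) ≤
      (liftMeasure ν).restrict (Ioc 0 (0 + 1)) ((fun x : ℝ => (x : UnitAddCircle)) ⁻¹' W n) := by
    refine hfreq.mono fun n hn => ?_
    rw [Measure.restrict_apply (measurable_coe_circle (hWm n)), ← hlift 0 _ (hWm n)]
    refine le_trans ?_ le_measure_sdiff
    refine ENNReal.le_sub_of_add_le_right (measure_ne_top _ _) ?_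
    refine (add_le_add_right (hJ n) _).trans ?_
    rw [← ENNReal.ofReal_add (by positivity) (by positivity), add_halves,
      ← ENNReal.ofReal_toReal (measure_ne_top ν _)]
    exact ENNReal.ofReal_le_ofReal hn
  have : IsFiniteMeasure ((liftMeasure ν).restrict (Ioc 0 (0 + 1))) :=
    ⟨by rw [Measure.restrict_apply_univ]; exact liftMeasure_Ioc_lt_top hν _ _⟩
  have hx := frequently_ae_frequently_mem
    (s := fun n => (fun x : ℝ => (x : UnitAddCircle)) ⁻¹' W n) (fun n => measurable_coe_circle (hWm n))
    (ENNReal.ofReal_pos.2 (half_pos hθ)) hWfreq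
  have hx' : ∃ᶠ x : ℝ in ae (liftMeasure ν), ∃ᶠ n in atTop, (x : UnitAddCircle) ∈ W n :=
    hx.filter_mono (ae_mono Measure.restrict_le_self)
  have hne : ∀ᵐ x ∂(liftMeasure ν), ∀ i, deriv B.F (B.F^[i] x) ≠ 0 := by
    have h1 : ∀ᵐ y ∂ν, ∀ i, B.Df (B.f^[i] y) ≠ 0 := by
      rw [ae_all_iff]
      intro i
      exact (hf.iterate i).quasiMeasurePreserving.ae (B.ae_Df_ne_zero hν)
    filter_upwards [hlift.ae_coe h1] with x hx i
    simpa only [B.f_iterate_coe, B.Df_coe] using hx i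
  refine (hx'.and_eventually hne).mono ?_
  rintro x ⟨hxW, hxne⟩
  refine (hxW.and_eventually (eventually_ge_atTop 1)).mono ?_
  rintro n ⟨⟨hn1, hn2⟩, hn0⟩
  have hexp := B.exp_le_of_mem_hyperbolicSet hxne hn1
  refine ⟨|∏ k ∈ Finset.range n, deriv B.F (B.F^[k] x)|,
    abs_pos.2 (Finset.prod_ne_zero_iff.2 fun k _ => hxne k), ?_, hdist n x hexp ?_⟩
  · have := hexp 0 hn0
    rwa [Nat.sub_zero, Nat.Ico_zero_eq_range] at this
  · intro i hi
    have h1 : ¬ L (B.f^[i] (x : UnitAddCircle)) < -(c / 2 * ((n - i : ℕ) + J)) :=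
      fun h => hn2 ⟨i, hi, h⟩
    rw [B.f_iterate_coe, hL] at h1
    simp only [B.Df_coe] at h1
    exact (Real.le_log_iff_exp_le (abs_pos.2 (hxne i))).1 (not_lt.1 h1)

theorem volume_Ioo_diff_add_int {Q : Set ℝ} (hQ : ∀ (t : ℝ) (j : ℤ), t + j ∈ Q ↔ t ∈ Q)
    (u v : ℝ) (j : ℤ) : volume (Ioo (u + j) (v + j) \ Q) = volume (Ioo u v \ Q) := by
  rw [← measure_preimage_add_right volume (j : ℝ) (Ioo (u + j) (v + j) \ Q)]
  congr 1
  ext t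
  simp [hQ]

/-- Forward invariant sets of full measure contain an interval modulo null sets. -/
theorem exists_interval_of_forward_invariant {ν : Measure UnitAddCircle} [IsProbabilityMeasure ν]
    (hν : ν ≪ volume) (hinv : Measure.map B.f ν = ν) {E : Set UnitAddCircle}
    (hE : MeasurableSet E) (hEf : E ⊆ B.f ⁻¹' E) (hE1 : ∀ᵐ y ∂ν, y ∈ E) :
    ∃ a b : ℝ, a < b ∧ volume (Ioo a b \ (fun x : ℝ => (x : UnitAddCircle)) ⁻¹' E) = 0 := by
  set Q : Set ℝ := (fun x : ℝ => (x : UnitAddCircle)) ⁻¹' E with hQ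
  have hQm : MeasurableSet Q := measurable_coe_circle hE
  have hQint : ∀ (t : ℝ) (j : ℤ), t + j ∈ Q ↔ t ∈ Q := by
    intro t j
    simp only [hQ, mem_preimage, coe_add_int]
  have hQF : ∀ t ∈ Q, B.F t ∈ Q := by
    intro t ht
    have := hEf ht
    rwa [mem_preimage, B.hf] at this
  obtain ⟨r, hr, c, hc, hfreq⟩ := B.exists_frequently_good_times hν hinv
  obtain ⟨x, hx, hxQ, hdens⟩ := (hfreq.and_eventually
    (((isCircleLift_liftMeasure hν).ae_coe hE1).and
      ((liftMeasure_ac ν).ae_le (ae_mem_imp_measure_closedBall Q)))).exists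
  have key : ∀ m : ℕ, ∃ y ∈ Icc (0 : ℝ) 1,
      volume (Ioo (y - r / 2) (y + r / 2) \ Q) ≤ ENNReal.ofReal (4 * r * (1 / (m + 1))) := by
    intro m
    have hm : (0 : ℝ) < 1 / (m + 1) := by positivity
    have hm1 : (1 : ℝ) / (m + 1) ≤ 1 := by
      rw [div_le_one (by positivity)]
      linarith [(Nat.cast_nonneg m : (0 : ℝ) ≤ m)]
    obtain ⟨r₀, hr₀, hr₀'⟩ := hdens hxQ (1 - 1 / (m + 1)) (by linarith) (by linarith)
    have hlarge : ∀ᶠ n : ℕ in atTop, r / r₀ < Real.exp (c * n) := by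
      have : Tendsto (fun n : ℕ => Real.exp (c * n)) atTop atTop :=
        Real.tendsto_exp_atTop.comp (tendsto_natCast_atTop_atTop.const_mul_atTop hc)
      exact this.eventually_gt_atTop _
    obtain ⟨n, ⟨P, hP, hPc, hd⟩, hn⟩ := (hx.and_eventually hlarge).exists
    have hρ : r / P < r₀ := by
      rw [div_lt_comm₀ hP hr₀]
      exact hn.trans_le hPc
    have hvol := volume_closedBall_diff_le hQm (div_pos hr hP) (hr₀' (r / P) (div_pos hr hP) hρ)
    have hv := B.volume_diff_le_at_hyperbolic_time hQF hr hP hd hvol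
    obtain ⟨j, hj⟩ := exists_int_mem_Ico (B.F^[n] x) 0
    refine ⟨B.F^[n] x + j, ⟨hj.1, by linarith [hj.2]⟩, ?_⟩
    rw [show B.F^[n] x + j - r / 2 = B.F^[n] x - r / 2 + j by ring,
      show B.F^[n] x + j + r / 2 = B.F^[n] x + r / 2 + j by ring,
      volume_Ioo_diff_add_int hQint]
    convert hv using 2
    field_simp
    ring
  choose y hy hyv using key
  obtain ⟨z, -, φ, hφ, hz⟩ := isCompact_Icc.tendsto_subseq hy
  refine ⟨z - r / 4, z + r / 4, by linarith, ?_⟩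
  have ht : Tendsto (fun m => ENNReal.ofReal (4 * r * (1 / ((φ m : ℕ) + 1 : ℝ)))) atTop
      (nhds 0) := by
    rw [← ENNReal.ofReal_zero]
    refine ENNReal.tendsto_ofReal ?_
    have := (tendsto_one_div_add_atTop_nhds_zero_nat (𝕜 := ℝ)).comp hφ.tendsto_atTop
    simpa using this.const_mul (4 * r)
  refine le_antisymm (ge_of_tendsto ht ?_) zero_le
  filter_upwards [hz.eventually (Metric.ball_mem_nhds z (show 0 < r / 4 by positivity))]
    with m hm
  rw [Real.dist_eq, abs_lt] at hm
  simp only [Function.comp_apply] at hm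
  exact (measure_mono (sdiff_subset_sdiff_left
    (Ioo_subset_Ioo (by linarith [hm.1, hm.2]) (by linarith [hm.1, hm.2])))).trans (hyv (φ m))

end BimodData

section Birkhoff

variable {X : Type*}

/-- The maximum of `0` and of the sums of `ψ` along the initial segments of an orbit. -/
def maxPrefix (f : X → X) (ψ : X → ℝ) : ℕ → X → ℝ
  | 0, _ => 0
  | n + 1, x => max 0 (ψ x + maxPrefix f ψ n (f x))

theorem maxPrefix_nonneg (f : X → X) (ψ : X → ℝ) (n : ℕ) (x : X) : 0 ≤ maxPrefix f ψ n x := by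
  cases n with
  | zero => exact le_rfl
  | succ n => exact le_max_left _ _

theorem monotone_maxPrefix (f : X → X) (ψ : X → ℝ) : Monotone (maxPrefix f ψ) := by
  refine monotone_nat_of_le_succ fun n => ?_
  induction n with
  | zero => exact fun x => maxPrefix_nonneg f ψ 1 x
  | succ n ih => exact fun x => max_le_max le_rfl (add_le_add_right (ih (f x)) _)

theorem sum_le_maxPrefix (f : X → X) (ψ : X → ℝ) (n : ℕ) (x : X) :
    ∑ j ∈ Finset.range n, ψ (f^[j] x) ≤ maxPrefix f ψ n x := by
  induction n generalizing x with
  | zero => simp [maxPrefix]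
  | succ n ih =>
    rw [Finset.sum_range_succ']
    refine le_trans ?_ (le_max_right _ _)
    have := ih (f x)
    simp only [Function.iterate_succ_apply, Function.iterate_zero, id_eq]
    linarith

variable [MeasurableSpace X] {ν : Measure X} {f : X → X} {ψ : X → ℝ}

theorem measurable_maxPrefix (hf : Measurable f) (hψ : Measurable ψ) (n : ℕ) :
    Measurable (maxPrefix f ψ n) := by
  induction n with
  | zero => exact measurable_const
  | succ n ih => exact measurable_const.max (hψ.add (ih.comp hf))

theorem integrable_maxPrefix (hf : MeasurePreserving f ν ν) (hψ : Integrable ψ ν) (n : ℕ) :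
    Integrable (maxPrefix f ψ n) ν := by
  induction n with
  | zero => exact integrable_zero X ℝ ν
  | succ n ih =>
    exact (integrable_zero X ℝ ν).sup (hψ.add (hf.integrable_comp_of_integrable ih))

/-- For an ergodic map, the Birkhoff sums of a function of negative integral are almost everywhere
bounded above. -/
theorem ae_exists_sum_le (hf : Ergodic f ν) (hψm : Measurable ψ) (hψ : Integrable ψ ν)
    (hneg : ∫ x, ψ x ∂ν < 0) :
    ∀ᵐ x ∂ν, ∃ K : ℝ, ∀ n, ∑ j ∈ Finset.range n, ψ (f^[j] x) ≤ K := by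
  have hmp := hf.toMeasurePreserving
  set G : Set X := {x | ∃ K : ℕ, ∀ n, maxPrefix f ψ n x ≤ K} with hG
  have hGm : MeasurableSet G := by
    have : G = ⋃ K : ℕ, ⋂ n, {x | maxPrefix f ψ n x ≤ K} := by
      ext x; simp [hG]
    rw [this]
    exact MeasurableSet.iUnion fun K => MeasurableSet.iInter fun n =>
      measurableSet_le (measurable_maxPrefix hf.measurable hψm n) measurable_const
  have hGf : f ⁻¹' G = G := by
    ext x
    constructor
    · rintro ⟨K, hK⟩
      obtain ⟨K', hK'⟩ := exists_nat_ge (|ψ x| + K)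
      refine ⟨K', fun n => ?_⟩
      cases n with
      | zero => exact Nat.cast_nonneg _
      | succ n =>
        refine max_le (Nat.cast_nonneg _) ?_
        linarith [hK n, le_abs_self (ψ x)]
    · rintro ⟨K, hK⟩
      obtain ⟨K', hK'⟩ := exists_nat_ge (|ψ x| + K)
      refine ⟨K', fun n => ?_⟩
      have := (le_max_right _ _).trans (hK (n + 1))
      linarith [neg_abs_le (ψ x)]
  suffices h : ∀ᵐ x ∂ν, x ∈ G by
    filter_upwards [h] with x ⟨K, hK⟩
    exact ⟨K, fun n => (sum_le_maxPrefix f ψ n x).trans (hK n)⟩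
  rcases hf.ae_mem_or_ae_notMem hGm hGf with h | h
  · exact h
  exfalso
  have hintg : ∀ n, Integrable (fun x => maxPrefix f ψ n (f x)) ν := fun n =>
    hmp.integrable_comp_of_integrable (integrable_maxPrefix hmp hψ n)
  have hlim : Tendsto (fun n => ∫ x, (maxPrefix f ψ (n + 1) x - maxPrefix f ψ n (f x)) ∂ν) atTop
      (nhds (∫ x, ψ x ∂ν)) := by
    refine tendsto_integral_of_dominated_convergence (fun x => |ψ x|)
      (fun n => ((integrable_maxPrefix hmp hψ (n + 1)).sub (hintg n)).aestronglyMeasurable)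
      hψ.abs (fun n => ae_of_all _ fun x => ?_) ?_
    · rw [Real.norm_eq_abs, abs_le, maxPrefix]
      have h0 := maxPrefix_nonneg f ψ n (f x)
      refine ⟨?_, ?_⟩
      · linarith [le_max_right 0 (ψ x + maxPrefix f ψ n (f x)), neg_abs_le (ψ x)]
      · rw [sub_le_iff_le_add]
        exact max_le (by positivity) (by linarith [le_abs_self (ψ x)])
    · filter_upwards [h] with x hx
      have hN : ∃ N, 0 < maxPrefix f ψ N x := by
        by_contra hcon
        push Not at hcon
        exact hx ⟨0, fun n => by simpa using hcon n⟩
      obtain ⟨N, hN⟩ := hN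
      refine tendsto_const_nhds.congr' ?_
      filter_upwards [eventually_ge_atTop N] with n hn
      have h1 : 0 < maxPrefix f ψ (n + 1) x :=
        hN.trans_le (monotone_maxPrefix f ψ (by omega : N ≤ n + 1) x)
      rw [maxPrefix] at h1 ⊢
      have h2 : 0 < ψ x + maxPrefix f ψ n (f x) := (lt_max_iff.1 h1).resolve_left (lt_irrefl 0)
      rw [max_eq_right h2.le]
      ring
  refine absurd (ge_of_tendsto' hlim fun n => ?_) (not_le.2 hneg)
  rw [integral_sub (integrable_maxPrefix hmp hψ (n + 1)) (hintg n), sub_nonneg]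
  have h1 : ∫ x, maxPrefix f ψ n (f x) ∂ν = ∫ x, maxPrefix f ψ n x ∂ν := by
    conv_rhs => rw [← hmp.map_eq]
    rw [integral_map hmp.aemeasurable
      (measurable_maxPrefix hf.measurable hψm n).aestronglyMeasurable]
  rw [h1]
  exact integral_mono (integrable_maxPrefix hmp hψ n) (integrable_maxPrefix hmp hψ (n + 1))
    (monotone_maxPrefix f ψ n.le_succ)

variable [IsProbabilityMeasure ν]

theorem ae_eventually_average_le (hf : Ergodic f ν) (hψm : Measurable ψ) (hψ : Integrable ψ ν)
    {ε : ℝ} (hε : 0 < ε) :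
    ∀ᵐ x ∂ν, ∀ᶠ n : ℕ in atTop,
      (∑ j ∈ Finset.range n, ψ (f^[j] x)) / (n : ℝ) ≤ (∫ y, ψ y ∂ν) + ε := by
  set I := ∫ y, ψ y ∂ν with hI
  have hneg : ∫ y, (ψ y - (I + ε / 2)) ∂ν < 0 := by
    rw [integral_sub hψ (integrable_const _)]
    simp only [integral_const, probReal_univ, smul_eq_mul, one_mul]
    linarith
  filter_upwards [ae_exists_sum_le hf (hψm.sub_const (I + ε / 2))
    (hψ.sub (integrable_const _)) hneg] with x ⟨K, hK⟩
  filter_upwards [eventually_gt_atTop 0,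
    (tendsto_natCast_atTop_atTop (R := ℝ)).eventually_ge_atTop (K / (ε / 2))] with n hn hn'
  have h1 := hK n
  rw [Finset.sum_sub_distrib, Finset.sum_const, Finset.card_range, nsmul_eq_mul] at h1
  rw [div_le_iff₀ (by positivity)] at hn'
  rw [div_le_iff₀ (by positivity)]
  linarith

/-- The pointwise ergodic theorem for ergodic maps. -/
theorem ae_tendsto_average (hf : Ergodic f ν) (hψm : Measurable ψ) (hψ : Integrable ψ ν) :
    ∀ᵐ x ∂ν, Tendsto (fun n : ℕ => (∑ j ∈ Finset.range n, ψ (f^[j] x)) / (n : ℝ)) atTop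
      (nhds (∫ y, ψ y ∂ν)) := by
  have h1 : ∀ᵐ x ∂ν, ∀ m : ℕ, ∀ᶠ n : ℕ in atTop,
      (∑ j ∈ Finset.range n, ψ (f^[j] x)) / (n : ℝ) ≤ (∫ y, ψ y ∂ν) + 1 / ((m : ℝ) + 1) :=
    ae_all_iff.2 fun m => ae_eventually_average_le hf hψm hψ (by positivity)
  have h2 : ∀ᵐ x ∂ν, ∀ m : ℕ, ∀ᶠ n : ℕ in atTop,
      (∑ j ∈ Finset.range n, -ψ (f^[j] x)) / (n : ℝ) ≤ (∫ y, -ψ y ∂ν) + 1 / ((m : ℝ) + 1) :=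
    ae_all_iff.2 fun m => ae_eventually_average_le hf hψm.neg hψ.neg (by positivity)
  filter_upwards [h1, h2] with x hx1 hx2
  rw [Metric.tendsto_nhds]
  intro ε hε
  obtain ⟨m, hm⟩ := exists_nat_one_div_lt hε
  filter_upwards [hx1 m, hx2 m] with n hn1 hn2
  rw [Finset.sum_neg_distrib, integral_neg, neg_div] at hn2
  rw [Real.dist_eq, abs_lt]
  constructor <;> linarith

/-- For an ergodic map of a compact metric space, almost every point is generic. -/
theorem ae_forall_tendsto_average [TopologicalSpace X] [CompactSpace X]
    [TopologicalSpace.MetrizableSpace X] [BorelSpace X] (hf : Ergodic f ν) :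
    ∀ᵐ x ∂ν, ∀ φ : C(X, ℝ), Tendsto (fun n : ℕ => (∑ j ∈ Finset.range n, φ (f^[j] x)) / (n : ℝ))
      atTop (nhds (∫ y, φ y ∂ν)) := by
  obtain ⟨D, hDc, hD⟩ := TopologicalSpace.exists_countable_dense C(X, ℝ)
  have hi : ∀ φ : C(X, ℝ), Integrable φ ν := fun φ =>
    φ.continuous.integrable_of_hasCompactSupport (HasCompactSupport.of_compactSpace φ)
  have h : ∀ᵐ x ∂ν, ∀ φ ∈ D,
      Tendsto (fun n : ℕ => (∑ j ∈ Finset.range n, φ (f^[j] x)) / (n : ℝ))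
        atTop (nhds (∫ y, φ y ∂ν)) :=
    (ae_ball_iff hDc).2 fun φ _ => ae_tendsto_average hf φ.continuous.measurable (hi φ)
  filter_upwards [h] with x hx φ
  rw [Metric.tendsto_nhds]
  intro ε hε
  obtain ⟨ψ, hψφ, hψD⟩ := Metric.dense_iff.1 hD φ (ε / 3) (by positivity)
  have hψφ' : ∀ y, |ψ y - φ y| < ε / 3 := fun y => by
    rw [← Real.dist_eq]
    exact (ContinuousMap.dist_apply_le_dist y).trans_lt hψφ
  have hintg : |(∫ y, ψ y ∂ν) - ∫ y, φ y ∂ν| ≤ ε / 3 := by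
    rw [← integral_sub (hi ψ) (hi φ)]
    have := norm_integral_le_of_norm_le_const (μ := ν) (f := fun y => ψ y - φ y) (C := ε / 3)
      (ae_of_all _ fun y => (hψφ' y).le)
    simpa using this
  filter_upwards [Metric.tendsto_nhds.1 (hx ψ hψD) (ε / 3) (by positivity),
    eventually_gt_atTop 0] with n hn hn0
  have hsum : |(∑ j ∈ Finset.range n, ψ (f^[j] x)) / (n : ℝ) -
      (∑ j ∈ Finset.range n, φ (f^[j] x)) / (n : ℝ)| ≤ ε / 3 := by
    rw [← sub_div, ← Finset.sum_sub_distrib, abs_div, Nat.abs_cast, div_le_iff₀ (by positivity)]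
    refine (Finset.abs_sum_le_sum_abs _ _).trans ?_
    refine (Finset.sum_le_sum fun j _ => (hψφ' (f^[j] x)).le).trans ?_
    rw [Finset.sum_const, Finset.card_range, nsmul_eq_mul, mul_comm]
  rw [Real.dist_eq, abs_lt] at *
  rw [abs_le] at hintg hsum
  constructor <;> linarith [hintg.1, hintg.2, hsum.1, hsum.2, hn.1, hn.2]

end Birkhoff

namespace BimodData

variable (B : BimodData)

/-- A set of full measure for an absolutely continuous invariant probability has full Lebesgue
measure, and the density is positive almost everywhere. -/
theorem ae_mem_and_rnDeriv_pos {ν : Measure UnitAddCircle} [IsProbabilityMeasure ν]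
    (hν : ν ≪ volume) (hinv : Measure.map B.f ν = ν) {E : Set UnitAddCircle}
    (hE : MeasurableSet E) (hE1 : ∀ᵐ y ∂ν, y ∈ E) :
    ∀ᵐ y, y ∈ E ∧ 0 < ν.rnDeriv volume y := by
  have hf := B.measurePreserving_f hinv
  set A : Set UnitAddCircle := {y | 0 < ν.rnDeriv volume y} with hA
  have hAm : MeasurableSet A :=
    measurableSet_lt measurable_const (Measure.measurable_rnDeriv ν volume)
  set E' : Set UnitAddCircle := ⋂ n : ℕ, B.f^[n] ⁻¹' (E ∩ A) with hE'
  have hE'm : MeasurableSet E' :=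
    MeasurableSet.iInter fun n => (B.measurable_f.iterate n) (hE.inter hAm)
  have hE'f : E' ⊆ B.f ⁻¹' E' := by
    intro y hy
    simp only [hE', mem_preimage, mem_iInter] at hy ⊢
    intro n
    have := hy (n + 1)
    rwa [Function.iterate_succ_apply] at this
  have hE'1 : ∀ᵐ y ∂ν, y ∈ E' := by
    simp only [hE', mem_iInter]
    rw [ae_all_iff]
    intro n
    exact (hf.iterate n).quasiMeasurePreserving.ae (hE1.and (Measure.rnDeriv_pos hν))
  obtain ⟨a, b, hab, h0⟩ := B.exists_interval_of_forward_invariant hν hinv hE'm hE'f hE'1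
  set Q : Set ℝ := (fun x : ℝ => (x : UnitAddCircle)) ⁻¹' E' with hQ
  have hpos : liftMeasure ν (Ioo a b) ≠ 0 := by
    intro hz
    rw [liftMeasure, withDensity_apply _ measurableSet_Ioo,
      lintegral_eq_zero_iff (measurable_liftDensity ν)] at hz
    have h1 : volume (Ioo a b ∩ Q) = 0 := by
      rw [Filter.EventuallyEq, ae_restrict_iff' measurableSet_Ioo] at hz
      refine measure_mono_null ?_ (ae_iff.1 hz)
      rintro x ⟨hx, hxQ⟩ hx'
      have h2 : 0 < ν.rnDeriv volume (x : UnitAddCircle) := (mem_iInter.1 hxQ 0).2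
      exact h2.ne' (hx' hx)
    have h2 : volume (Ioo a b) = 0 := by
      rw [← inter_union_sdiff (Ioo a b) Q]
      exact measure_union_null h1 h0
    rw [Real.volume_Ioo, ENNReal.ofReal_eq_zero] at h2
    linarith
  have hQ0 : volume Qᶜ = 0 := by
    refine measure_mono_null (t := ⋃ k : ℕ, ⋃ i : ℤ,
      (fun t => B.F^[k] t + i) '' (Ioo a b \ Q)) ?_ ?_
    · intro t ht
      obtain ⟨k, i, y, hy, hyt⟩ := B.exists_iterate_eq_of_pos hν hinv hpos t
      simp only [mem_iUnion]
      refine ⟨k, -i, y, ⟨hy, fun hyQ => ht ?_⟩, by push_cast; linarith⟩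
      have h1 : B.f^[k] (y : UnitAddCircle) ∈ E' := by
        have : ∀ k : ℕ, ∀ z ∈ E', B.f^[k] z ∈ E' := by
          intro k
          induction k with
          | zero => exact fun z hz => hz
          | succ k ih =>
            intro z hz
            rw [Function.iterate_succ_apply]
            exact ih _ (hE'f hz)
        exact this k _ hyQ
      rw [B.f_iterate_coe, hyt, coe_add_int] at h1
      exact h1
    · refine measure_iUnion_null fun k => measure_iUnion_null fun i => ?_
      refine addHaar_image_eq_zero_of_differentiableOn_of_addHaar_eq_zero volume ?_ h0
      exact (((B.contDiff_iterate k).differentiable (by norm_num)).add_const _).differentiableOn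
  have hfin := isCircleLift_volume.ae_of_ae_coe (p := fun y => y ∈ E') hE'm (ae_iff.2 hQ0)
  filter_upwards [hfin] with y hy
  exact mem_iInter.1 hy 0

theorem volume_ac {ν : Measure UnitAddCircle} [IsProbabilityMeasure ν]
    (hν : ν ≪ volume) (hinv : Measure.map B.f ν = ν) : volume ≪ ν := by
  have h := B.ae_mem_and_rnDeriv_pos hν hinv MeasurableSet.univ
    (ae_of_all _ fun _ => mem_univ _)
  rw [← Measure.withDensity_rnDeriv_eq ν volume hν]
  exact withDensity_absolutelyContinuous' (Measure.measurable_rnDeriv ν volume).aemeasurable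
    (h.mono fun y hy => hy.2.ne')

theorem ergodic_f {ν : Measure UnitAddCircle} [IsProbabilityMeasure ν]
    (hν : ν ≪ volume) (hinv : Measure.map B.f ν = ν) : Ergodic B.f ν := by
  have hf := B.measurePreserving_f hinv
  refine { toMeasurePreserving := hf, aeconst_set := fun E hE hEf => ?_ }
  rw [eventuallyConst_set']
  by_cases h0 : ν E = 0
  · exact Or.inl (ae_eq_empty.2 h0)
  right
  have := isProbabilityMeasure_cond h0
  have h := B.ae_mem_and_rnDeriv_pos ((cond_ac E).trans hν) (map_cond_eq hf hE hEf.ge) hE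
    (ProbabilityTheory.ae_cond_mem hE)
  exact ae_eq_univ.2 (ae_iff.1 (hν.ae_le (h.mono fun y hy => hy.1)))

end BimodData

/-- **Theorem A (properties of the invariant measure).** If `f ∈ Bimod` preserves a Borel
probability measure `μ` absolutely continuous with respect to Lebesgue, then: `μ` is the
unique such measure, `μ` is equivalent to Lebesgue, `(f, μ)` is ergodic, `μ` is a global
physical measure, and `μ` is hyperbolic (its Lyapunov exponent `∫ log|Df| dμ` is positive). -/
theorem thmA_properties (B : BimodData) (μ : Measure UnitAddCircle)
    [IsProbabilityMeasure μ] (hac : μ ≪ volume) (hinv : Measure.map B.f μ = μ) :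
    (∀ ν : Measure UnitAddCircle, IsProbabilityMeasure ν → ν ≪ volume →
        Measure.map B.f ν = ν → ν = μ)
    ∧ (μ ≪ volume ∧ volume ≪ μ)
    ∧ Ergodic B.f μ
    ∧ (∀ᵐ x ∂(volume : Measure UnitAddCircle), ∀ φ : C(UnitAddCircle, ℝ),
        Tendsto (fun n : ℕ => (∑ j ∈ Finset.range n, φ (B.f^[j] x)) / (n : ℝ))
          atTop (nhds (∫ y, φ y ∂μ)))
    ∧ 0 < ∫ x, Real.log |B.Df x| ∂μ := by
  have hvol := B.volume_ac hac hinv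
  have herg := B.ergodic_f hac hinv
  exact ⟨fun ν _ hν hνinv =>
      herg.eq_of_absolutelyContinuous (B.measurePreserving_f hνinv) (hν.trans hvol),
    ⟨hac, hvol⟩, herg, hvol.ae_le (ae_forall_tendsto_average herg),
    B.integral_log_Df_pos hac hinv⟩
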